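/- arXiv:1604.06664 — 4 statements merged into one kernel-verified Lean document; each statement's English description precedes it below -/
import Mathlib

section
/- Assume H1. For each d let X^d have density π^d(x) = ∏_{i=1}^d π(x_i) and Z^d be an independent standard d-dimensional Gaussian vector; set ΔV_i^d = V(X_i^d) − V(X_i^d + ℓ d^{−1/2} Z_i^d) and b_i^d = −(ℓ Z_i^d/√d) V̇(X_i^d) + 2 E[ζ^d(X_1^d, Z_1^d)] − (ℓ²/(4d)) V̇(X_i^d)². Then lim_{d→∞} E[ |V̇(X_1^d) · ( 𝒢(ℓ² V̇(X_1^d)²/d, 2 ∑_{i=2}^d ΔV_i^d) − 𝒢(ℓ² V̇(X_1^d)²/d, 2 ∑_{i=2}^d b_i^d) )| ] = 0. -/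
open MeasureTheory ProbabilityTheory Filter Real
open scoped ENNReal NNReal Topology

noncomputable section

/-- The normalized target density `π(x) = exp(-V(x)) / ∫ exp(-V(y)) dy`. -/
def piDen (V : ℝ → ℝ) (x : ℝ) : ℝ := Real.exp (-V x) / ∫ y : ℝ, Real.exp (-V y)

/-- The probability measure on `ℝ` with density `π`. -/
def piMeasure (V : ℝ → ℝ) : Measure ℝ :=
  MeasureTheory.volume.withDensity (fun x => ENNReal.ofReal (piDen V x))

/-- `ζ^d(x,z) = exp((V(x) - V(x + ℓ d^{-1/2} z))/2) - 1`. -/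
def zeta (V : ℝ → ℝ) (ℓ : ℝ) (d : ℕ) (x z : ℝ) : ℝ :=
  Real.exp ((V x - V (x + ℓ * z / Real.sqrt d)) / 2) - 1

/-- The standard normal cumulative distribution function `Φ`. -/
def stdGaussCDF (s : ℝ) : ℝ := (gaussianReal 0 1 (Set.Iic s)).toReal

/-- `ΔV_i^d`-type increment: `V(x) - V(x + ℓ z/√d)`. -/
def dV (V : ℝ → ℝ) (ℓ : ℝ) (d : ℕ) (x z : ℝ) : ℝ := V x - V (x + ℓ * z / Real.sqrt d)

/-- `b^d(x,z) = -(ℓ z/√d) V̇(x) + 2 E[ζ^d(X₁,Z₁)] - (ℓ²/(4d)) V̇(x)²`. -/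
def bFun (V Vdot : ℝ → ℝ) (ℓ : ℝ) (d : ℕ) (x z : ℝ) : ℝ :=
  -(ℓ * z / Real.sqrt d) * Vdot x
    + 2 * (∫ q : ℝ × ℝ, zeta V ℓ d q.1 q.2 ∂((piMeasure V).prod (gaussianReal 0 1)))
    - ℓ ^ 2 / (4 * (d : ℝ)) * (Vdot x) ^ 2

/-- Joint law of `(X^d, Z^d)`: `X^d ∼ π^{⊗d}` independent of `Z^d ∼ N(0, I_d)`. -/
def prodPi (V : ℝ → ℝ) (d : ℕ) : Measure ((Fin d → ℝ) × (Fin d → ℝ)) :=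
  (Measure.pi fun _ : Fin d => piMeasure V).prod
    (Measure.pi fun _ : Fin d => gaussianReal 0 1)

/-- The function `𝒢` of Jourdain–Lelièvre–Miasojedow:
`𝒢(a,b) = exp((a-b)/2) Φ(b/(2√a) - √a)` for `a > 0`, `𝒢(0,b) = exp(-b/2) 1_{b>0}`. -/
def Gfun (a b : ℝ) : ℝ :=
  if 0 < a then Real.exp ((a - b) / 2) * stdGaussCDF (b / (2 * Real.sqrt a) - Real.sqrt a)
  else if 0 < b then Real.exp (-b / 2) else 0

/-- `h(u) = e^{-u/2} 1_{u>0}`. -/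
def hfun (u : ℝ) : ℝ := if 0 < u then Real.exp (-u / 2) else 0

lemma measurable_hfun : Measurable hfun := by
  unfold hfun
  exact Measurable.ite measurableSet_Ioi (by fun_prop) measurable_const

lemma hfun_nonneg (u : ℝ) : 0 ≤ hfun u := by
  unfold hfun; split_ifs <;> positivity

lemma hfun_le_one (u : ℝ) : hfun u ≤ 1 := by
  unfold hfun
  split_ifs with h
  · rw [Real.exp_le_one_iff]; linarith
  · norm_num

lemma exp_lip {u v : ℝ} (hu : 0 < u) (hv : 0 < v) :
    |Real.exp (-u / 2) - Real.exp (-v / 2)| ≤ |u - v| := by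
  have key : ∀ a b : ℝ, 0 < a → a ≤ b →
      |Real.exp (-a / 2) - Real.exp (-b / 2)| ≤ |a - b| := by
    intro a b ha hab
    have h1 : Real.exp (-b / 2) ≤ Real.exp (-a / 2) := Real.exp_le_exp.2 (by linarith)
    have h2 : Real.exp (-b / 2) = Real.exp (-a / 2) * Real.exp (-(b - a) / 2) := by
      rw [← Real.exp_add]; congr 1; ring
    have h3 := Real.add_one_le_exp (-(b - a) / 2)
    have h4 : Real.exp (-a / 2) ≤ 1 := by rw [Real.exp_le_one_iff]; linarith
    have h5 := Real.exp_pos (-a / 2)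
    rw [abs_of_nonneg (by linarith), abs_of_nonpos (by linarith), h2]
    nlinarith
  rcases le_total u v with h | h
  · exact key u v hu h
  · rw [abs_sub_comm, abs_sub_comm u v]; exact key v u hv h

lemma hfun_diff (u v δ : ℝ) (hδ : 0 < δ) :
    |hfun u - hfun v| ≤ δ + (if δ < |u - v| then 1 else 0) + (if |v| ≤ δ then 1 else 0) := by
  have hb : |hfun u - hfun v| ≤ 1 := by
    rw [abs_le]
    constructor <;> linarith [hfun_nonneg u, hfun_nonneg v, hfun_le_one u, hfun_le_one v]
  by_cases h1 : δ < |u - v|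
  · simp only [h1, if_true]; split_ifs <;> linarith
  by_cases h2 : |v| ≤ δ
  · simp only [h2, if_true]; split_ifs; linarith
  simp only [h1, h2, if_false, add_zero]
  push Not at h1 h2
  have h3 := abs_le.1 h1
  rcases lt_abs.1 h2 with h | h
  · have hv : 0 < v := by linarith
    have hu : 0 < u := by linarith
    simp only [hfun, hu, hv, if_true]
    exact (exp_lip hu hv).trans h1
  · have hv : ¬ 0 < v := by linarith
    have hu : ¬ 0 < u := by linarith
    simp only [hfun, hu, hv, if_false]
    simp [hδ.le]

lemma integrable_hfun_comp (b c : ℝ) :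
    Integrable (fun g => hfun (b + c * g)) (gaussianReal 0 1) := by
  refine Integrable.of_bound (C := 1)
    (measurable_hfun.comp (by fun_prop)).aestronglyMeasurable (ae_of_all _ fun g => ?_)
  rw [Real.norm_eq_abs, abs_of_nonneg (hfun_nonneg _)]
  exact hfun_le_one _

lemma Gfun_eq (a b : ℝ) (ha : 0 ≤ a) :
    Gfun a b = ∫ g, hfun (b + 2 * Real.sqrt a * g) ∂(gaussianReal 0 1) := by
  rcases ha.eq_or_lt with rfl | ha
  · simp [Gfun, hfun]
  have hs : 0 < Real.sqrt a := Real.sqrt_pos.2 ha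
  have hsq : Real.sqrt a * Real.sqrt a = a := Real.mul_self_sqrt ha.le
  simp only [Gfun, ha, if_true, stdGaussCDF]
  -- the CDF as a set integral
  have h1 : (gaussianReal 0 1 (Set.Iic (b / (2 * √a) - √a))).toReal
      = ∫ x in Set.Iic (b / (2 * √a) - √a), gaussianPDFReal 0 1 x := by
    rw [gaussianReal_apply_eq_integral _ one_ne_zero, ENNReal.toReal_ofReal]
    exact integral_nonneg fun x => gaussianPDFReal_nonneg _ _ _
  rw [h1, integral_gaussianReal_eq_integral_smul one_ne_zero,
    ← integral_sub_left_eq_self _ volume (-√a), integral_Iic_eq_integral_Iio,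
    ← integral_indicator measurableSet_Iio, ← integral_const_mul]
  congr 1
  ext y
  have hiff : (0 < b + 2 * √a * (-√a - y)) ↔ y < b / (2 * √a) - √a := by
    rw [lt_sub_iff_add_lt, lt_div_iff₀ (by positivity)]
    constructor <;> intro h <;> nlinarith
  by_cases hy : y < b / (2 * √a) - √a
  · have hy' := hiff.2 hy
    simp only [hfun, hy', if_true, Set.indicator, Set.mem_Iio, hy, smul_eq_mul, gaussianPDFReal,
      NNReal.coe_one, mul_one, sub_zero]
    rw [mul_left_comm, mul_assoc, ← Real.exp_add, ← Real.exp_add]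
    congr 2
    nlinarith
  · have hy' : ¬ (0 < b + 2 * √a * (-√a - y)) := fun h => hy (hiff.1 h)
    simp only [hfun, hy', if_false, Set.indicator, Set.mem_Iio, hy, smul_eq_mul, mul_zero]

lemma Gfun_diff (a b b' δ : ℝ) (ha : 0 ≤ a) (hδ : 0 < δ) :
    |Gfun a b - Gfun a b'| ≤ δ + (if δ < |b - b'| then 1 else 0)
      + (if |b'| ≤ 2 * δ then 1 else 0) + 4 * a / δ ^ 2 := by
  rw [Gfun_eq a b ha, Gfun_eq a b' ha,
    ← integral_sub (integrable_hfun_comp _ _) (integrable_hfun_comp _ _)]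
  set c : ℝ := δ + (if δ < |b - b'| then 1 else 0) + (if |b'| ≤ 2 * δ then 1 else 0) with hc
  have hi2 : Integrable (fun g : ℝ => g ^ 2) (gaussianReal 0 1) :=
    (memLp_id_gaussianReal (μ := 0) (v := 1) 2).integrable_sq
  have hE2 : ∫ g : ℝ, g ^ 2 ∂(gaussianReal 0 1) = 1 := by
    have := variance_fun_id_gaussianReal (μ := 0) (v := 1)
    rw [variance_eq_integral (by fun_prop)] at this
    simpa using this
  calc _ ≤ ∫ g, |hfun (b + 2 * √a * g) - hfun (b' + 2 * √a * g)| ∂(gaussianReal 0 1) :=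
        abs_integral_le_integral_abs
    _ ≤ ∫ g, (c + 4 * a / δ ^ 2 * g ^ 2) ∂(gaussianReal 0 1) := by
        refine integral_mono_of_nonneg (ae_of_all _ fun g => abs_nonneg _)
          ((integrable_const _).add (hi2.const_mul _)) (ae_of_all _ fun g => ?_)
        refine (hfun_diff _ _ δ hδ).trans ?_
        have e1 : b + 2 * √a * g - (b' + 2 * √a * g) = b - b' := by ring
        rw [e1]
        have hnn : 0 ≤ 4 * a / δ ^ 2 * g ^ 2 := by positivity
        have hsq : √a ^ 2 = a := Real.sq_sqrt ha
        simp only [hc]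
        by_cases h1 : |b' + 2 * √a * g| ≤ δ
        · by_cases h2 : |b'| ≤ 2 * δ
          · simp only [h1, h2, if_true]; linarith
          · have h3 : δ ≤ |2 * √a * g| := by
              have := abs_sub_abs_le_abs_sub (b' + 2 * √a * g) b'
              have := abs_sub_abs_le_abs_sub b' (b' + 2 * √a * g)
              rw [show b' - (b' + 2 * √a * g) = -(2 * √a * g) by ring, abs_neg] at this
              push Not at h2
              linarith
            have h4 : δ ^ 2 ≤ 4 * a * g ^ 2 := by
              have := pow_le_pow_left₀ hδ.le h3 2
              rw [sq_abs] at this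
              nlinarith
            have h5 : 1 ≤ 4 * a / δ ^ 2 * g ^ 2 := by
              rw [div_mul_eq_mul_div, le_div_iff₀ (by positivity)]; linarith
            simp only [h1, h2, if_true, if_false]; linarith
        · simp only [h1, if_false]
          have : (0:ℝ) ≤ if |b'| ≤ 2 * δ then 1 else 0 := by split_ifs <;> norm_num
          linarith
    _ = c + 4 * a / δ ^ 2 := by
        rw [integral_add (integrable_const _) (hi2.const_mul _), integral_const_mul, hE2]
        simp

lemma law_gauss_sum {n : ℕ} (a : Fin n → ℝ) (S : Finset (Fin n)) :
    (Measure.pi fun _ : Fin n => gaussianReal 0 1).map (fun z => ∑ i ∈ S, a i * z i)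
      = gaussianReal 0 (Real.toNNReal (∑ i ∈ S, a i ^ 2)) := by
  classical
  induction S using Finset.induction_on with
  | empty => simp [Measure.map_const]
  | insert j S hj ih =>
    have hind : iIndepFun (fun (i : Fin n) (z : Fin n → ℝ) => a i * z i)
        (Measure.pi fun _ : Fin n => gaussianReal 0 1) :=
      iIndepFun_pi (X := fun i x => a i * x) (fun i => by fun_prop)
    have h2 := (hind.indepFun_finsetSum_of_notMem (fun i => by fun_prop) hj).symm
    have hX : (Measure.pi fun _ : Fin n => gaussianReal 0 1).map (fun z => a j * z j)
        = gaussianReal 0 (Real.toNNReal (a j ^ 2)) := by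
      have : (fun z : Fin n → ℝ => a j * z j) = (fun x => a j * x) ∘ (fun z => z j) := rfl
      rw [this, ← Measure.map_map (by fun_prop) (by fun_prop),
        (measurePreserving_eval (fun _ : Fin n => gaussianReal 0 1) j).map_eq,
        gaussianReal_map_const_mul]
      simp only [mul_zero, mul_one]
      congr 1
      ext; simp [sq_nonneg]
    have hY : (Measure.pi fun _ : Fin n => gaussianReal 0 1).map
        (∑ i ∈ S, fun z : Fin n → ℝ => a i * z i)
        = gaussianReal 0 (Real.toNNReal (∑ i ∈ S, a i ^ 2)) := by
      rw [← ih]; congr 1; ext z; simp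
    have := gaussianReal_add_gaussianReal_of_indepFun h2 hX hY
    rw [Finset.sum_insert hj, Real.toNNReal_add (by positivity) (by positivity)]
    rw [add_zero] at this
    rw [← this]
    congr 1
    ext z
    simp [Finset.sum_insert hj]

lemma gaussian_small_ball (v : ℝ≥0) (v0 : ℝ) (hv0 : 0 < v0) (hv : v0 ≤ v) (c r : ℝ) :
    gaussianReal 0 v {y | |c + y| ≤ r} ≤ ENNReal.ofReal (2 * r / Real.sqrt v0) := by
  have hvpos : (0:ℝ) < v := hv0.trans_le hv
  have hvne : v ≠ 0 := by
    intro h; rw [h] at hvpos; simp at hvpos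
  have hset : {y : ℝ | |c + y| ≤ r} = Set.Icc (-c - r) (-c + r) := by
    ext y; simp only [Set.mem_ofPred_eq, Set.mem_Icc, abs_le]
    constructor <;> rintro ⟨h1, h2⟩ <;> constructor <;> linarith
  rw [gaussianReal_apply _ hvne, hset]
  calc _ ≤ ∫⁻ x in Set.Icc (-c - r) (-c + r), ENNReal.ofReal (1 / √v0) := by
        refine lintegral_mono fun x => ?_
        refine ENNReal.ofReal_le_ofReal ?_
        rw [gaussianPDFReal_def]
        have h1 : rexp (-(x - 0) ^ 2 / (2 * v)) ≤ 1 := by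
          rw [Real.exp_le_one_iff]
          apply div_nonpos_of_nonpos_of_nonneg
          · nlinarith [sq_nonneg (x - 0)]
          · positivity
        have h2 : √v0 ≤ √(2 * π * v) := by
          apply Real.sqrt_le_sqrt
          nlinarith [Real.pi_gt_three]
        have h3 : 0 < √v0 := Real.sqrt_pos.2 hv0
        calc _ ≤ (√(2 * π * v))⁻¹ * 1 := mul_le_mul_of_nonneg_left h1 (by positivity)
          _ ≤ 1 / √v0 := by rw [mul_one, one_div]; gcongr
    _ = _ := by
        rw [lintegral_const, Measure.restrict_apply MeasurableSet.univ, Set.univ_inter,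
          Real.volume_Icc, ← ENNReal.ofReal_mul (by positivity)]
        congr 1
        ring

lemma gauss_sum_small_ball {n : ℕ} (a : Fin n → ℝ) (S : Finset (Fin n)) (v0 : ℝ) (hv0 : 0 < v0)
    (hv : v0 ≤ ∑ i ∈ S, a i ^ 2) (c r : ℝ) :
    (Measure.pi fun _ : Fin n => gaussianReal 0 1) {z | |c + ∑ i ∈ S, a i * z i| ≤ r}
      ≤ ENNReal.ofReal (2 * r / Real.sqrt v0) := by
  have h := gaussian_small_ball (Real.toNNReal (∑ i ∈ S, a i ^ 2)) v0 hv0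
    (by rw [Real.coe_toNNReal _ (by positivity)]; exact hv) c r
  rw [← law_gauss_sum, Measure.map_apply (by fun_prop)] at h
  · exact h
  · exact measurableSet_le (by fun_prop) (by fun_prop)

/-- Chebyshev for sums over coordinates. -/
lemma cheb_pi (P : Measure ℝ) [IsProbabilityMeasure P] {n : ℕ} (S : Finset (Fin n))
    (f : ℝ × ℝ → ℝ) (hf : MemLp f 2 (P.prod (gaussianReal 0 1))) (t : ℝ) (ht : 0 < t) :
    ((Measure.pi fun _ : Fin n => P).prod (Measure.pi fun _ : Fin n => gaussianReal 0 1))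
      {w | t ≤ |∑ i ∈ S, f (w.1 i, w.2 i) - S.card * ∫ q, f q ∂(P.prod (gaussianReal 0 1))|}
      ≤ ENNReal.ofReal (S.card * (∫ q, f q ^ 2 ∂(P.prod (gaussianReal 0 1))) / t ^ 2) := by
  set μ := P.prod (gaussianReal 0 1) with hμ
  have hmp := measurePreserving_arrowProdEquivProdArrow ℝ ℝ (Fin n) (fun _ => P)
    (fun _ => gaussianReal 0 1)
  rw [← hmp.measure_preimage_equiv]
  set M := Measure.pi fun _ : Fin n => μ with hM
  have hev : ∀ i, MeasurePreserving (fun w : Fin n → ℝ × ℝ => w i) M μ := fun i =>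
    measurePreserving_eval (fun _ : Fin n => μ) i
  have hL : ∀ i, MemLp (fun w : Fin n → ℝ × ℝ => f (w i)) 2 M := fun i =>
    hf.comp_measurePreserving (hev i)
  have hsum : MemLp (∑ i ∈ S, fun w : Fin n → ℝ × ℝ => f (w i)) 2 M :=
    memLp_finsetSum' S fun i _ => hL i
  have hmean : M[∑ i ∈ S, fun w : Fin n → ℝ × ℝ => f (w i)] = S.card * ∫ q, f q ∂μ := by
    simp only [Finset.sum_apply]
    rw [integral_finsetSum _ fun i _ => (hL i).integrable one_le_two]
    rw [Finset.sum_congr rfl fun i _ => ?_, Finset.sum_const, nsmul_eq_mul]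
    rw [← (hev i).map_eq, integral_map (hev i).measurable.aemeasurable]
    rw [(hev i).map_eq]; exact hf.1
  have hvar : variance (∑ i ∈ S, fun w : Fin n → ℝ × ℝ => f (w i)) M
      ≤ S.card * ∫ q, f q ^ 2 ∂μ := by
    rw [IndepFun.variance_sum (fun i _ => hL i) (fun i _ j _ hij =>
      (iIndepFun_pi (X := fun _ : Fin n => f)
        (fun i => hf.1.aemeasurable)).indepFun hij)]
    rw [← nsmul_eq_mul, ← Finset.sum_const]
    refine Finset.sum_le_sum fun i _ => ?_
    refine (variance_le_expectation_sq (hL i).1).trans (le_of_eq ?_)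
    rw [← (hev i).map_eq, integral_map (hev i).measurable.aemeasurable]
    · rfl
    rw [(hev i).map_eq]; exact hf.1.pow 2
  have hch := meas_ge_le_variance_div_sq hsum ht
  rw [hmean] at hch
  refine le_trans (le_of_eq ?_) (hch.trans (ENNReal.ofReal_le_ofReal ?_))
  · congr 1
    ext w
    simp [MeasurableEquiv.arrowProdEquivProdArrow, Equiv.arrowProdEquivProdArrow]
  · gcongr

lemma piMeasure_prob (V : ℝ → ℝ) (hVint : Integrable (fun y => Real.exp (-V y))) :
    IsProbabilityMeasure (piMeasure V) := by
  have hpos : 0 < ∫ y, Real.exp (-V y) := integral_exp_pos hVint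
  constructor
  rw [piMeasure, withDensity_apply _ MeasurableSet.univ, Measure.restrict_univ,
    ← ofReal_integral_eq_lintegral_ofReal]
  · simp only [piDen]
    rw [integral_div, div_self hpos.ne', ENNReal.ofReal_one]
  · exact hVint.div_const _
  · exact ae_of_all _ fun x => div_nonneg (Real.exp_pos _).le hpos.le

/-- Remainder `R(x,z) = V(x) - V(x+sz) + s z V̇(x)`. -/
def Rf (V Vdot : ℝ → ℝ) (s : ℝ) (q : ℝ × ℝ) : ℝ :=
  V q.1 - V (q.1 + s * q.2) + s * q.2 * Vdot q.1

lemma R_fixed (V Vdot : ℝ → ℝ) (hV : Measurable V) (hVdot : Measurable Vdot)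
    [IsProbabilityMeasure (piMeasure V)]
    (p C β : ℝ) (hp : 4 < p) (hC : 0 < C)
    (θ : ℝ)
    (h1 : Integrable (fun x => |V (x + θ) - V x - θ * Vdot x| ^ p) (piMeasure V))
    (h2 : (∫ x, |V (x + θ) - V x - θ * Vdot x| ^ p ∂(piMeasure V)) ^ (1 / p) ≤ C * |θ| ^ β)
    (q : ℕ) (hq0 : q ≠ 0) (hq : (q : ℝ) ≤ p) :
    ∫⁻ x, ENNReal.ofReal (|V (x + θ) - V x - θ * Vdot x| ^ q) ∂(piMeasure V)
      ≤ ENNReal.ofReal ((C * |θ| ^ β) ^ q) := by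
  set f : ℝ → ℝ := fun x => V (x + θ) - V x - θ * Vdot x with hf
  have hfm : Measurable f := by fun_prop
  have hpp : ENNReal.ofReal p ≠ 0 := by
    rw [ENNReal.ofReal_ne_zero_iff]; linarith
  have hpt : (ENNReal.ofReal p).toReal = p := ENNReal.toReal_ofReal (by linarith)
  have hmem : MemLp f (ENNReal.ofReal p) (piMeasure V) := by
    rw [← integrable_norm_rpow_iff hfm.aestronglyMeasurable hpp ENNReal.ofReal_ne_top, hpt]
    exact h1
  have hle : eLpNorm f q (piMeasure V) ≤ ENNReal.ofReal (C * |θ| ^ β) := by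
    calc eLpNorm f q (piMeasure V) ≤ eLpNorm f (ENNReal.ofReal p) (piMeasure V) := by
          apply eLpNorm_le_eLpNorm_of_exponent_le _ hfm.aestronglyMeasurable
          rw [← ENNReal.ofReal_natCast]
          exact ENNReal.ofReal_le_ofReal hq
      _ ≤ _ := by
          rw [hmem.eLpNorm_eq_integral_rpow_norm hpp ENNReal.ofReal_ne_top, hpt]
          apply ENNReal.ofReal_le_ofReal
          rw [← one_div]
          exact h2
  rw [eLpNorm_eq_lintegral_rpow_enorm_toReal (by exact_mod_cast hq0) (by simp)] at hle
  have h3 := ENNReal.rpow_le_rpow hle (z := (q:ℝ)) (by positivity)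
  have hq0' : (q:ℝ) ≠ 0 := by exact_mod_cast hq0
  rw [ENNReal.toReal_natCast, ← ENNReal.rpow_mul, one_div, inv_mul_cancel₀ hq0',
    ENNReal.rpow_one, ENNReal.rpow_natCast, ← ENNReal.ofReal_pow (by positivity)] at h3
  refine le_trans (le_of_eq ?_) h3
  congr 1
  ext x
  rw [ENNReal.rpow_natCast, ENNReal.ofReal_pow (abs_nonneg _), Real.enorm_eq_ofReal_abs]

lemma prod_bound (P Q : Measure ℝ) [IsProbabilityMeasure P] [IsProbabilityMeasure Q]
    (F : ℝ × ℝ → ℝ) (hF : Measurable F) (hF0 : ∀ q, 0 ≤ F q) (G : ℝ → ℝ) (hG0 : ∀ z, 0 ≤ G z)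
    (hG : Integrable G Q)
    (h : ∀ z, ∫⁻ x, ENNReal.ofReal (F (x, z)) ∂P ≤ ENNReal.ofReal (G z)) :
    Integrable F (P.prod Q) ∧ ∫ q, F q ∂(P.prod Q) ≤ ∫ z, G z ∂Q := by
  have key : ∫⁻ q, ENNReal.ofReal (F q) ∂(P.prod Q) ≤ ENNReal.ofReal (∫ z, G z ∂Q) := by
    rw [lintegral_prod_symm' _ (by fun_prop),
      ofReal_integral_eq_lintegral_ofReal hG (ae_of_all _ hG0)]
    exact lintegral_mono h
  have hFint : Integrable F (P.prod Q) := by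
    refine ⟨hF.aestronglyMeasurable, ?_⟩
    rw [hasFiniteIntegral_iff_ofReal (ae_of_all _ hF0)]
    exact key.trans_lt ENNReal.ofReal_lt_top
  refine ⟨hFint, ?_⟩
  rw [← ofReal_integral_eq_lintegral_ofReal hFint (ae_of_all _ hF0)] at key
  exact (ENNReal.ofReal_le_ofReal_iff (integral_nonneg hG0)).1 key

lemma shift_lemma (V : ℝ → ℝ) (hV : Measurable V) (θ : ℝ) (F : ℝ → ℝ) (hF : Measurable F)
    (hF0 : ∀ x, 0 ≤ F x) :
    ∫⁻ x, ENNReal.ofReal (F x * Real.exp (V x - V (x + θ))) ∂(piMeasure V)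
      = ∫⁻ x, ENNReal.ofReal (F (x - θ)) ∂(piMeasure V) := by
  have hd : Measurable (fun x => ENNReal.ofReal (piDen V x)) := by unfold piDen; fun_prop
  have hZ : 0 ≤ ∫ y, Real.exp (-V y) := integral_nonneg fun y => (Real.exp_pos _).le
  have hn : ∀ x, 0 ≤ piDen V x := fun x => div_nonneg (Real.exp_pos _).le hZ
  rw [piMeasure, lintegral_withDensity_eq_lintegral_mul _ hd (by fun_prop),
    lintegral_withDensity_eq_lintegral_mul _ hd (by fun_prop),
    ← lintegral_sub_right_eq_self _ θ]
  refine lintegral_congr fun x => ?_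
  simp only [Pi.mul_apply, sub_add_cancel]
  rw [← ENNReal.ofReal_mul (hn _), ← ENNReal.ofReal_mul (hn _)]
  congr 1
  simp only [piDen]
  have : rexp (-V x) = rexp (-V (x - θ)) * rexp (V (x - θ) - V x) := by
    rw [← Real.exp_add]; congr 1; ring
  rw [this]
  ring

lemma exp_taylor (u : ℝ) :
    |Real.exp u - 1 - u - u ^ 2 / 2| ≤ 3 * |u| ^ 3 * (1 + Real.exp (2 * u)) := by
  have hT : |Real.exp u - 1 - u - u ^ 2 / 2| ≤ |u| ^ 3 * Real.exp |u| := by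
    have h := Complex.norm_exp_sub_sum_le_norm_mul_exp (u : ℂ) 3
    have e : Complex.exp (u : ℂ) - ∑ m ∈ Finset.range 3, (u : ℂ) ^ m / (m.factorial : ℂ)
        = ((Real.exp u - 1 - u - u ^ 2 / 2 : ℝ) : ℂ) := by
      simp only [Finset.sum_range_succ, Finset.range_zero, Finset.sum_empty, Nat.factorial]
      push_cast
      ring
    rw [e, Complex.norm_real, Complex.norm_real] at h
    exact h
  have hp : 0 ≤ |u| ^ 3 := by positivity
  have he := Real.exp_pos (2 * u)
  rcases le_total 0 u with h | h
  · rw [abs_of_nonneg h] at hT hp ⊢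
    have h1 : Real.exp u ≤ Real.exp (2 * u) := Real.exp_le_exp.2 (by linarith)
    nlinarith
  · rcases le_total (-1) u with h1 | h1
    · have h2 : Real.exp |u| ≤ 3 := by
        have : |u| ≤ 1 := by rw [abs_of_nonpos h]; linarith
        exact (Real.exp_le_exp.2 this).trans Real.exp_one_lt_three.le
      nlinarith
    · have h2 : Real.exp u ≤ 1 := Real.exp_le_one_iff.2 h
      have h3 := Real.exp_pos u
      rw [abs_of_nonpos h] at hp ⊢
      have h4 : |Real.exp u - 1 - u - u ^ 2 / 2| ≤ 3 * (-u) ^ 3 := by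
        obtain ⟨y, rfl⟩ : ∃ y, u = -y := ⟨-u, by ring⟩
        rw [neg_neg]
        have hy : 1 ≤ y := by linarith
        have a1 : y ≤ y ^ 2 := by nlinarith
        have a2 : y ^ 2 ≤ y ^ 3 := by nlinarith [sq_nonneg y]
        rw [abs_le]; constructor <;> nlinarith
      nlinarith

lemma integrable_abs_rpow_gauss (r : ℝ) (hr : 0 < r) :
    Integrable (fun z : ℝ => |z| ^ r) (gaussianReal 0 1) := by
  have := (memLp_id_gaussianReal' (μ := 0) (v := 1) (ENNReal.ofReal r)
    ENNReal.ofReal_ne_top).integrable_norm_rpow (by simpa using hr) ENNReal.ofReal_ne_top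
  simpa [ENNReal.toReal_ofReal hr.le] using this

lemma gauss_sq : Integrable (fun g : ℝ => g ^ 2) (gaussianReal 0 1) ∧
    ∫ g : ℝ, g ^ 2 ∂(gaussianReal 0 1) = 1 := by
  refine ⟨(memLp_id_gaussianReal (μ := 0) (v := 1) 2).integrable_sq, ?_⟩
  have := variance_fun_id_gaussianReal (μ := 0) (v := 1)
  rw [variance_eq_integral (by fun_prop)] at this
  simpa using this

lemma Vdot_memLp (Vdot : ℝ → ℝ) (hVdot : Measurable Vdot) (P : Measure ℝ)
    (h : Integrable (fun x => |Vdot x| ^ (6 : ℝ)) P) : MemLp Vdot 6 P := by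
  rw [← integrable_norm_rpow_iff hVdot.aestronglyMeasurable (by norm_num) (by norm_num)]
  simpa using h

lemma Vdot_pow (Vdot : ℝ → ℝ) (hVdot : Measurable Vdot) (P : Measure ℝ) [IsProbabilityMeasure P]
    (h : Integrable (fun x => |Vdot x| ^ (6 : ℝ)) P) (k : ℕ) (hk : k ≠ 0) (hk6 : k ≤ 6) :
    Integrable (fun x => |Vdot x| ^ k) P := by
  have h1 : MemLp Vdot k P := (Vdot_memLp Vdot hVdot P h).mono_exponent (by exact_mod_cast hk6)
  exact h1.integrable_norm_pow hk

lemma dV_fixed (V Vdot : ℝ → ℝ) (hV : Measurable V) (hVdot : Measurable Vdot)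
    [IsProbabilityMeasure (piMeasure V)]
    (p C β : ℝ) (hp : 4 < p) (hC : 0 < C)
    (hH1i : ∀ θ : ℝ,
      Integrable (fun x => |V (x + θ) - V x - θ * Vdot x| ^ p) (piMeasure V) ∧
      (∫ x, |V (x + θ) - V x - θ * Vdot x| ^ p ∂(piMeasure V)) ^ (1 / p) ≤ C * |θ| ^ β)
    (hH1ii : Integrable (fun x => |Vdot x| ^ (6 : ℝ)) (piMeasure V)) (θ : ℝ) :
    ∫⁻ x, ENNReal.ofReal (|V (x + θ) - V x| ^ 3) ∂(piMeasure V)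
      ≤ ENNReal.ofReal (4 * ((C * |θ| ^ β) ^ 3
          + |θ| ^ 3 * ∫ x, |Vdot x| ^ 3 ∂(piMeasure V))) := by
  have hR := R_fixed V Vdot hV hVdot p C β hp hC θ (hH1i θ).1 (hH1i θ).2 3 (by norm_num)
    (by norm_num; linarith)
  have hI := Vdot_pow Vdot hVdot _ hH1ii 3 (by norm_num) (by norm_num)
  have hm0 : 0 ≤ ∫ x, |Vdot x| ^ 3 ∂(piMeasure V) := integral_nonneg fun x => by positivity
  calc _ ≤ ∫⁻ x, (ENNReal.ofReal 4 *
        (ENNReal.ofReal (|V (x + θ) - V x - θ * Vdot x| ^ 3) +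
          ENNReal.ofReal (|θ| ^ 3) * ENNReal.ofReal (|Vdot x| ^ 3))) ∂(piMeasure V) := by
        refine lintegral_mono fun x => ?_
        simp only
        rw [← ENNReal.ofReal_mul (by positivity), ← ENNReal.ofReal_add (by positivity)
          (by positivity), ← ENNReal.ofReal_mul (by positivity)]
        apply ENNReal.ofReal_le_ofReal
        have h1 : |V (x + θ) - V x| ≤ |V (x + θ) - V x - θ * Vdot x| + |θ| * |Vdot x| := by
          rw [← abs_mul]
          have := abs_add_le (V (x + θ) - V x - θ * Vdot x) (θ * Vdot x)
          simpa using this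
        have ha : 0 ≤ |V (x + θ) - V x - θ * Vdot x| := abs_nonneg _
        have hb : 0 ≤ |θ| * |Vdot x| := by positivity
        rw [← mul_pow]
        generalize |V (x + θ) - V x - θ * Vdot x| = a at *
        generalize |θ| * |Vdot x| = b at *
        calc _ ≤ (a + b) ^ 3 := by gcongr
          _ ≤ _ := by nlinarith [mul_nonneg (add_nonneg ha hb) (sq_nonneg (a - b))]
    _ = ENNReal.ofReal 4 * (∫⁻ x, ENNReal.ofReal (|V (x + θ) - V x - θ * Vdot x| ^ 3)
          ∂(piMeasure V) + ENNReal.ofReal (|θ| ^ 3) *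
          ∫⁻ x, ENNReal.ofReal (|Vdot x| ^ 3) ∂(piMeasure V)) := by
        rw [lintegral_const_mul _ (by fun_prop), lintegral_add_left (by fun_prop),
          lintegral_const_mul _ (by fun_prop)]
    _ ≤ _ := by
        rw [← ofReal_integral_eq_lintegral_ofReal hI (ae_of_all _ fun x => by positivity),
          ENNReal.ofReal_mul (by positivity), ENNReal.ofReal_add (by positivity) (by positivity),
          ENNReal.ofReal_mul (p := |θ| ^ 3) (by positivity)]
        gcongr

lemma key_lemma
    (V Vdot : ℝ → ℝ) (hV : Measurable V) (hVdot : Measurable Vdot)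
    [IsProbabilityMeasure (piMeasure V)]
    (p C β : ℝ) (hp : 4 < p) (hC : 0 < C) (hβ : 1 < β)
    (hH1i : ∀ θ : ℝ,
      Integrable (fun x => |V (x + θ) - V x - θ * Vdot x| ^ p) (piMeasure V) ∧
      (∫ x, |V (x + θ) - V x - θ * Vdot x| ^ p ∂(piMeasure V)) ^ (1 / p) ≤ C * |θ| ^ β)
    (hH1ii : Integrable (fun x => |Vdot x| ^ (6 : ℝ)) (piMeasure V)) :
    ∃ φ : ℝ → ℝ, Tendsto φ (𝓝[>] 0) (𝓝 0) ∧ ∀ s : ℝ, 0 < s →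
      MemLp (Rf V Vdot s) 2 ((piMeasure V).prod (gaussianReal 0 1)) ∧
      ∫ q, Rf V Vdot s q ^ 2 ∂((piMeasure V).prod (gaussianReal 0 1)) ≤ s ^ 2 * φ s ∧
      |∫ q, Rf V Vdot s q ∂((piMeasure V).prod (gaussianReal 0 1))
        - 2 * ∫ q : ℝ × ℝ, (Real.exp ((V q.1 - V (q.1 + s * q.2)) / 2) - 1)
            ∂((piMeasure V).prod (gaussianReal 0 1))
        + s ^ 2 / 4 * ∫ x, Vdot x ^ 2 ∂(piMeasure V)| ≤ s ^ 2 * φ s := by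
  set P := piMeasure V with hP
  set γ := gaussianReal 0 1 with hγ
  set m2 := ∫ x, Vdot x ^ 2 ∂P with hm2
  set m3 := ∫ x, |Vdot x| ^ 3 ∂P with hm3
  have hm2n : 0 ≤ m2 := integral_nonneg fun x => by positivity
  have hm3n : 0 ≤ m3 := integral_nonneg fun x => by positivity
  set κ2 := ∫ z, |z| ^ (β * 2) ∂γ with hκ2
  set κ3 := ∫ z, |z| ^ (β * 3) ∂γ with hκ3
  set κ := ∫ z, |z| ^ (3 : ℝ) ∂γ with hκ
  have hκ2n : 0 ≤ κ2 := integral_nonneg fun x => by positivity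
  have hκ3n : 0 ≤ κ3 := integral_nonneg fun x => by positivity
  have hκn : 0 ≤ κ := integral_nonneg fun x => by positivity
  have hi2 := integrable_abs_rpow_gauss (β * 2) (by linarith)
  have hi3 := integrable_abs_rpow_gauss (β * 3) (by linarith)
  have hi := integrable_abs_rpow_gauss 3 (by norm_num)
  refine ⟨fun s => C ^ 2 * κ2 * s ^ (2 * (β - 1)) + (1 / 4) * (C ^ 2 * κ2) * s ^ (2 * (β - 1))
    + (1 / 4) * (C ^ 2 * κ2 + m2) * s ^ (β - 1)
    + 16 * (C ^ 3 * κ3 * s ^ (3 * (β - 1) + 1) + κ * m3 * s), ?_, ?_⟩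
  · have t1 : ∀ r : ℝ, 0 < r → Tendsto (fun s : ℝ => s ^ r) (𝓝[>] 0) (𝓝 0) := by
      intro r hr
      have := (Real.continuousAt_rpow_const 0 r (Or.inr hr.le)).tendsto
      rw [Real.zero_rpow hr.ne'] at this
      exact this.mono_left nhdsWithin_le_nhds
    have t0 : Tendsto (fun s : ℝ => s) (𝓝[>] 0) (𝓝 0) := tendsto_id.mono_left nhdsWithin_le_nhds
    have := ((((t1 (2 * (β - 1)) (by linarith)).const_mul (C ^ 2 * κ2)).add
      ((t1 (2 * (β - 1)) (by linarith)).const_mul ((1 / 4) * (C ^ 2 * κ2)))).add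
      ((t1 (β - 1) (by linarith)).const_mul ((1 / 4) * (C ^ 2 * κ2 + m2)))).add
      ((((t1 (3 * (β - 1) + 1) (by linarith)).const_mul (C ^ 3 * κ3)).add
        (t0.const_mul (κ * m3))).const_mul 16)
    simpa using this
  intro s hs
  set μ := P.prod γ with hμ
  -- abs powers
  have hab : ∀ (z : ℝ) (k : ℕ), (C * |s * z| ^ β) ^ k = C ^ k * s ^ (β * k) * |z| ^ (β * k) := by
    intro z k
    rw [abs_mul, abs_of_pos hs, Real.mul_rpow hs.le (abs_nonneg _), mul_pow, mul_pow,
      ← Real.rpow_mul_natCast hs.le, ← Real.rpow_mul_natCast (abs_nonneg _), mul_assoc]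
  have hRm : Measurable (Rf V Vdot s) := by unfold Rf; fun_prop
  -- second moment of R
  have hR2 : Integrable (fun q => Rf V Vdot s q ^ 2) μ ∧
      ∫ q, Rf V Vdot s q ^ 2 ∂μ ≤ ∫ z, C ^ 2 * s ^ (β * 2) * |z| ^ (β * 2) ∂γ := by
    refine prod_bound P γ _ (by fun_prop) (fun q => sq_nonneg _) _ (fun z => by positivity)
      (hi2.const_mul _) fun z => ?_
    have := R_fixed V Vdot hV hVdot p C β hp hC (s * z) (hH1i _).1 (hH1i _).2 2 (by norm_num)
      (by norm_num; linarith)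
    rw [hab] at this
    refine le_trans (le_of_eq ?_) (this.trans (le_of_eq (by norm_num)))
    congr 1
    ext x
    rw [sq_abs]
    congr 1
    simp only [Rf]; ring
  obtain ⟨hR2i, hR2b⟩ := hR2
  rw [integral_const_mul] at hR2b
  have hRL : MemLp (Rf V Vdot s) 2 μ := (memLp_two_iff_integrable_sq hRm.aestronglyMeasurable).2 hR2i
  -- third moments
  have hGint : Integrable (fun z : ℝ => 4 * (C ^ 3 * s ^ (β * 3) * |z| ^ (β * 3)
      + s ^ 3 * |z| ^ (3 : ℝ) * m3)) γ :=
    ((hi3.const_mul _).add ((hi.const_mul _).mul_const _)).const_mul _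
  have hGval : ∫ z : ℝ, 4 * (C ^ 3 * s ^ (β * 3) * |z| ^ (β * 3)
      + s ^ 3 * |z| ^ (3 : ℝ) * m3) ∂γ = 4 * (C ^ 3 * s ^ (β * 3) * κ3 + s ^ 3 * κ * m3) := by
    rw [integral_const_mul, integral_add (hi3.const_mul _) ((hi.const_mul _).mul_const _),
      integral_const_mul, integral_mul_const, integral_const_mul]
  have hGeq : ∀ z : ℝ, 4 * ((C * |s * z| ^ β) ^ 3 + |s * z| ^ 3 * m3)
      = 4 * (C ^ 3 * s ^ (β * 3) * |z| ^ (β * 3) + s ^ 3 * |z| ^ (3 : ℝ) * m3) := by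
    intro z
    rw [hab, abs_mul, mul_pow, abs_of_pos hs]
    norm_num
  have hG0 : ∀ z : ℝ, 0 ≤ 4 * (C ^ 3 * s ^ (β * 3) * |z| ^ (β * 3)
      + s ^ 3 * |z| ^ (3 : ℝ) * m3) := fun z => by positivity
  have hD1 := prod_bound P γ (fun q => |V q.1 - V (q.1 + s * q.2)| ^ 3) (by fun_prop)
    (fun q => by positivity) _ hG0 hGint (fun z => by
      rw [← hGeq]
      refine le_trans (le_of_eq ?_)
        (dV_fixed V Vdot hV hVdot p C β hp hC hH1i hH1ii (s * z))
      congr 1; ext x; rw [abs_sub_comm])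
  have hD2 := prod_bound P γ (fun q => |V q.1 - V (q.1 + s * q.2)| ^ 3 *
      Real.exp (V q.1 - V (q.1 + s * q.2))) (by fun_prop)
    (fun q => by positivity) _ hG0 hGint (fun z => by
      rw [← hGeq]
      simp only
      rw [hP, shift_lemma V hV (s * z) (fun x => |V x - V (x + s * z)| ^ 3) (by fun_prop)
        (fun x => by positivity)]
      have := dV_fixed V Vdot hV hVdot p C β hp hC hH1i hH1ii (-(s * z))
      rw [abs_neg] at this
      refine le_trans (le_of_eq ?_) this
      congr 1; ext x; simp [← sub_eq_add_neg])
  rw [hGval] at hD1 hD2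
  obtain ⟨hD1i, hD1b⟩ := hD1
  obtain ⟨hD2i, hD2b⟩ := hD2
  set T := 4 * (C ^ 3 * s ^ (β * 3) * κ3 + s ^ 3 * κ * m3) with hT
  -- the Taylor remainder
  set ρ : ℝ × ℝ → ℝ := fun q => Real.exp ((V q.1 - V (q.1 + s * q.2)) / 2) - 1
    - (V q.1 - V (q.1 + s * q.2)) / 2 - ((V q.1 - V (q.1 + s * q.2)) / 2) ^ 2 / 2 with hρ
  have hρm : Measurable ρ := by fun_prop
  have hρb : ∀ q, |ρ q| ≤ |V q.1 - V (q.1 + s * q.2)| ^ 3 +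
      |V q.1 - V (q.1 + s * q.2)| ^ 3 * Real.exp (V q.1 - V (q.1 + s * q.2)) := by
    intro q
    have := exp_taylor ((V q.1 - V (q.1 + s * q.2)) / 2)
    rw [mul_div_cancel₀ _ (two_ne_zero), abs_div, abs_two, div_pow |_|] at this
    refine this.trans ?_
    have : 0 ≤ |V q.1 - V (q.1 + s * q.2)| ^ 3 * (1 + Real.exp (V q.1 - V (q.1 + s * q.2))) := by
      positivity
    nlinarith
  have hρi : Integrable ρ μ := (hD1i.add hD2i).mono' hρm.aestronglyMeasurable
    (ae_of_all _ hρb)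
  have hρI : |∫ q, ρ q ∂μ| ≤ T + T := by
    calc _ ≤ ∫ q, |ρ q| ∂μ := abs_integral_le_integral_abs
      _ ≤ _ := integral_mono hρi.abs (hD1i.add hD2i) hρb
      _ ≤ T + T := by
        rw [integral_add' hD1i hD2i]; linarith
  -- the linear part
  have hV6 := Vdot_memLp Vdot hVdot P hH1ii
  have hV2 : Integrable (fun x => Vdot x ^ 2) P := by
    simpa using Vdot_pow Vdot hVdot P hH1ii 2 (by norm_num) (by norm_num)
  have hV1 : Integrable Vdot P := hV6.integrable (by norm_num)
  have hL1i : Integrable (fun q : ℝ × ℝ => s * q.2 * Vdot q.1) μ := by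
    have := (hV1.mul_prod (μ := P) (ν := γ)
      ((memLp_id_gaussianReal (μ := 0) (v := 1) 1).integrable (by norm_num))).const_mul s
    refine this.congr (ae_of_all _ fun q => ?_)
    simp; ring
  have hL1 : ∫ q : ℝ × ℝ, s * q.2 * Vdot q.1 ∂μ = 0 := by
    have : ∀ q : ℝ × ℝ, s * q.2 * Vdot q.1 = s * (Vdot q.1 * q.2) := fun q => by ring
    simp_rw [this]
    rw [integral_const_mul, integral_prod_mul (μ := P) (ν := γ) Vdot (fun z => z), hγ,
      integral_id_gaussianReal]
    simp
  have hL2i : Integrable (fun q : ℝ × ℝ => (s * q.2 * Vdot q.1) ^ 2) μ := by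
    have := (hV2.mul_prod (μ := P) (ν := γ) gauss_sq.1).const_mul (s ^ 2)
    refine this.congr (ae_of_all _ fun q => ?_)
    simp; ring
  have hL2 : ∫ q : ℝ × ℝ, (s * q.2 * Vdot q.1) ^ 2 ∂μ = s ^ 2 * m2 := by
    have : ∀ q : ℝ × ℝ, (s * q.2 * Vdot q.1) ^ 2 = s ^ 2 * (Vdot q.1 ^ 2 * q.2 ^ 2) :=
      fun q => by ring
    simp_rw [this]
    rw [integral_const_mul, integral_prod_mul (μ := P) (ν := γ) (fun x => Vdot x ^ 2)
      (fun z => z ^ 2), hγ, gauss_sq.2, mul_one]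
  have hLL : MemLp (fun q : ℝ × ℝ => s * q.2 * Vdot q.1) 2 μ :=
    (memLp_two_iff_integrable_sq (by fun_prop)).2 hL2i
  have hRLi : Integrable (fun q => Rf V Vdot s q * (s * q.2 * Vdot q.1)) μ :=
    hRL.integrable_mul hLL
  have hRi : Integrable (Rf V Vdot s) μ := hRL.integrable one_le_two
  have hcross : |∫ q, Rf V Vdot s q * (s * q.2 * Vdot q.1) ∂μ|
      ≤ (1 / 2) * ((∫ q, Rf V Vdot s q ^ 2 ∂μ) / s ^ (β - 1) + s ^ (β - 1) * (s ^ 2 * m2)) := by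
    have ht : 0 < s ^ (β - 1) := Real.rpow_pos_of_pos hs _
    set t := s ^ (β - 1)
    calc _ ≤ ∫ q, |Rf V Vdot s q * (s * q.2 * Vdot q.1)| ∂μ := abs_integral_le_integral_abs
      _ ≤ ∫ q, ((1 / 2) * (Rf V Vdot s q ^ 2 / t + t * (s * q.2 * Vdot q.1) ^ 2)) ∂μ := by
          refine integral_mono hRLi.abs (((hR2i.div_const _).add (hL2i.const_mul _)).const_mul _)
            fun q => ?_
          simp only
          generalize Rf V Vdot s q = a
          generalize s * q.2 * Vdot q.1 = b
          rw [abs_mul, ← sq_abs a, ← sq_abs b]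
          generalize |a| = a
          generalize |b| = b
          have : (1 / 2) * (a ^ 2 / t + t * b ^ 2) - a * b = (a - t * b) ^ 2 / (2 * t) := by
            field_simp; ring
          have : 0 ≤ (a - t * b) ^ 2 / (2 * t) := by positivity
          linarith
      _ = _ := by
          rw [integral_const_mul, integral_add (hR2i.div_const _) (hL2i.const_mul _),
            integral_div, integral_const_mul, hL2]
  -- expansion of zeta
  have hz : ∀ q : ℝ × ℝ, Real.exp ((V q.1 - V (q.1 + s * q.2)) / 2) - 1
      = (1 / 2) * Rf V Vdot s q - (1 / 2) * (s * q.2 * Vdot q.1) + (1 / 8) * Rf V Vdot s q ^ 2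
        - (1 / 4) * (Rf V Vdot s q * (s * q.2 * Vdot q.1)) + (1 / 8) * (s * q.2 * Vdot q.1) ^ 2
        + ρ q := by
    intro q; simp only [hρ, Rf]; ring
  have hzI : ∫ q : ℝ × ℝ, (Real.exp ((V q.1 - V (q.1 + s * q.2)) / 2) - 1) ∂μ
      = (1 / 2) * ∫ q, Rf V Vdot s q ∂μ - (1 / 2) * 0 + (1 / 8) * ∫ q, Rf V Vdot s q ^ 2 ∂μ
        - (1 / 4) * ∫ q, (Rf V Vdot s q * (s * q.2 * Vdot q.1)) ∂μ + (1 / 8) * (s ^ 2 * m2)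
        + ∫ q, ρ q ∂μ := by
    simp_rw [hz]
    have i1 := hRi.const_mul (1 / 2 : ℝ)
    have i2 := hL1i.const_mul (1 / 2 : ℝ)
    have i3 := hR2i.const_mul (1 / 8 : ℝ)
    have i4 := hRLi.const_mul (1 / 4 : ℝ)
    have i5 := hL2i.const_mul (1 / 8 : ℝ)
    have j2 : Integrable (fun q : ℝ × ℝ => (1 / 2) * Rf V Vdot s q - (1 / 2) * (s * q.2 * Vdot q.1)) μ :=
      i1.sub i2
    have j3 : Integrable (fun q : ℝ × ℝ => (1 / 2) * Rf V Vdot s q - (1 / 2) * (s * q.2 * Vdot q.1) + (1 / 8) * Rf V Vdot s q ^ 2) μ :=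
      j2.add i3
    have j4 : Integrable (fun q : ℝ × ℝ => (1 / 2) * Rf V Vdot s q - (1 / 2) * (s * q.2 * Vdot q.1) + (1 / 8) * Rf V Vdot s q ^ 2
        - (1 / 4) * (Rf V Vdot s q * (s * q.2 * Vdot q.1))) μ :=
      j3.sub i4
    have j5 : Integrable (fun q : ℝ × ℝ => (1 / 2) * Rf V Vdot s q - (1 / 2) * (s * q.2 * Vdot q.1) + (1 / 8) * Rf V Vdot s q ^ 2
        - (1 / 4) * (Rf V Vdot s q * (s * q.2 * Vdot q.1)) + (1 / 8) * (s * q.2 * Vdot q.1) ^ 2) μ :=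
      j4.add i5
    rw [integral_add j5 hρi, integral_add j4 i5, integral_sub j3 i4, integral_add j2 i3,
      integral_sub i1 i2]
    simp only [integral_const_mul, hL1, hL2]
  -- powers of s
  have e1 : s ^ (β * 2) = s ^ 2 * s ^ (2 * (β - 1)) := by
    rw [← Real.rpow_natCast s 2, ← Real.rpow_add hs]; congr 1; push_cast; ring
  have e2 : s ^ (β * 2) / s ^ (β - 1) = s ^ 2 * s ^ (β - 1) := by
    rw [← Real.rpow_sub hs, ← Real.rpow_natCast s 2, ← Real.rpow_add hs]
    congr 1; push_cast; ring
  have e3 : s ^ (β * 3) = s ^ 2 * s ^ (3 * (β - 1) + 1) := by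
    rw [← Real.rpow_natCast s 2, ← Real.rpow_add hs]; congr 1; push_cast; ring
  have p1 : 0 < s ^ (2 * (β - 1)) := Real.rpow_pos_of_pos hs _
  have p2 : 0 < s ^ (β - 1) := Real.rpow_pos_of_pos hs _
  have p3 : 0 < s ^ (3 * (β - 1) + 1) := Real.rpow_pos_of_pos hs _
  have hI2n : 0 ≤ ∫ q, Rf V Vdot s q ^ 2 ∂μ := integral_nonneg fun q => sq_nonneg _
  have hcr2 : (∫ q, Rf V Vdot s q ^ 2 ∂μ) / s ^ (β - 1) ≤ C ^ 2 * κ2 * (s ^ 2 * s ^ (β - 1)) := by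
    rw [← e2, mul_div_assoc', div_le_div_iff_of_pos_right p2]
    linarith
  rw [e1] at hR2b
  refine ⟨hRL, ?_, ?_⟩
  · have : 0 ≤ s ^ 2 * ((1 / 4) * (C ^ 2 * κ2) * s ^ (2 * (β - 1))
      + (1 / 4) * (C ^ 2 * κ2 + m2) * s ^ (β - 1)
      + 16 * (C ^ 3 * κ3 * s ^ (3 * (β - 1) + 1) + κ * m3 * s)) := by positivity
    simp only
    linarith
  · rw [hzI]
    have hTe : T = s ^ 2 * (4 * (C ^ 3 * κ3 * s ^ (3 * (β - 1) + 1) + κ * m3 * s)) := by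
      rw [hT, e3]; ring
    have q1 : 0 ≤ s ^ 2 * (C ^ 2 * κ2 * s ^ (2 * (β - 1))) := by positivity
    have a1 := abs_le.1 hcross
    have a2 := abs_le.1 hρI
    rw [abs_le]
    simp only
    constructor <;> linarith [a1.1, a1.2, a2.1, a2.2]

instance (V : ℝ → ℝ) [IsProbabilityMeasure (piMeasure V)] (d : ℕ) :
    IsProbabilityMeasure (prodPi V d) := by
  unfold prodPi; infer_instance

/-- The scale `s_d = ℓ/√(d+1)`. -/
def sc (ℓ : ℝ) (d : ℕ) : ℝ := ℓ / Real.sqrt ((d + 1 : ℕ) : ℝ)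

lemma sc_pos (ℓ : ℝ) (hℓ : 0 < ℓ) (d : ℕ) : 0 < sc ℓ d := by
  unfold sc; positivity

lemma sc_sq (ℓ : ℝ) (d : ℕ) : sc ℓ d ^ 2 = ℓ ^ 2 / ((d : ℝ) + 1) := by
  unfold sc
  rw [div_pow, Real.sq_sqrt (by positivity)]; push_cast; rfl

lemma d_sc_sq_le (ℓ : ℝ) (d : ℕ) : d * sc ℓ d ^ 2 ≤ ℓ ^ 2 := by
  rw [sc_sq, mul_div_assoc', div_le_iff₀ (by positivity)]
  nlinarith [sq_nonneg ℓ]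

lemma sc_sq_tendsto (ℓ : ℝ) : Tendsto (fun d => sc ℓ d ^ 2) atTop (𝓝 0) := by
  simp_rw [sc_sq]
  have := (tendsto_one_div_add_atTop_nhds_zero_nat (𝕜 := ℝ)).const_mul (ℓ ^ 2)
  simpa [div_eq_mul_inv] using this

lemma sc_tendsto (ℓ : ℝ) (hℓ : 0 < ℓ) : Tendsto (sc ℓ) atTop (𝓝[>] 0) := by
  rw [tendsto_nhdsWithin_iff]
  refine ⟨?_, Eventually.of_forall fun d => sc_pos ℓ hℓ d⟩
  have := (sc_sq_tendsto ℓ).sqrt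
  simpa [Real.sqrt_sq (sc_pos ℓ hℓ _).le] using this

/-- `E[ζ]` at scale `s`. -/
def Ez (V : ℝ → ℝ) (s : ℝ) : ℝ :=
  ∫ q : ℝ × ℝ, (Real.exp ((V q.1 - V (q.1 + s * q.2)) / 2) - 1)
            ∂((piMeasure V).prod (gaussianReal 0 1))

lemma sc_mul (ℓ : ℝ) (d : ℕ) (z : ℝ) : ℓ * z / Real.sqrt ((d + 1 : ℕ) : ℝ) = sc ℓ d * z := by
  unfold sc; ring

lemma bFun_eq (V Vdot : ℝ → ℝ) (ℓ : ℝ) (d : ℕ) (x z : ℝ) :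
    bFun V Vdot ℓ (d + 1) x z
      = -(sc ℓ d * z) * Vdot x + 2 * Ez V (sc ℓ d) - sc ℓ d ^ 2 / 4 * Vdot x ^ 2 := by
  unfold bFun zeta Ez
  simp_rw [sc_mul, sc_sq]
  push_cast
  congr 2
  rw [div_div, mul_comm]

lemma dV_sub_b (V Vdot : ℝ → ℝ) (ℓ : ℝ) (d : ℕ) (x z : ℝ) :
    dV V ℓ (d + 1) x z - bFun V Vdot ℓ (d + 1) x z
      = (Rf V Vdot (sc ℓ d) (x, z) + sc ℓ d ^ 2 / 4 * Vdot x ^ 2) - 2 * Ez V (sc ℓ d) := by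
  rw [bFun_eq]
  unfold dV Rf
  rw [sc_mul]
  ring

lemma card_S (d : ℕ) : ((Finset.univ.erase (0 : Fin (d + 1))).card : ℝ) = d := by
  simp

lemma int_fst (P : Measure ℝ) [IsProbabilityMeasure P] (f : ℝ → ℝ) :
    ∫ q : ℝ × ℝ, f q.1 ∂(P.prod (gaussianReal 0 1)) = ∫ x, f x ∂P := by
  rw [integral_fun_fst]; simp

lemma Vsq (Vdot : ℝ → ℝ) (hVdot : Measurable Vdot) (P : Measure ℝ) [IsProbabilityMeasure P]
    (h : Integrable (fun x => |Vdot x| ^ (6 : ℝ)) P) :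
    MemLp (fun q : ℝ × ℝ => Vdot q.1 ^ 2) 2 (P.prod (gaussianReal 0 1)) ∧
    ∫ q : ℝ × ℝ, Vdot q.1 ^ 2 ∂(P.prod (gaussianReal 0 1)) = ∫ x, Vdot x ^ 2 ∂P ∧
    ∫ q : ℝ × ℝ, (Vdot q.1 ^ 2) ^ 2 ∂(P.prod (gaussianReal 0 1)) = ∫ x, |Vdot x| ^ 4 ∂P := by
  have e : ∀ x, (Vdot x ^ 2) ^ 2 = |Vdot x| ^ 4 := fun x => by
    rw [show |Vdot x| ^ 4 = (|Vdot x| ^ 2) ^ 2 by ring, sq_abs]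
  refine ⟨?_, int_fst P fun x => Vdot x ^ 2, ?_⟩
  · rw [memLp_two_iff_integrable_sq (by exact ((hVdot.comp measurable_fst).pow_const 2).aestronglyMeasurable)]
    simp_rw [e]
    exact (Vdot_pow Vdot hVdot P h 4 (by norm_num) (by norm_num)).comp_fst _
  · simp_rw [e]
    exact int_fst P fun x => |Vdot x| ^ 4

lemma A1 (V Vdot : ℝ → ℝ) (hVdot : Measurable Vdot)
    [IsProbabilityMeasure (piMeasure V)]
    (hH1ii : Integrable (fun x => |Vdot x| ^ (6 : ℝ)) (piMeasure V))
    (ℓ : ℝ) (hℓ : 0 < ℓ) (φ : ℝ → ℝ) (hφ : Tendsto φ (𝓝[>] 0) (𝓝 0))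
    (h : ∀ s : ℝ, 0 < s →
      MemLp (Rf V Vdot s) 2 ((piMeasure V).prod (gaussianReal 0 1)) ∧
      ∫ q, Rf V Vdot s q ^ 2 ∂((piMeasure V).prod (gaussianReal 0 1)) ≤ s ^ 2 * φ s ∧
      |∫ q, Rf V Vdot s q ∂((piMeasure V).prod (gaussianReal 0 1))
        - 2 * Ez V s
        + s ^ 2 / 4 * ∫ x, Vdot x ^ 2 ∂(piMeasure V)| ≤ s ^ 2 * φ s)
    (δ : ℝ) (hδ : 0 < δ) (ε : ℝ) (hε : 0 < ε) :
    ∀ᶠ d : ℕ in atTop, (prodPi V (d + 1)).real {w |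
      δ < |2 * ∑ i ∈ Finset.univ.erase (0 : Fin (d + 1)), dV V ℓ (d + 1) (w.1 i) (w.2 i)
        - 2 * ∑ i ∈ Finset.univ.erase (0 : Fin (d + 1)),
          bFun V Vdot ℓ (d + 1) (w.1 i) (w.2 i)|} ≤ ε := by
  set P := piMeasure V with hP
  set m4 := ∫ x, |Vdot x| ^ 4 ∂P with hm4
  have hm4n : 0 ≤ m4 := integral_nonneg fun x => by positivity
  have hφd : Tendsto (fun d => φ (sc ℓ d)) atTop (𝓝 0) := hφ.comp (sc_tendsto ℓ hℓ)
  have ev1 : ∀ᶠ d in atTop, ℓ ^ 2 * φ (sc ℓ d) < δ / 4 := by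
    have := hφd.const_mul (ℓ ^ 2)
    rw [mul_zero] at this
    exact this.eventually_lt_const (by positivity)
  have ev2 : ∀ᶠ d in atTop, (2 * ℓ ^ 2 * φ (sc ℓ d) + ℓ ^ 2 / 8 * m4 * sc ℓ d ^ 2) / (δ / 4) ^ 2
      < ε := by
    have := ((hφd.const_mul (2 * ℓ ^ 2)).add
      ((sc_sq_tendsto ℓ).const_mul (ℓ ^ 2 / 8 * m4))).div_const ((δ / 4) ^ 2)
    simp only [mul_zero, add_zero, zero_div] at this
    exact this.eventually_lt_const hε
  filter_upwards [ev1, ev2] with d h1 h2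
  set s := sc ℓ d with hs
  have hspos : 0 < s := sc_pos ℓ hℓ d
  obtain ⟨hL, hsq, hM⟩ := h s hspos
  have hds := d_sc_sq_le ℓ d
  rw [← hs] at hds
  have hφn : 0 ≤ φ s := by
    have : 0 ≤ s ^ 2 * φ s := (abs_nonneg _).trans hM
    exact nonneg_of_mul_nonneg_right this (by positivity)
  obtain ⟨hW, hW2, hW4⟩ := Vsq Vdot hVdot P hH1ii
  set f : ℝ × ℝ → ℝ := fun q => Rf V Vdot s q + s ^ 2 / 4 * Vdot q.1 ^ 2 with hf
  have hWc := hW.const_mul (s ^ 2 / 4)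
  have hfL : MemLp f 2 (P.prod (gaussianReal 0 1)) := hL.add hWc
  have hfm : ∫ q, f q ∂(P.prod (gaussianReal 0 1))
      = ∫ q, Rf V Vdot s q ∂(P.prod (gaussianReal 0 1)) + s ^ 2 / 4 * ∫ x, Vdot x ^ 2 ∂P := by
    rw [hf, integral_add (hL.integrable one_le_two) (hWc.integrable one_le_two),
      integral_const_mul, hW2]
  have hf2 : ∫ q, f q ^ 2 ∂(P.prod (gaussianReal 0 1)) ≤ 2 * (s ^ 2 * φ s)
      + s ^ 4 / 8 * m4 := by
    calc _ ≤ ∫ q, (2 * Rf V Vdot s q ^ 2 + s ^ 4 / 8 * (Vdot q.1 ^ 2) ^ 2)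
          ∂(P.prod (gaussianReal 0 1)) := by
          refine integral_mono hfL.integrable_sq
            ((hL.integrable_sq.const_mul _).add (hW.integrable_sq.const_mul _)) fun q => ?_
          simp only [hf]
          nlinarith [sq_nonneg (Rf V Vdot s q - s ^ 2 / 4 * Vdot q.1 ^ 2)]
      _ = 2 * ∫ q, Rf V Vdot s q ^ 2 ∂(P.prod (gaussianReal 0 1)) + s ^ 4 / 8 * m4 := by
          rw [integral_add (hL.integrable_sq.const_mul _) (hW.integrable_sq.const_mul _),
            integral_const_mul, integral_const_mul, hW4]
      _ ≤ _ := by linarith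
  have hch := cheb_pi P (Finset.univ.erase (0 : Fin (d + 1))) f hfL (δ / 4) (by positivity)
  rw [card_S] at hch
  rw [measureReal_def]
  refine ENNReal.toReal_le_of_le_ofReal hε.le ?_
  refine (measure_mono ?_).trans (hch.trans (ENNReal.ofReal_le_ofReal ?_))
  · intro w hw
    simp only [Set.mem_ofPred_eq] at hw ⊢
    have e1 : ∑ i ∈ Finset.univ.erase (0 : Fin (d + 1)), dV V ℓ (d + 1) (w.1 i) (w.2 i)
        - ∑ i ∈ Finset.univ.erase (0 : Fin (d + 1)), bFun V Vdot ℓ (d + 1) (w.1 i) (w.2 i)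
        = ∑ i ∈ Finset.univ.erase (0 : Fin (d + 1)), f (w.1 i, w.2 i) - d * (2 * Ez V s) := by
      rw [← Finset.sum_sub_distrib, Finset.sum_congr rfl fun i _ => dV_sub_b V Vdot ℓ d _ _,
        Finset.sum_sub_distrib, Finset.sum_const, nsmul_eq_mul, card_S]
    rw [← mul_sub, e1, abs_mul, abs_two] at hw
    set A := ∑ i ∈ Finset.univ.erase (0 : Fin (d + 1)), f (w.1 i, w.2 i)
    have hdM : |d * (∫ q, f q ∂(P.prod (gaussianReal 0 1)) - 2 * Ez V s)| ≤ δ / 4 := by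
      rw [abs_mul, Nat.abs_cast, hfm]
      rw [show ∀ a b c : ℝ, a + b - c = a - c + b by intros; ring]
      calc _ ≤ (d : ℝ) * (s ^ 2 * φ s) := by gcongr
        _ = d * s ^ 2 * φ s := by ring
        _ ≤ ℓ ^ 2 * φ s := by gcongr
        _ ≤ _ := h1.le
    have e2 : A - d * (2 * Ez V s) = (A - d * ∫ q, f q ∂(P.prod (gaussianReal 0 1)))
        + d * (∫ q, f q ∂(P.prod (gaussianReal 0 1)) - 2 * Ez V s) := by ring
    rw [e2] at hw
    have := abs_add_le (A - d * ∫ q, f q ∂(P.prod (gaussianReal 0 1)))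
      (d * (∫ q, f q ∂(P.prod (gaussianReal 0 1)) - 2 * Ez V s))
    linarith
  · refine le_trans ?_ h2.le
    gcongr
    calc (d : ℝ) * ∫ q, f q ^ 2 ∂(P.prod (gaussianReal 0 1))
        ≤ d * (2 * (s ^ 2 * φ s) + s ^ 4 / 8 * m4) := by gcongr
      _ = (d * s ^ 2) * (2 * φ s + s ^ 2 / 8 * m4) := by ring
      _ ≤ ℓ ^ 2 * (2 * φ s + s ^ 2 / 8 * m4) := by gcongr
      _ = _ := by ring

lemma A2 (V Vdot : ℝ → ℝ) (hVdot : Measurable Vdot)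
    [IsProbabilityMeasure (piMeasure V)]
    (hH1ii : Integrable (fun x => |Vdot x| ^ (6 : ℝ)) (piMeasure V))
    (hm2 : 0 < ∫ x, Vdot x ^ 2 ∂(piMeasure V))
    (ℓ : ℝ) (hℓ : 0 < ℓ) (δ : ℝ) (hδ : 0 < δ) (ε : ℝ) (hε : 0 < ε) :
    ∀ᶠ d : ℕ in atTop, (prodPi V (d + 1)).real {w |
      |2 * ∑ i ∈ Finset.univ.erase (0 : Fin (d + 1)),
          bFun V Vdot ℓ (d + 1) (w.1 i) (w.2 i)| ≤ 2 * δ}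
        ≤ ε + 4 * δ / √(ℓ ^ 2 * ∫ x, Vdot x ^ 2 ∂(piMeasure V)) := by
  set P := piMeasure V with hP
  set m4 := ∫ x, |Vdot x| ^ 4 ∂P with hm4
  set m2 := ∫ x, Vdot x ^ 2 ∂P
  have hm4n : 0 ≤ m4 := integral_nonneg fun x => by positivity
  have ev2 : ∀ᶠ d in atTop, ℓ ^ 2 * m4 * sc ℓ d ^ 2 / (ℓ ^ 2 * m2 / 4) ^ 2 < ε := by
    have := ((sc_sq_tendsto ℓ).const_mul (ℓ ^ 2 * m4)).div_const ((ℓ ^ 2 * m2 / 4) ^ 2)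
    simp only [mul_zero, zero_div] at this
    exact this.eventually_lt_const hε
  filter_upwards [ev2, eventually_ge_atTop 1] with d h2 hd1
  set s := sc ℓ d with hs
  have hspos : 0 < s := sc_pos ℓ hℓ d
  have hds := d_sc_sq_le ℓ d
  rw [← hs] at hds
  have hds2 : ℓ ^ 2 / 2 ≤ d * s ^ 2 := by
    have : (1:ℝ) ≤ d := by exact_mod_cast hd1
    rw [hs, sc_sq, mul_div_assoc', div_le_div_iff₀ (by norm_num) (by positivity)]
    nlinarith [sq_nonneg ℓ]
  obtain ⟨hW, hW2, hW4⟩ := Vsq Vdot hVdot P hH1ii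
  have hWc := hW.const_mul (s ^ 2)
  set S := Finset.univ.erase (0 : Fin (d + 1)) with hS
  have hch := cheb_pi P S _ hWc (ℓ ^ 2 * m2 / 4) (by positivity)
  rw [hS, card_S, ← hS, integral_const_mul, hW2] at hch
  have hsqv : ∫ q : ℝ × ℝ, (s ^ 2 * Vdot q.1 ^ 2) ^ 2 ∂(P.prod (gaussianReal 0 1))
      = s ^ 4 * m4 := by
    rw [hm4, ← hW4, ← integral_const_mul]; congr 1; ext q; ring
  rw [hsqv] at hch
  set Bad : Set ((Fin (d + 1) → ℝ) × (Fin (d + 1) → ℝ)) :=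
    {w | ℓ ^ 2 * m2 / 4 ≤ |∑ i ∈ S, s ^ 2 * Vdot (w.1 i) ^ 2 - d * (s ^ 2 * m2)|} with hBad
  set c : (Fin (d + 1) → ℝ) → ℝ := fun x =>
    2 * ∑ i ∈ S, (2 * Ez V s - s ^ 2 / 4 * Vdot (x i) ^ 2) with hc
  have hB : ∀ w : (Fin (d + 1) → ℝ) × (Fin (d + 1) → ℝ),
      2 * ∑ i ∈ S, bFun V Vdot ℓ (d + 1) (w.1 i) (w.2 i)
      = c w.1 + ∑ i ∈ S, (-2 * s * Vdot (w.1 i)) * w.2 i := by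
    intro w
    rw [hc]
    simp only
    rw [Finset.mul_sum, Finset.mul_sum, ← Finset.sum_add_distrib]
    refine Finset.sum_congr rfl fun i _ => ?_
    rw [bFun_eq]; ring
  simp_rw [hB]
  have hcm : Measurable c := by fun_prop
  set E : Set ((Fin (d + 1) → ℝ) × (Fin (d + 1) → ℝ)) :=
    {w | |c w.1 + ∑ i ∈ S, (-2 * s * Vdot (w.1 i)) * w.2 i| ≤ 2 * δ} with hE
  have hEm : MeasurableSet E := measurableSet_le (by fun_prop) (by fun_prop)
  have hBm : MeasurableSet Bad := measurableSet_le (by fun_prop) (by fun_prop)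
  have hBadle : prodPi V (d + 1) Bad ≤ ENNReal.ofReal ε := by
    refine hch.trans (ENNReal.ofReal_le_ofReal (le_trans ?_ h2.le))
    refine div_le_div_of_nonneg_right ?_ (by positivity)
    calc (d : ℝ) * (s ^ 4 * m4) = (d * s ^ 2) * (m4 * s ^ 2) := by ring
      _ ≤ ℓ ^ 2 * (m4 * s ^ 2) := by gcongr
      _ = _ := by ring
  have hGood : prodPi V (d + 1) (E \ Bad) ≤ ENNReal.ofReal (4 * δ / √(ℓ ^ 2 * m2)) := by
    rw [prodPi, Measure.prod_apply (hEm.diff hBm)]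
    calc _ ≤ ∫⁻ _, ENNReal.ofReal (4 * δ / √(ℓ ^ 2 * m2))
          ∂(Measure.pi fun _ : Fin (d + 1) => P) := by
          refine lintegral_mono fun x => ?_
          by_cases hx : ℓ ^ 2 * m2 / 4 ≤ |∑ i ∈ S, s ^ 2 * Vdot (x i) ^ 2 - d * (s ^ 2 * m2)|
          · have : (Prod.mk x ⁻¹' (E \ Bad)) = ∅ := by
              ext z
              simp only [Set.mem_preimage, Set.mem_sdiff, Set.mem_empty_iff_false, iff_false, not_and,
                not_not]
              intro _
              exact hx
            rw [this]; simp
          · have hv : ℓ ^ 2 * m2 ≤ ∑ i ∈ S, (-2 * s * Vdot (x i)) ^ 2 := by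
              push Not at hx
              have h3 := (abs_lt.1 hx).1
              have h4 : ∑ i ∈ S, (-2 * s * Vdot (x i)) ^ 2
                  = 4 * ∑ i ∈ S, s ^ 2 * Vdot (x i) ^ 2 := by
                rw [Finset.mul_sum]; refine Finset.sum_congr rfl fun i _ => by ring
              rw [h4]
              nlinarith
            have := gauss_sum_small_ball (fun i => -2 * s * Vdot (x i)) S _ (by positivity) hv
              (c x) (2 * δ)
            refine (measure_mono ?_).trans (this.trans (le_of_eq (by ring_nf)))
            intro z hz
            exact hz.1
      _ = _ := by simp
  rw [measureReal_def]
  refine ENNReal.toReal_le_of_le_ofReal (by positivity) ?_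
  rw [ENNReal.ofReal_add hε.le (by positivity)]
  calc prodPi V (d + 1) E ≤ prodPi V (d + 1) (Bad ∪ (E \ Bad)) := by
        apply measure_mono; intro w hw
        by_cases h : w ∈ Bad
        · exact Or.inl h
        · exact Or.inr ⟨hw, h⟩
    _ ≤ _ := (measure_union_le _ _).trans (add_le_add hBadle hGood)

lemma mp0 (V : ℝ → ℝ) [IsProbabilityMeasure (piMeasure V)] (d : ℕ) :
    MeasurePreserving (fun w : (Fin (d + 1) → ℝ) × (Fin (d + 1) → ℝ) => w.1 0)
      (prodPi V (d + 1)) (piMeasure V) := by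
  have h1 := measurePreserving_eval (fun _ : Fin (d + 1) => piMeasure V) 0
  have h2 : MeasurePreserving Prod.fst (prodPi V (d + 1))
      (Measure.pi fun _ : Fin (d + 1) => piMeasure V) := by
    unfold prodPi; exact measurePreserving_fst
  exact h1.comp h2

lemma int0 (V : ℝ → ℝ) [IsProbabilityMeasure (piMeasure V)] (d : ℕ) (f : ℝ → ℝ)
    (hf : Integrable f (piMeasure V)) :
    Integrable (fun w : (Fin (d + 1) → ℝ) × (Fin (d + 1) → ℝ) => f (w.1 0)) (prodPi V (d + 1)) ∧
    ∫ w : (Fin (d + 1) → ℝ) × (Fin (d + 1) → ℝ), f (w.1 0) ∂(prodPi V (d + 1))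
      = ∫ x, f x ∂(piMeasure V) := by
  have h := mp0 V d
  refine ⟨h.integrable_comp_of_integrable hf, ?_⟩
  rw [← h.map_eq, integral_map h.measurable.aemeasurable]
  rw [h.map_eq]; exact hf.aestronglyMeasurable

lemma pt_bound (v D η g a K n ia ib : ℝ) (hη : 0 < η)
    (hg : g ≤ η ^ 2 + ia + ib + 4 * a / (η ^ 2) ^ 2) (hia : ia = 0 ∨ ia = 1)
    (hib : ib = 0 ∨ ib = 1) (ha : a = K * v ^ 2 / n) (hv : 0 ≤ v) (hD : D = v * g) :
    D ≤ η ^ 2 * v + 2 * η * v ^ 2 + (ia + ib) / η + 4 * K / (η ^ 4 * n) * v ^ 3 := by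
  have key : v ≤ η * v ^ 2 + 1 / η := by
    rw [← sub_nonneg]
    have : η * v ^ 2 + 1 / η - v = ((η * v - 1 / 2) ^ 2 + 3 / 4) / η := by field_simp; ring
    rw [this]; positivity
  have h0 : 0 ≤ η * v ^ 2 := by positivity
  have one : ∀ i : ℝ, i = 0 ∨ i = 1 → v * i ≤ η * v ^ 2 + i / η := by
    rintro i (rfl | rfl)
    · simpa using h0
    · simpa using key
  have h1 := one ia hia
  have h2 := one ib hib
  have h3 : v * g ≤ v * (η ^ 2 + ia + ib + 4 * a / (η ^ 2) ^ 2) := by gcongr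
  have h4 : v * (4 * a / (η ^ 2) ^ 2) = 4 * K / (η ^ 4 * n) * v ^ 3 := by
    rw [ha, ← pow_mul]; simp only [div_eq_mul_inv, mul_inv]; ring
  rw [hD, ← h4, add_div]
  nlinarith

lemma main_bound (V Vdot : ℝ → ℝ) (hV : Measurable V) (hVdot : Measurable Vdot)
    [IsProbabilityMeasure (piMeasure V)]
    (hH1ii : Integrable (fun x => |Vdot x| ^ (6 : ℝ)) (piMeasure V))
    (ℓ η : ℝ) (hη : 0 < η) (d : ℕ) :
      ∫ w : (Fin (d + 1) → ℝ) × (Fin (d + 1) → ℝ),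
        |Vdot (w.1 0) *
          (Gfun (ℓ ^ 2 * (Vdot (w.1 0)) ^ 2 / ((d : ℝ) + 1))
              (2 * ∑ i ∈ Finset.univ.erase (0 : Fin (d + 1)),
                dV V ℓ (d + 1) (w.1 i) (w.2 i)) -
            Gfun (ℓ ^ 2 * (Vdot (w.1 0)) ^ 2 / ((d : ℝ) + 1))
              (2 * ∑ i ∈ Finset.univ.erase (0 : Fin (d + 1)),
                bFun V Vdot ℓ (d + 1) (w.1 i) (w.2 i)))|
        ∂(prodPi V (d + 1))
      ≤ η ^ 2 * ∫ x, |Vdot x| ∂(piMeasure V) + 2 * η * ∫ x, Vdot x ^ 2 ∂(piMeasure V)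
        + ((prodPi V (d + 1)).real {w |
      η ^ 2 < |2 * ∑ i ∈ Finset.univ.erase (0 : Fin (d + 1)), dV V ℓ (d + 1) (w.1 i) (w.2 i)
        - 2 * ∑ i ∈ Finset.univ.erase (0 : Fin (d + 1)),
          bFun V Vdot ℓ (d + 1) (w.1 i) (w.2 i)|} + (prodPi V (d + 1)).real {w |
      |2 * ∑ i ∈ Finset.univ.erase (0 : Fin (d + 1)),
          bFun V Vdot ℓ (d + 1) (w.1 i) (w.2 i)| ≤ 2 * η ^ 2}) / η
        + 4 * ℓ ^ 2 / (η ^ 4 * ((d : ℝ) + 1)) * ∫ x, |Vdot x| ^ 3 ∂(piMeasure V) := by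
  set Q := prodPi V (d + 1) with hQ
  set A : Set ((Fin (d + 1) → ℝ) × (Fin (d + 1) → ℝ)) := {w |
      η ^ 2 < |2 * ∑ i ∈ Finset.univ.erase (0 : Fin (d + 1)), dV V ℓ (d + 1) (w.1 i) (w.2 i)
        - 2 * ∑ i ∈ Finset.univ.erase (0 : Fin (d + 1)),
          bFun V Vdot ℓ (d + 1) (w.1 i) (w.2 i)|} with hA
  set B : Set ((Fin (d + 1) → ℝ) × (Fin (d + 1) → ℝ)) := {w |
      |2 * ∑ i ∈ Finset.univ.erase (0 : Fin (d + 1)),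
          bFun V Vdot ℓ (d + 1) (w.1 i) (w.2 i)| ≤ 2 * η ^ 2} with hB
  have mA : MeasurableSet A := by
    simp only [hA, bFun_eq, dV]
    exact measurableSet_lt (by fun_prop) (by fun_prop)
  have mB : MeasurableSet B := by
    simp only [hB, bFun_eq]
    exact measurableSet_le (by fun_prop) (by fun_prop)
  have i1 := int0 V d (fun x => |Vdot x|)
    (by simpa using Vdot_pow Vdot hVdot _ hH1ii 1 (by norm_num) (by norm_num))
  have i2 := int0 V d (fun x => Vdot x ^ 2)
    (by simpa using Vdot_pow Vdot hVdot _ hH1ii 2 (by norm_num) (by norm_num))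
  have i3 := int0 V d (fun x => |Vdot x| ^ 3)
    (Vdot_pow Vdot hVdot _ hH1ii 3 (by norm_num) (by norm_num))
  rw [← hQ] at i1 i2 i3
  have iA : Integrable (A.indicator (1 : (Fin (d + 1) → ℝ) × (Fin (d + 1) → ℝ) → ℝ)) Q := (integrable_const (1:ℝ)).indicator mA
  have iB : Integrable (B.indicator (1 : (Fin (d + 1) → ℝ) × (Fin (d + 1) → ℝ) → ℝ)) Q := (integrable_const (1:ℝ)).indicator mB
  have j1 := i1.1.const_mul (η ^ 2)
  have j2 := i2.1.const_mul (2 * η)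
  have j4 := (iA.add iB).div_const η
  have j3 := i3.1.const_mul (4 * ℓ ^ 2 / (η ^ 4 * ((d : ℝ) + 1)))
  have e : ∫ w, (η ^ 2 * |Vdot (w.1 0)| + 2 * η * Vdot (w.1 0) ^ 2
      + (A.indicator (1 : (Fin (d + 1) → ℝ) × (Fin (d + 1) → ℝ) → ℝ) w + B.indicator (1 : (Fin (d + 1) → ℝ) × (Fin (d + 1) → ℝ) → ℝ) w) / η
      + 4 * ℓ ^ 2 / (η ^ 4 * ((d : ℝ) + 1)) * |Vdot (w.1 0)| ^ 3) ∂Q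
      = η ^ 2 * ∫ x, |Vdot x| ∂(piMeasure V) + 2 * η * ∫ x, Vdot x ^ 2 ∂(piMeasure V)
        + (Q.real A + Q.real B) / η
        + 4 * ℓ ^ 2 / (η ^ 4 * ((d : ℝ) + 1)) * ∫ x, |Vdot x| ^ 3 ∂(piMeasure V) := by
    rw [integral_add (by exact (j1.add j2).add j4) j3, integral_add (by exact j1.add j2) (by exact j4),
      integral_add j1 j2,
      integral_const_mul, integral_const_mul, integral_const_mul, integral_div,
      integral_add iA iB, integral_indicator_one mA, integral_indicator_one mB,
      i1.2, i2.2, i3.2]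
  rw [← e]
  refine integral_mono_of_nonneg (Eventually.of_forall fun w => abs_nonneg _)
    (((j1.add j2).add j4).add j3) (Eventually.of_forall fun w => ?_)
  have hg := Gfun_diff (ℓ ^ 2 * (Vdot (w.1 0)) ^ 2 / ((d : ℝ) + 1))
    (2 * ∑ i ∈ Finset.univ.erase (0 : Fin (d + 1)), dV V ℓ (d + 1) (w.1 i) (w.2 i))
    (2 * ∑ i ∈ Finset.univ.erase (0 : Fin (d + 1)), bFun V Vdot ℓ (d + 1) (w.1 i) (w.2 i))
    (η ^ 2) (by positivity) (by positivity)
  have := pt_bound |Vdot (w.1 0)| _ η _ _ (ℓ ^ 2) ((d : ℝ) + 1) (A.indicator (1 : (Fin (d + 1) → ℝ) × (Fin (d + 1) → ℝ) → ℝ) w)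
    (B.indicator (1 : (Fin (d + 1) → ℝ) × (Fin (d + 1) → ℝ) → ℝ) w) hη (hg.trans_eq ?_) ?_ ?_ (by rw [sq_abs]) (abs_nonneg _)
    (abs_mul _ _)
  · rw [sq_abs] at this
    exact this
  · simp only [Set.indicator, hA, hB, Set.mem_ofPred_eq, Pi.one_apply]
  · by_cases h : w ∈ A <;> simp [h]
  · by_cases h : w ∈ B <;> simp [h]

/-- Lemma 10:
`lim_d E[|V̇(X₁)(𝒢(ℓ²V̇(X₁)²/d, 2∑_{i=2}^d ΔV_i^d) - 𝒢(ℓ²V̇(X₁)²/d, 2∑_{i=2}^d b_i^d))|] = 0`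
(stated with dimension `d+1`, first coordinate `0`). -/
theorem stmt_12
    (V Vdot : ℝ → ℝ) (hV : Measurable V) (hVdot : Measurable Vdot)
    (hVint : Integrable (fun y => Real.exp (-V y)))
    (p C β : ℝ) (hp : 4 < p) (hC : 0 < C) (hβ : 1 < β)
    (hH1i : ∀ θ : ℝ,
      Integrable (fun x => |V (x + θ) - V x - θ * Vdot x| ^ p) (piMeasure V) ∧
      (∫ x, |V (x + θ) - V x - θ * Vdot x| ^ p ∂(piMeasure V)) ^ (1 / p) ≤ C * |θ| ^ β)
    (hH1ii : Integrable (fun x => |Vdot x| ^ (6 : ℝ)) (piMeasure V))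
    (ℓ : ℝ) (hℓ : 0 < ℓ) :
    Tendsto (fun d : ℕ =>
      ∫ w : (Fin (d + 1) → ℝ) × (Fin (d + 1) → ℝ),
        |Vdot (w.1 0) *
          (Gfun (ℓ ^ 2 * (Vdot (w.1 0)) ^ 2 / ((d : ℝ) + 1))
              (2 * ∑ i ∈ Finset.univ.erase (0 : Fin (d + 1)),
                dV V ℓ (d + 1) (w.1 i) (w.2 i)) -
            Gfun (ℓ ^ 2 * (Vdot (w.1 0)) ^ 2 / ((d : ℝ) + 1))
              (2 * ∑ i ∈ Finset.univ.erase (0 : Fin (d + 1)),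
                bFun V Vdot ℓ (d + 1) (w.1 i) (w.2 i)))|
        ∂(prodPi V (d + 1)))
      atTop (𝓝 0) := by
  have := piMeasure_prob V hVint
  have hsqint : Integrable (fun x => Vdot x ^ 2) (piMeasure V) := by
    simpa using Vdot_pow Vdot hVdot _ hH1ii 2 (by norm_num) (by norm_num)
  have hm2n : 0 ≤ ∫ x, Vdot x ^ 2 ∂(piMeasure V) := integral_nonneg fun x => sq_nonneg _
  rcases hm2n.eq_or_lt with h0 | hm2
  · have hz : ∀ᵐ x ∂(piMeasure V), Vdot x = 0 := by
      have := (integral_eq_zero_iff_of_nonneg (fun x => sq_nonneg (Vdot x)) hsqint).1 h0.symm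
      filter_upwards [this] with x hx
      simpa using hx
    refine tendsto_const_nhds.congr fun d => ?_
    symm
    refine integral_eq_zero_of_ae ?_
    filter_upwards [(mp0 V d).quasiMeasurePreserving.ae hz] with w hw
    simp [hw]
  obtain ⟨φ, hφ, hk⟩ := key_lemma V Vdot hV hVdot p C β hp hC hβ hH1i hH1ii
  have hm1 : 0 ≤ ∫ x, |Vdot x| ∂(piMeasure V) := integral_nonneg fun x => abs_nonneg _
  have hm3 : 0 ≤ ∫ x, |Vdot x| ^ 3 ∂(piMeasure V) := integral_nonneg fun x => by positivity
  set m1 := ∫ x, |Vdot x| ∂(piMeasure V) with hm1d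
  set m2 := ∫ x, Vdot x ^ 2 ∂(piMeasure V) with hm2d
  set m3 := ∫ x, |Vdot x| ^ 3 ∂(piMeasure V) with hm3d
  set K := 4 / √(ℓ ^ 2 * m2) with hK
  have hKn : 0 ≤ K := by positivity
  rw [Metric.tendsto_atTop']
  intro ε hε
  set K' := m1 + 2 * m2 + 3 + K with hK'
  have hK'p : 0 < K' := by positivity
  set η := min 1 (ε / (2 * K')) with hηd
  have hη : 0 < η := by positivity
  have hη1 : η ≤ 1 := min_le_left _ _
  have hη2 : η * K' < ε := by
    calc η * K' ≤ ε / (2 * K') * K' := by gcongr; exact min_le_right _ _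
      _ = ε / 2 := by field_simp
      _ < ε := by linarith
  have e1 := A1 V Vdot hVdot hH1ii ℓ hℓ φ hφ hk (η ^ 2) (by positivity) (η ^ 2) (by positivity)
  have e2 := A2 V Vdot hVdot hH1ii hm2 ℓ hℓ (η ^ 2) (by positivity) (η ^ 2) (by positivity)
  have e3 : ∀ᶠ d : ℕ in atTop, 4 * ℓ ^ 2 / (η ^ 4 * ((d : ℝ) + 1)) * m3 < η := by
    have := (tendsto_one_div_add_atTop_nhds_zero_nat (𝕜 := ℝ)).const_mul (4 * ℓ ^ 2 / η ^ 4 * m3)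
    rw [mul_zero] at this
    filter_upwards [this.eventually_lt_const hη] with d hd
    refine lt_of_eq_of_lt ?_ hd
    simp only [div_eq_mul_inv, mul_inv]; ring
  obtain ⟨N, hN⟩ := eventually_atTop.1 (e1.and (e2.and e3))
  refine ⟨N, fun d hd => ?_⟩
  obtain ⟨h1, h2, h3⟩ := hN d (le_of_lt hd)
  rw [Real.dist_eq, sub_zero, abs_of_nonneg (integral_nonneg fun w => abs_nonneg _)]
  have hb := main_bound V Vdot hV hVdot hH1ii ℓ η hη d
  refine hb.trans_lt (lt_of_le_of_lt ?_ hη2)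
  rw [← hm1d, ← hm2d, ← hm3d]
  rw [show 4 * η ^ 2 / √(ℓ ^ 2 * m2) = K * η ^ 2 by rw [hK]; ring] at h2
  have h5 := div_le_div_of_nonneg_right (add_le_add h1 h2) hη.le
  have h6 : (η ^ 2 + (η ^ 2 + K * η ^ 2)) / η = (2 + K) * η := by field_simp; ring
  rw [h6] at h5
  have h7 : η ^ 2 * m1 ≤ η * m1 := by
    have : η ^ 2 ≤ η := by nlinarith
    gcongr
  rw [hK']
  nlinarith
end
end

section
/- Assume G1. Define ξ_θ(x) = √(π(x+θ)) and υ(x,θ) = 1_𝓘(x + rθ) 1_𝓘(x + (1−r)θ). Then there exists a constant C > 0 such that for all θ ∈ ℝ, (∫_𝓘 ( (ξ_θ(x) − ξ_0(x)) υ(x,θ) + θ V̇(x) ξ_0(x)/2 )² dx)^{1/2} ≤ C|θ|^β, where β > 1 is the exponent from G1(i). -/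
open MeasureTheory ProbabilityTheory Filter Real
open scoped ENNReal NNReal Topology

noncomputable section

/-- The normalized target density on the open interval `I`:
`π(x) = exp(-V(x)) 1_I(x) / ∫_I exp(-V(y)) dy`. -/
def piDenI (I : Set ℝ) (V : ℝ → ℝ) (x : ℝ) : ℝ :=
  Set.indicator I (fun y => Real.exp (-V y)) x / ∫ y in I, Real.exp (-V y)

/-- The probability measure on `ℝ` with density `π` supported on `I`. -/
def piMeasureI (I : Set ℝ) (V : ℝ → ℝ) : Measure ℝ :=
  MeasureTheory.volume.withDensity (fun x => ENNReal.ofReal (piDenI I V x))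

/-- Indicator of the event `𝒟_I = {x + rℓz/√d ∈ I} ∩ {x + (1-r)ℓz/√d ∈ I}`. -/
def indD (I : Set ℝ) (r ℓ : ℝ) (d : ℕ) (x z : ℝ) : ℝ :=
  Set.indicator I (fun _ => (1 : ℝ)) (x + r * ℓ * z / Real.sqrt d) *
    Set.indicator I (fun _ => (1 : ℝ)) (x + (1 - r) * ℓ * z / Real.sqrt d)


lemma aux_taylor (s : ℝ) : (exp s - 1 - s) ^ 2 ≤ s ^ 4 * (1 + exp s ^ 2) := by
  have h1 := add_one_le_exp s
  have h2 := add_one_le_exp (-s)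
  have h3 : exp s * exp (-s) = 1 := by rw [← exp_add]; simp
  have hp := exp_pos s
  have hp' := exp_pos (-s)
  have h0 : 0 ≤ exp s - 1 - s := by linarith
  have h4 : exp s * (1 - s) ≤ 1 := by nlinarith
  rcases le_total 0 s with hs | hs
  · have h5 : exp s - 1 - s ≤ s ^ 2 * exp s := by nlinarith
    calc (exp s - 1 - s) ^ 2 ≤ (s ^ 2 * exp s) ^ 2 := pow_le_pow_left₀ h0 h5 2
      _ ≤ _ := by nlinarith [pow_nonneg hs 4]
  · have h5 : exp s - 1 - s ≤ s ^ 2 := by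
      have : 0 ≤ (1 + s + s ^ 2 - exp s) * (1 - s) := by nlinarith [pow_nonneg (neg_nonneg.2 hs) 3]
      have := nonneg_of_mul_nonneg_left this (by linarith)
      linarith
    calc (exp s - 1 - s) ^ 2 ≤ (s ^ 2) ^ 2 := pow_le_pow_left₀ h0 h5 2
      _ ≤ _ := by nlinarith [mul_nonneg (sq_nonneg (s^2)) (sq_nonneg (exp s))]

lemma aux_entropy (u : ℝ) : 2 * (exp (-u / 2) - 1) ^ 2 ≤ (1 - exp (-u / 2) ^ 2) * u := by
  have h1 := add_one_le_exp (-u / 2)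
  have h2 := add_one_le_exp (u / 2)
  have h3 : exp (-u / 2) * exp (u / 2) = 1 := by rw [← exp_add]; simp [neg_div]
  have hp := exp_pos (-u / 2)
  set w := exp (-u / 2)
  rcases le_total 0 u with hs | hs
  · have hw : w ≤ 1 := by
      apply exp_le_one_iff.2; linarith
    have : 2 * (1 - w) ≤ u * (1 + w) := by nlinarith
    nlinarith
  · have hw : 1 ≤ w := by
      apply one_le_exp; linarith
    have h5 : 2 * (w - 1) ≤ w * (-u) := by nlinarith
    have : 2 * (w - 1) ≤ (1 + w) * (-u) := by nlinarith
    nlinarith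

lemma aux_meas (I : Set ℝ) (hIo : IsOpen I) (V : ℝ → ℝ) (hV : Measurable V) :
    Measurable (piDenI I V) := by
  unfold piDenI
  exact ((hV.neg.exp).indicator hIo.measurableSet).div_const _

lemma aux_nonneg (I : Set ℝ) (V : ℝ → ℝ) (x : ℝ) : 0 ≤ piDenI I V x := by
  unfold piDenI
  exact div_nonneg (Set.indicator_nonneg (fun _ _ => (exp_pos _).le) _)
    (integral_nonneg fun _ => (exp_pos _).le)

lemma aux_prob (I : Set ℝ) (hIo : IsOpen I) (hne : I.Nonempty) (V : ℝ → ℝ) (hV : Measurable V)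
    (hVint : IntegrableOn (fun y => Real.exp (-V y)) I) :
    Integrable (piDenI I V) ∧ ∫ x, piDenI I V x = 1 ∧ IsProbabilityMeasure (piMeasureI I V) := by
  have hZ : 0 < ∫ y in I, exp (-V y) := by
    rw [setIntegral_pos_iff_support_of_nonneg_ae (Eventually.of_forall fun _ => (exp_pos _).le) hVint]
    have : (Function.support fun y => exp (-V y)) = Set.univ := by
      ext x; simp [(exp_pos _).ne']
    rw [this, Set.univ_inter]
    exact hIo.measure_pos _ hne
  have h1 : Integrable (piDenI I V) := by
    unfold piDenI
    exact (hVint.integrable_indicator hIo.measurableSet).div_const _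
  have h2 : ∫ x, piDenI I V x = 1 := by
    unfold piDenI
    rw [integral_div, integral_indicator hIo.measurableSet, div_self hZ.ne']
  refine ⟨h1, h2, ⟨?_⟩⟩
  rw [piMeasureI, withDensity_apply _ MeasurableSet.univ, Measure.restrict_univ,
    ← ofReal_integral_eq_lintegral_ofReal h1 (Eventually.of_forall (aux_nonneg I V)), h2]
  simp

lemma aux_int (I : Set ℝ) (hIo : IsOpen I) (V : ℝ → ℝ) (hV : Measurable V) (f : ℝ → ℝ) :
    ∫ x, f x ∂(piMeasureI I V) = ∫ x, piDenI I V x * f x := by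
  rw [piMeasureI, integral_withDensity_eq_integral_toReal_smul
    (aux_meas I hIo V hV).ennreal_ofReal (Eventually.of_forall fun _ => ENNReal.ofReal_lt_top)]
  simp [ENNReal.toReal_ofReal (aux_nonneg I V _)]

lemma aux_intble (I : Set ℝ) (hIo : IsOpen I) (V : ℝ → ℝ) (hV : Measurable V) (f : ℝ → ℝ) :
    Integrable f (piMeasureI I V) ↔ Integrable (fun x => piDenI I V x * f x) := by
  rw [piMeasureI, integrable_withDensity_iff_integrable_smul'
    (aux_meas I hIo V hV).ennreal_ofReal (Eventually.of_forall fun _ => ENNReal.ofReal_lt_top)]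
  simp [ENNReal.toReal_ofReal (aux_nonneg I V _)]

/-- From an `L^p` bound to a `MemLp` statement. -/
lemma aux_lp (μ : Measure ℝ) (f : ℝ → ℝ) (hf : Measurable f) (p B : ℝ)
    (hp : 0 < p) (hi : Integrable (fun x => |f x| ^ p) μ)
    (hB : (∫ x, |f x| ^ p ∂μ) ^ (1 / p) ≤ B) :
    MemLp f (ENNReal.ofReal p) μ ∧ eLpNorm f (ENNReal.ofReal p) μ ≤ ENNReal.ofReal B := by
  have hp0 : ENNReal.ofReal p ≠ 0 := by simpa using hp
  have hm : MemLp f (ENNReal.ofReal p) μ := by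
    rw [← integrable_norm_rpow_iff hf.aestronglyMeasurable hp0 ENNReal.ofReal_ne_top]
    simpa [ENNReal.toReal_ofReal hp.le] using hi
  refine ⟨hm, ?_⟩
  rw [hm.eLpNorm_eq_integral_rpow_norm hp0 ENNReal.ofReal_ne_top]
  apply ENNReal.ofReal_le_ofReal
  simpa [ENNReal.toReal_ofReal hp.le] using hB

lemma aux_even (μ : Measure ℝ) (f : ℝ → ℝ) (n : ℕ) (hn : Even n) (hn0 : n ≠ 0) (B : ℝ) (hB0 : 0 ≤ B)
    (hm : MemLp f n μ) (hB : eLpNorm f n μ ≤ ENNReal.ofReal B) :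
    Integrable (fun x => f x ^ n) μ ∧ ∫ x, f x ^ n ∂μ ≤ B ^ n := by
  have hn0' : (n : ℝ≥0∞) ≠ 0 := by exact_mod_cast hn0
  have h1 := hm.integrable_norm_rpow hn0' (by simp)
  rw [hm.eLpNorm_eq_integral_rpow_norm hn0' (by simp), ENNReal.ofReal_le_ofReal_iff hB0] at hB
  simp only [ENNReal.toReal_natCast, Real.norm_eq_abs, rpow_natCast, hn.pow_abs] at h1 hB
  refine ⟨h1, ?_⟩
  have h0 : 0 ≤ ∫ x, f x ^ n ∂μ := integral_nonneg fun x => hn.pow_nonneg _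
  have h2 := pow_le_pow_left₀ (rpow_nonneg h0 _) hB n
  rwa [rpow_inv_natCast_pow h0 hn0] at h2

/-- The truncated increment of `V`. -/
def auxU (I : Set ℝ) (V : ℝ → ℝ) (r θ x : ℝ) : ℝ :=
  (V (x + θ) - V x) * Set.indicator I (fun _ => (1 : ℝ)) (x + r * θ) *
    Set.indicator I (fun _ => (1 : ℝ)) (x + (1 - r) * θ)

lemma auxU_neg (I : Set ℝ) (V : ℝ → ℝ) (r θ x : ℝ) :
    auxU I V r (-θ) (x + θ) = - auxU I V r θ x := by
  unfold auxU
  have h1 : x + θ + r * -θ = x + (1 - r) * θ := by ring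
  have h2 : x + θ + (1 - r) * -θ = x + r * θ := by ring
  have h3 : x + θ + -θ = x := by ring
  rw [h1, h2, h3]; ring

lemma auxU_meas (I : Set ℝ) (hIo : IsOpen I) (V : ℝ → ℝ) (hV : Measurable V) (r θ : ℝ) :
    Measurable (auxU I V r θ) := by
  have hi : Measurable (Set.indicator I (fun _ => (1 : ℝ))) :=
    measurable_const.indicator hIo.measurableSet
  have h1 := hi.comp (measurable_id.add_const (r * θ))
  have h2 := hi.comp (measurable_id.add_const ((1 - r) * θ))
  have h3 := hV.comp (measurable_id.add_const θ)
  exact ((h3.sub hV).mul h1).mul h2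

lemma aux_cases (I : Set ℝ) (hIoc : I.OrdConnected) (V : ℝ → ℝ) (r : ℝ) (hr : 1 < r) (θ x : ℝ) :
    (Set.indicator I (fun _ => (1 : ℝ)) (x + r * θ) *
      Set.indicator I (fun _ => (1 : ℝ)) (x + (1 - r) * θ) = 0) ∨
    (Set.indicator I (fun _ => (1 : ℝ)) (x + r * θ) = 1 ∧
      Set.indicator I (fun _ => (1 : ℝ)) (x + (1 - r) * θ) = 1 ∧
      sqrt (piDenI I V (x + θ)) = sqrt (piDenI I V x) * exp (-(V (x + θ) - V x) / 2)) := by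
  by_cases h1 : x + r * θ ∈ I
  swap
  · left; simp [h1]
  by_cases h2 : x + (1 - r) * θ ∈ I
  swap
  · left; simp [h2]
  right
  have hx : x ∈ I ∧ x + θ ∈ I := by
    rcases le_total 0 θ with h | h
    · constructor
      · apply hIoc.out h2 h1; constructor <;> nlinarith
      · apply hIoc.out h2 h1; constructor <;> nlinarith
    · constructor
      · apply hIoc.out h1 h2; constructor <;> nlinarith
      · apply hIoc.out h1 h2; constructor <;> nlinarith
  refine ⟨by simp [h1], by simp [h2], ?_⟩
  have : piDenI I V (x + θ) = piDenI I V x * exp (-(V (x + θ) - V x) / 2) ^ 2 := by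
    unfold piDenI
    rw [Set.indicator_of_mem hx.1, Set.indicator_of_mem hx.2, ← exp_nat_mul, div_mul_eq_mul_div,
      ← exp_add]
    congr 2
    push_cast; ring
  rw [this, sqrt_mul (aux_nonneg I V x), sqrt_sq (exp_pos _).le]

lemma aux_pt (I : Set ℝ) (hIoc : I.OrdConnected) (V Vdot : ℝ → ℝ) (r : ℝ) (hr : 1 < r) (θ x : ℝ) :
    ((sqrt (piDenI I V (x + θ)) - sqrt (piDenI I V x)) *
            (Set.indicator I (fun _ => (1 : ℝ)) (x + r * θ) *
              Set.indicator I (fun _ => (1 : ℝ)) (x + (1 - r) * θ)) +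
          θ * Vdot x * sqrt (piDenI I V x) / 2) ^ 2 ≤
      piDenI I V x * (auxU I V r θ x - θ * Vdot x) ^ 2 / 2 +
      (piDenI I V x * auxU I V r θ x ^ 4 +
        piDenI I V (x + θ) * auxU I V r (-θ) (x + θ) ^ 4) / 8 := by
  rw [auxU_neg]
  have hs := sq_sqrt (aux_nonneg I V x)
  have hs' := sq_sqrt (aux_nonneg I V (x + θ))
  rcases aux_cases I hIoc V r hr θ x with h | ⟨h1, h2, h3⟩
  · have hU : auxU I V r θ x = 0 := by rw [auxU, mul_assoc, h, mul_zero]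
    rw [h, hU, ← hs]
    simp only [sqrt_sq (sqrt_nonneg _)]
    nlinarith [sq_nonneg (θ * Vdot x * sqrt (piDenI I V x))]
  · have hU : auxU I V r θ x = V (x + θ) - V x := by rw [auxU, h1, h2]; ring
    rw [hU, h1, h2]
    rw [← hs', ← hs]
    simp only [sqrt_sq (sqrt_nonneg _)]
    rw [h3]
    set a := sqrt (piDenI I V x)
    set u := V (x + θ) - V x
    have ht := aux_taylor (-u / 2)
    set w := exp (-u / 2)
    have e : (a * w - a) * (1 * 1) + θ * Vdot x * a / 2 =
      a * (w - 1 - (-u / 2)) + a * (-(u - θ * Vdot x) / 2) := by ring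
    rw [e]
    have h4 : (a * (w - 1 - (-u / 2)) + a * (-(u - θ * Vdot x) / 2)) ^ 2 ≤
      2 * a ^ 2 * (w - 1 - (-u / 2)) ^ 2 + 2 * (a * (-(u - θ * Vdot x) / 2)) ^ 2 := by
      nlinarith [sq_nonneg (a * (w - 1 - (-u / 2)) - a * (-(u - θ * Vdot x) / 2))]
    have h5 := mul_le_mul_of_nonneg_left ht (by positivity : 0 ≤ 2 * a ^ 2)
    nlinarith

lemma aux_pt2 (I : Set ℝ) (hIoc : I.OrdConnected) (V : ℝ → ℝ) (r : ℝ) (hr : 1 < r) (θ x : ℝ) :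
    2 * ((sqrt (piDenI I V (x + θ)) - sqrt (piDenI I V x)) *
            (Set.indicator I (fun _ => (1 : ℝ)) (x + r * θ) *
              Set.indicator I (fun _ => (1 : ℝ)) (x + (1 - r) * θ))) ^ 2 ≤
      piDenI I V x * auxU I V r θ x + piDenI I V (x + θ) * auxU I V r (-θ) (x + θ) := by
  rw [auxU_neg]
  have hs := sq_sqrt (aux_nonneg I V x)
  have hs' := sq_sqrt (aux_nonneg I V (x + θ))
  rcases aux_cases I hIoc V r hr θ x with h | ⟨h1, h2, h3⟩
  · have hU : auxU I V r θ x = 0 := by rw [auxU, mul_assoc, h, mul_zero]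
    rw [h, hU]; simp
  · have hU : auxU I V r θ x = V (x + θ) - V x := by rw [auxU, h1, h2]; ring
    rw [hU, h1, h2]
    rw [← hs', ← hs]
    simp only [sqrt_sq (sqrt_nonneg _)]
    rw [h3]
    set a := sqrt (piDenI I V x)
    set u := V (x + θ) - V x
    have h5 := mul_le_mul_of_nonneg_left (aux_entropy u) (by positivity : 0 ≤ a ^ 2)
    nlinarith

lemma aux_pt3 (I : Set ℝ) (V Vdot : ℝ → ℝ) (r θ x : ℝ) :
    ((sqrt (piDenI I V (x + θ)) - sqrt (piDenI I V x)) *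
            (Set.indicator I (fun _ => (1 : ℝ)) (x + r * θ) *
              Set.indicator I (fun _ => (1 : ℝ)) (x + (1 - r) * θ)) +
          θ * Vdot x * sqrt (piDenI I V x) / 2) ^ 2 ≤
      2 * (piDenI I V x + piDenI I V (x + θ)) + θ ^ 2 / 2 * (piDenI I V x * Vdot x ^ 2) := by
  have hs := sq_sqrt (aux_nonneg I V x)
  have hs' := sq_sqrt (aux_nonneg I V (x + θ))
  have h0 := sqrt_nonneg (piDenI I V x)
  have h0' := sqrt_nonneg (piDenI I V (x + θ))
  set υ := Set.indicator I (fun _ => (1 : ℝ)) (x + r * θ) *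
              Set.indicator I (fun _ => (1 : ℝ)) (x + (1 - r) * θ) with hυ
  have hv : υ = 0 ∨ υ = 1 := by
    rw [hυ]
    by_cases h1 : x + r * θ ∈ I <;> by_cases h2 : x + (1 - r) * θ ∈ I <;> simp [h1, h2]
  rw [← hs', ← hs]
  simp only [sqrt_sq (sqrt_nonneg _)]
  set a := sqrt (piDenI I V x)
  set b := sqrt (piDenI I V (x + θ))
  have hab : 0 ≤ a * b := by positivity
  rcases hv with h | h <;> rw [h]
  · nlinarith [sq_nonneg (θ * Vdot x * a), sq_nonneg a, sq_nonneg b]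
  · nlinarith [sq_nonneg ((b - a) - θ * Vdot x * a / 2)]

/-- Lemma (DQM on an interval): with `ξ_θ(x) = √(π(x+θ))` and
`υ(x,θ) = 1_I(x+rθ) 1_I(x+(1-r)θ)`,
`(∫_I ((ξ_θ - ξ_0) υ(·,θ) + θ V̇ ξ_0/2)² dx)^{1/2} ≤ C'|θ|^β`. -/
theorem stmt_16
    (I : Set ℝ) (hIo : IsOpen I) (hIoc : I.OrdConnected)
    (V Vdot : ℝ → ℝ) (hV : Measurable V) (hVdot : Measurable Vdot)
    (hVint : IntegrableOn (fun y => Real.exp (-V y)) I)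
    (r : ℝ) (hr : 1 < r)
    (p C β : ℝ) (hp : 4 < p) (hC : 0 < C) (hβ : 1 < β)
    (hG1i : ∀ θ : ℝ,
      Integrable (fun x =>
        |(V (x + θ) - V x) * Set.indicator I (fun _ => (1 : ℝ)) (x + r * θ) *
            Set.indicator I (fun _ => (1 : ℝ)) (x + (1 - r) * θ) -
          θ * Vdot x| ^ p) (piMeasureI I V) ∧
      (∫ x,
        |(V (x + θ) - V x) * Set.indicator I (fun _ => (1 : ℝ)) (x + r * θ) *
            Set.indicator I (fun _ => (1 : ℝ)) (x + (1 - r) * θ) -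
          θ * Vdot x| ^ p ∂(piMeasureI I V)) ^ (1 / p) ≤ C * |θ| ^ β)
    (hG1ii : Integrable (fun x => |Vdot x| ^ (6 : ℝ)) (piMeasureI I V))
    (γ Cγ : ℝ) (hγ : 6 ≤ γ) (hCγ : 0 < Cγ)
    (hG1iii : ∀ θ : ℝ, ((piMeasureI I V) {x | x + θ ∉ I}).toReal ≤ Cγ * |θ| ^ γ)
    (ℓ : ℝ) (hℓ : 0 < ℓ) :
    ∃ C' > 0, ∀ θ : ℝ,
      Real.sqrt (∫ x in I,
        ((Real.sqrt (piDenI I V (x + θ)) - Real.sqrt (piDenI I V x)) *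
            (Set.indicator I (fun _ => (1 : ℝ)) (x + r * θ) *
              Set.indicator I (fun _ => (1 : ℝ)) (x + (1 - r) * θ)) +
          θ * Vdot x * Real.sqrt (piDenI I V x) / 2) ^ 2) ≤ C' * |θ| ^ β := by
  rcases Set.eq_empty_or_nonempty I with hI | hne
  · subst hI
    refine ⟨1, one_pos, fun θ => ?_⟩
    simp only [Measure.restrict_empty, integral_zero_measure, sqrt_zero]
    positivity
  obtain ⟨hπi, hπ1, hprob⟩ := aux_prob I hIo hne V hV hVint
  set μ := piMeasureI I V with hμ
  have hπ0 := aux_nonneg I V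
  -- basic norms
  have hD : ∀ θ, MemLp (fun x => auxU I V r θ x - θ * Vdot x) (ENNReal.ofReal p) μ ∧
      eLpNorm (fun x => auxU I V r θ x - θ * Vdot x) (ENNReal.ofReal p) μ ≤
        ENNReal.ofReal (C * |θ| ^ β) := fun θ =>
    aux_lp μ _ ((auxU_meas I hIo V hV r θ).sub (hVdot.const_mul θ)) p _ (by linarith)
      (hG1i θ).1 (hG1i θ).2
  set K := (∫ x, |Vdot x| ^ (6 : ℝ) ∂μ) ^ (1 / (6 : ℝ)) with hK
  have hK0 : 0 ≤ K := rpow_nonneg (integral_nonneg fun x => rpow_nonneg (abs_nonneg _) _) _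
  have hW := aux_lp μ Vdot hVdot 6 K (by norm_num) hG1ii le_rfl
  have h4p : ((4 : ℕ) : ℝ≥0∞) ≤ ENNReal.ofReal p := by
    rw [← ENNReal.ofReal_natCast]; apply ENNReal.ofReal_le_ofReal; push_cast; linarith
  have h46 : ((4 : ℕ) : ℝ≥0∞) ≤ ENNReal.ofReal 6 := by
    rw [← ENNReal.ofReal_natCast]; apply ENNReal.ofReal_le_ofReal; norm_num
  have hB0 : ∀ θ : ℝ, 0 ≤ C * |θ| ^ β := fun θ => by positivity
  have hD2 : ∀ θ, Integrable (fun x => (auxU I V r θ x - θ * Vdot x) ^ 2) μ ∧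
      ∫ x, (auxU I V r θ x - θ * Vdot x) ^ 2 ∂μ ≤ (C * |θ| ^ β) ^ 2 := fun θ => by
    have h2p : ((2 : ℕ) : ℝ≥0∞) ≤ ENNReal.ofReal p := le_trans (by norm_num) h4p
    exact aux_even μ _ 2 even_two two_ne_zero _ (hB0 θ) ((hD θ).1.mono_exponent h2p)
      ((eLpNorm_le_eLpNorm_of_exponent_le h2p (hD θ).1.aestronglyMeasurable).trans (hD θ).2)
  have hD1 : ∀ θ, Integrable (fun x => auxU I V r θ x - θ * Vdot x) μ ∧
      ∫ x, (auxU I V r θ x - θ * Vdot x) ∂μ ≤ C * |θ| ^ β := fun θ => by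
    have h1p : 1 ≤ ENNReal.ofReal p := le_trans (by norm_num) h4p
    have hm := (hD θ).1.mono_exponent h1p
    have hi := memLp_one_iff_integrable.1 hm
    refine ⟨hi, ?_⟩
    have hle := (eLpNorm_le_eLpNorm_of_exponent_le h1p (hD θ).1.aestronglyMeasurable).trans (hD θ).2
    rw [eLpNorm_one_eq_lintegral_enorm, ← ofReal_integral_norm_eq_lintegral_enorm hi,
      ENNReal.ofReal_le_ofReal_iff (hB0 θ)] at hle
    exact (le_trans (Real.le_norm_self _) (norm_integral_le_integral_norm _)).trans hle
  have hW4 : MemLp Vdot ((4 : ℕ) : ℝ≥0∞) μ := hW.1.mono_exponent h46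
  have hW4b : eLpNorm Vdot ((4 : ℕ) : ℝ≥0∞) μ ≤ ENNReal.ofReal K :=
    (eLpNorm_le_eLpNorm_of_exponent_le h46 hW.1.aestronglyMeasurable).trans hW.2
  have hW1 : Integrable Vdot μ :=
    memLp_one_iff_integrable.1 (hW4.mono_exponent (by norm_num))
  have hW2 : Integrable (fun x => Vdot x ^ 2) μ :=
    (hW4.mono_exponent (p := 2) (by norm_num)).integrable_sq
  have hU1 : ∀ θ, Integrable (auxU I V r θ) μ := fun θ => by
    have := (hD1 θ).1.add (hW1.const_mul θ)
    refine this.congr (Eventually.of_forall fun x => ?_)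
    simp
  have hU4 : ∀ θ, Integrable (fun x => auxU I V r θ x ^ 4) μ ∧
      ∫ x, auxU I V r θ x ^ 4 ∂μ ≤ (C * |θ| ^ β + |θ| * K) ^ 4 := fun θ => by
    have hm1 := (hD θ).1.mono_exponent h4p
    have hm2 := hW4.const_mul θ
    have hle := (eLpNorm_le_eLpNorm_of_exponent_le h4p (hD θ).1.aestronglyMeasurable).trans (hD θ).2
    have he : auxU I V r θ = (fun x => auxU I V r θ x - θ * Vdot x) + (fun x => θ * Vdot x) := by
      ext x; simp
    refine aux_even μ _ 4 (by decide) (by norm_num) _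
      (add_nonneg (hB0 θ) (mul_nonneg (abs_nonneg _) hK0)) ?_ ?_
    · rw [he]; exact hm1.add hm2
    · rw [he]
      refine (eLpNorm_add_le hm1.aestronglyMeasurable hm2.aestronglyMeasurable
        (by norm_num)).trans ?_
      rw [ENNReal.ofReal_add (hB0 θ) (mul_nonneg (abs_nonneg _) hK0),
        ENNReal.ofReal_mul (abs_nonneg _)]
      refine add_le_add hle ?_
      have := eLpNorm_const_smul θ Vdot ((4 : ℕ) : ℝ≥0∞) μ
      rw [show (fun x => θ * Vdot x) = θ • Vdot from rfl, this, ← ofReal_norm,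
        Real.norm_eq_abs]
      gcongr
  -- transfer to Lebesgue
  have hI := aux_int I hIo V hV
  have hIb := aux_intble I hIo V hV
  have hShi : ∀ (f : ℝ → ℝ) (θ : ℝ), Integrable f μ →
      Integrable (fun x => piDenI I V (x + θ) * f (x + θ)) := fun f θ hf =>
    ((hIb f).1 hf).comp_add_right θ
  have hSh : ∀ (f : ℝ → ℝ) (θ : ℝ),
      ∫ x, piDenI I V (x + θ) * f (x + θ) = ∫ x, f x ∂μ := fun f θ => by
    rw [hI f]; exact integral_add_right_eq_self (fun x => piDenI I V x * f x) θ
  set R : ℝ → ℝ → ℝ := fun θ x => piDenI I V x * (auxU I V r θ x - θ * Vdot x) ^ 2 / 2 +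
      (piDenI I V x * auxU I V r θ x ^ 4 +
        piDenI I V (x + θ) * auxU I V r (-θ) (x + θ) ^ 4) / 8 with hR
  have hR0 : ∀ θ x, 0 ≤ R θ x := fun θ x => le_trans (sq_nonneg _) (aux_pt I hIoc V Vdot r hr θ x)
  have ha : ∀ θ, Integrable (fun x => piDenI I V x * (auxU I V r θ x - θ * Vdot x) ^ 2) :=
    fun θ => (hIb _).1 (hD2 θ).1
  have hb : ∀ θ, Integrable (fun x => piDenI I V x * auxU I V r θ x ^ 4) :=
    fun θ => (hIb _).1 (hU4 θ).1
  have hc : ∀ θ, Integrable (fun x => piDenI I V (x + θ) * auxU I V r (-θ) (x + θ) ^ 4) :=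
    fun θ => hShi (fun x => auxU I V r (-θ) x ^ 4) θ (hU4 (-θ)).1
  have hRi : ∀ θ, Integrable (R θ) := fun θ =>
    ((ha θ).div_const 2).add (((hb θ).add (hc θ)).div_const 8)
  have hRb : ∀ θ, ∫ x, R θ x ≤ (C * |θ| ^ β) ^ 2 / 2 + (C * |θ| ^ β + |θ| * K) ^ 4 / 4 := fun θ => by
    have e1 : ∫ x, R θ x = (∫ x, (auxU I V r θ x - θ * Vdot x) ^ 2 ∂μ) / 2 +
        ((∫ x, auxU I V r θ x ^ 4 ∂μ) + ∫ x, auxU I V r (-θ) x ^ 4 ∂μ) / 8 := by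
      rw [← hSh (fun x => auxU I V r (-θ) x ^ 4) θ, hI, hI, ← integral_add (hb θ) (hc θ),
        ← integral_div, ← integral_div]
      exact integral_add ((ha θ).div_const 2) (((hb θ).add (hc θ)).div_const 8)
    have h1 := (hD2 θ).2
    have h2 := (hU4 θ).2
    have h3 := (hU4 (-θ)).2
    rw [abs_neg] at h3
    rw [e1]; linarith
  -- when β > 2 the score vanishes
  have hK2 : 2 < β → K = 0 := by
    intro hβ2
    have key : ∀ θ, θ ^ 2 / 4 * ∫ x, Vdot x ^ 2 ∂μ ≤
        (C * |θ| ^ β) ^ 2 + (C * |θ| ^ β + |θ| * K) ^ 4 / 2 + 2 * (C * |θ| ^ β) := by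
      intro θ
      have i1 := (hIb _).1 (hU1 θ)
      have i2 := hShi _ θ (hU1 (-θ))
      have hpt : ∀ x, θ ^ 2 / 4 * (piDenI I V x * Vdot x ^ 2) ≤ 2 * R θ x +
          (piDenI I V x * auxU I V r θ x + piDenI I V (x + θ) * auxU I V r (-θ) (x + θ)) := by
        intro x
        have p1 := aux_pt I hIoc V Vdot r hr θ x
        have p2 := aux_pt2 I hIoc V r hr θ x
        have hs := sq_sqrt (hπ0 x)
        change _ ≤ R θ x at p1
        refine le_trans ?_ (add_le_add (mul_le_mul_of_nonneg_left p1 zero_le_two) p2)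
        nth_rw 1 [← hs]
        set g := (sqrt (piDenI I V (x + θ)) - sqrt (piDenI I V x)) *
            (Set.indicator I (fun _ => (1 : ℝ)) (x + r * θ) *
              Set.indicator I (fun _ => (1 : ℝ)) (x + (1 - r) * θ))
        nlinarith [sq_nonneg (2 * g + θ * Vdot x * sqrt (piDenI I V x) / 2)]
      have hint := integral_mono (((hIb _).1 hW2).const_mul (θ ^ 2 / 4))
        (((hRi θ).const_mul 2).add (i1.add i2)) hpt
      have e2 : ∫ x, (2 * R θ x + (piDenI I V x * auxU I V r θ x +
          piDenI I V (x + θ) * auxU I V r (-θ) (x + θ))) =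
          2 * (∫ x, R θ x) + ((∫ x, auxU I V r θ x ∂μ) + ∫ x, auxU I V r (-θ) x ∂μ) := by
        rw [← hSh (auxU I V r (-θ)) θ, hI, ← integral_add i1 i2, ← integral_const_mul]
        exact integral_add ((hRi θ).const_mul 2) (i1.add i2)
      have e3 : ∀ θ, ∫ x, (auxU I V r θ x - θ * Vdot x) ∂μ =
          (∫ x, auxU I V r θ x ∂μ) - θ * ∫ x, Vdot x ∂μ := fun θ => by
        rw [integral_sub (hU1 θ) (hW1.const_mul θ), integral_const_mul]
      have b1 := (hD1 θ).2
      have b2 := (hD1 (-θ)).2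
      rw [e3] at b1 b2
      rw [abs_neg] at b2
      have hint' : θ ^ 2 / 4 * ∫ x, Vdot x ^ 2 ∂μ ≤ 2 * (∫ x, R θ x) +
          ((∫ x, auxU I V r θ x ∂μ) + ∫ x, auxU I V r (-θ) x ∂μ) := by
        rw [← e2, hI, ← integral_const_mul]
        exact hint
      have := hRb θ
      linarith
    have hv0 : 0 ≤ ∫ x, Vdot x ^ 2 ∂μ := integral_nonneg fun x => sq_nonneg _
    have hbound : ∀ θ : ℝ, 0 < θ → θ ≤ 1 → ∫ x, Vdot x ^ 2 ∂μ ≤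
        (4 * C ^ 2 + 8 * C) * θ ^ (β - 2) + 2 * (C + K) ^ 4 * θ ^ (2 : ℝ) := by
      intro θ h0 h1
      have k := key θ
      rw [abs_of_pos h0] at k
      have eβ : θ ^ β = θ ^ (β - 2) * θ ^ 2 := by
        rw [← rpow_natCast θ 2, ← rpow_add h0]; congr 1; norm_num
      have q1 : θ ^ β ≤ 1 := rpow_le_one h0.le h1 (by linarith)
      have q2 : θ ^ β ≤ θ := by
        simpa using rpow_le_rpow_of_exponent_ge h0 h1 hβ.le
      have q0 : 0 ≤ θ ^ β := rpow_nonneg h0.le _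
      have t1 : (C * θ ^ β) ^ 2 ≤ C ^ 2 * θ ^ β := by
        rw [mul_pow]
        have : (θ ^ β) ^ 2 ≤ θ ^ β := by nlinarith
        nlinarith [sq_nonneg C]
      have t2 : (C * θ ^ β + θ * K) ^ 4 ≤ (C + K) ^ 4 * θ ^ 4 := by
        rw [← mul_pow]
        apply pow_le_pow_left₀ (by positivity)
        nlinarith
      have e2 : θ ^ (2 : ℝ) = θ ^ 2 := by exact_mod_cast rpow_natCast θ 2
      rw [e2]
      have : θ ^ 2 * ∫ x, Vdot x ^ 2 ∂μ ≤ θ ^ 2 * ((4 * C ^ 2 + 8 * C) * θ ^ (β - 2) +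
          2 * (C + K) ^ 4 * θ ^ 2) := by
        have : θ ^ 2 * ((4 * C ^ 2 + 8 * C) * θ ^ (β - 2) + 2 * (C + K) ^ 4 * θ ^ 2) =
          (4 * C ^ 2 + 8 * C) * θ ^ β + 2 * ((C + K) ^ 4 * θ ^ 4) := by rw [eβ]; ring
        rw [this]
        linarith
      exact le_of_mul_le_mul_left this (by positivity)
    have hlim : Tendsto (fun θ : ℝ => (4 * C ^ 2 + 8 * C) * θ ^ (β - 2) +
        2 * (C + K) ^ 4 * θ ^ (2 : ℝ)) (𝓝[>] 0) (𝓝 0) := by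
      have c1 : ContinuousAt (fun θ : ℝ => (4 * C ^ 2 + 8 * C) * θ ^ (β - 2) +
          2 * (C + K) ^ 4 * θ ^ (2 : ℝ)) 0 :=
        ((continuousAt_rpow_const 0 (β - 2) (Or.inr (by linarith))).const_mul _).add
          ((continuousAt_rpow_const 0 2 (Or.inr (by norm_num))).const_mul _)
      have := c1.tendsto.mono_left (nhdsWithin_le_nhds (s := Set.Ioi 0))
      simpa [zero_rpow (by linarith : β - 2 ≠ 0)] using this
    have hv : ∫ x, Vdot x ^ 2 ∂μ ≤ 0 := by
      refine ge_of_tendsto hlim ?_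
      filter_upwards [Ioc_mem_nhdsGT (zero_lt_one' ℝ)] with θ hθ
      exact hbound θ hθ.1 hθ.2
    have hz := (integral_eq_zero_iff_of_nonneg (fun x => sq_nonneg (Vdot x)) hW2).1
      (le_antisymm hv hv0)
    have h6 : ∫ x, |Vdot x| ^ (6 : ℝ) ∂μ = 0 := by
      apply integral_eq_zero_of_ae
      filter_upwards [hz] with x hx
      have : Vdot x = 0 := by simpa using hx
      rw [this]; simp
    rw [hK, h6]; norm_num
  -- conclusion
  set E2 := ∫ x, Vdot x ^ 2 ∂μ with hE2
  have hE20 : 0 ≤ E2 := integral_nonneg fun x => sq_nonneg _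
  set M := C ^ 2 + (C + K) ^ 4 + 4 + E2 with hM
  have hM0 : 0 < M := by positivity
  refine ⟨sqrt M, sqrt_pos.2 hM0, fun θ => ?_⟩
  have hq0 : 0 ≤ |θ| ^ β := rpow_nonneg (abs_nonneg _) _
  rw [← sqrt_sq hq0, ← sqrt_mul hM0.le]
  apply sqrt_le_sqrt
  rcases le_total |θ| 1 with h1 | h1
  · have s1 : ∫ x in I, ((sqrt (piDenI I V (x + θ)) - sqrt (piDenI I V x)) *
            (Set.indicator I (fun _ => (1 : ℝ)) (x + r * θ) *
              Set.indicator I (fun _ => (1 : ℝ)) (x + (1 - r) * θ)) +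
          θ * Vdot x * sqrt (piDenI I V x) / 2) ^ 2 ≤ ∫ x, R θ x :=
      (integral_mono_of_nonneg (Eventually.of_forall fun x => sq_nonneg _) (hRi θ).integrableOn
        (Eventually.of_forall fun x => aux_pt I hIoc V Vdot r hr θ x)).trans
        (setIntegral_le_integral (hRi θ) (Eventually.of_forall (hR0 θ)))
    refine (s1.trans (hRb θ)).trans ?_
    have q1 : |θ| ^ β ≤ 1 := rpow_le_one (abs_nonneg _) h1 (by linarith)
    have t : (C * |θ| ^ β + |θ| * K) ^ 2 ≤ (C + K) ^ 2 * |θ| ^ β := by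
      rcases le_or_gt β 2 with hb2 | hb2
      · rcases eq_or_lt_of_le (abs_nonneg θ) with h0 | h0
        · rw [← h0, zero_rpow (by linarith)]; simp
        have q2 : |θ| ^ β ≤ |θ| := by simpa using rpow_le_rpow_of_exponent_ge h0 h1 hβ.le
        have q3 : |θ| ^ 2 ≤ |θ| ^ β := by
          have := rpow_le_rpow_of_exponent_ge h0 h1 hb2
          rwa [rpow_two] at this
        calc (C * |θ| ^ β + |θ| * K) ^ 2 ≤ ((C + K) * |θ|) ^ 2 := by
              apply pow_le_pow_left₀ (by positivity); nlinarith
          _ = (C + K) ^ 2 * |θ| ^ 2 := by ring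
          _ ≤ _ := by gcongr
      · rw [hK2 hb2]
        have : (|θ| ^ β) ^ 2 ≤ |θ| ^ β := by nlinarith
        nlinarith [sq_nonneg C]
    have t4 : (C * |θ| ^ β + |θ| * K) ^ 4 ≤ (C + K) ^ 4 * (|θ| ^ β) ^ 2 := by
      have := pow_le_pow_left₀ (sq_nonneg _) t 2
      calc _ = ((C * |θ| ^ β + |θ| * K) ^ 2) ^ 2 := by ring
        _ ≤ _ := this
        _ = _ := by ring
    have n1 : 0 ≤ C ^ 2 * (|θ| ^ β) ^ 2 := by positivity
    have n2 : 0 ≤ (C + K) ^ 4 * (|θ| ^ β) ^ 2 := by positivity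
    have n3 : 0 ≤ (4 + E2) * (|θ| ^ β) ^ 2 := by positivity
    rw [hM]
    nlinarith
  · have j1 : Integrable (fun x => 2 * (piDenI I V x + piDenI I V (x + θ))) :=
      (hπi.add (hπi.comp_add_right θ)).const_mul 2
    have j2 : Integrable (fun x => θ ^ 2 / 2 * (piDenI I V x * Vdot x ^ 2)) :=
      ((hIb _).1 hW2).const_mul _
    have s1 : ∫ x in I, ((sqrt (piDenI I V (x + θ)) - sqrt (piDenI I V x)) *
            (Set.indicator I (fun _ => (1 : ℝ)) (x + r * θ) *
              Set.indicator I (fun _ => (1 : ℝ)) (x + (1 - r) * θ)) +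
          θ * Vdot x * sqrt (piDenI I V x) / 2) ^ 2 ≤
          ∫ x, (2 * (piDenI I V x + piDenI I V (x + θ)) +
            θ ^ 2 / 2 * (piDenI I V x * Vdot x ^ 2)) :=
      (integral_mono_of_nonneg (Eventually.of_forall fun x => sq_nonneg _) (j1.add j2).integrableOn
        (Eventually.of_forall fun x => aux_pt3 I V Vdot r θ x)).trans
        (setIntegral_le_integral (j1.add j2)
          (Eventually.of_forall fun x => le_trans (sq_nonneg _) (aux_pt3 I V Vdot r θ x)))
    have s2 : ∫ x, (2 * (piDenI I V x + piDenI I V (x + θ)) +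
            θ ^ 2 / 2 * (piDenI I V x * Vdot x ^ 2)) = 4 + θ ^ 2 / 2 * E2 := by
      rw [integral_add j1 j2, integral_const_mul, integral_const_mul,
        integral_add hπi (hπi.comp_add_right θ), integral_add_right_eq_self (piDenI I V) θ, hπ1,
        hE2, hI]
      norm_num
    rw [s2] at s1
    refine s1.trans ?_
    have q : |θ| ≤ |θ| ^ β := by simpa using rpow_le_rpow_of_exponent_le h1 hβ.le
    have q2 : θ ^ 2 ≤ (|θ| ^ β) ^ 2 := by
      rw [← sq_abs]; exact pow_le_pow_left₀ (abs_nonneg _) q 2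
    have q3 : 1 ≤ (|θ| ^ β) ^ 2 := one_le_pow₀ (h1.trans q)
    have n1 : 0 ≤ C ^ 2 * (|θ| ^ β) ^ 2 := by positivity
    have n2 : 0 ≤ (C + K) ^ 4 * (|θ| ^ β) ^ 2 := by positivity
    rw [hM]
    nlinarith [mul_le_mul_of_nonneg_right q2 hE20, mul_nonneg hE20 (sq_nonneg (|θ| ^ β))]
end
end

section
/- Assume G1. Let X be a real random variable with density π and Z an independent standard Gaussian random variable, and for each d set 𝒟_𝓘 = {X + r ℓ d^{−1/2} Z ∈ 𝓘} ∩ {X + (1−r) ℓ d^{−1/2} Z ∈ 𝓘} and ζ^d(x,z) = exp{(V(x) − V(x + ℓ d^{−1/2} z))/2} − 1 (defined on 𝒟_𝓘). Then: (i) lim_{d→∞} d · E[(1_{𝒟_𝓘} ζ^d(X,Z) + ℓ Z V̇(X)/(2√d))²] = 0; (ii) with p > 4 from G1(i), lim_{d→∞} √d · E[|1_{𝒟_𝓘}(V(X) − V(X + ℓZ/√d)) + ℓZ V̇(X)/√d|^p]^{1/p} = 0; (iii) lim_{d→∞} d · E[ 1_{𝒟_𝓘} |log(1 + ζ^d(X,Z))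 − ζ^d(X,Z) + ζ^d(X,Z)²/2| ] = 0. -/
open MeasureTheory ProbabilityTheory Filter Real
open scoped ENNReal NNReal Topology

noncomputable section

lemma aux_exp_one (u : ℝ) : (Real.exp u - 1 - u) ^ 2 ≤ u ^ 4 * (1 + Real.exp (2 * u)) := by
  have h0 : 0 ≤ Real.exp u - 1 - u := by linarith [Real.add_one_le_exp u]
  have he : Real.exp (2 * u) = Real.exp u ^ 2 := by rw [← Real.exp_nat_mul]; norm_num
  have hpos := Real.exp_pos u
  have hm : (1 - u) * Real.exp u ≤ 1 := by
    have h1 := Real.add_one_le_exp (-u)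
    have h2 : Real.exp (-u) * Real.exp u = 1 := by rw [← Real.exp_add]; simp
    nlinarith
  rw [he]
  rcases le_total 0 u with hu | hu
  · have h1 : Real.exp u - 1 - u ≤ u ^ 2 * Real.exp u := by
      nlinarith
    calc (Real.exp u - 1 - u) ^ 2 ≤ (u ^ 2 * Real.exp u) ^ 2 := by gcongr
      _ ≤ _ := by nlinarith [pow_nonneg (sq_nonneg u) 2]
  · have h1 : Real.exp u - 1 - u ≤ u ^ 2 := by
      by_contra hcon
      push Not at hcon
      nlinarith
    calc (Real.exp u - 1 - u) ^ 2 ≤ (u ^ 2) ^ 2 := by gcongr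
      _ ≤ _ := by nlinarith [mul_nonneg (pow_nonneg (sq_nonneg u) 2) (sq_nonneg (Real.exp u))]

lemma aux_exp_sq (s : ℝ) : (Real.exp s - 1) ^ 2 ≤ s ^ 2 * (1 + Real.exp (2 * s)) := by
  have he : Real.exp (2 * s) = Real.exp s ^ 2 := by rw [← Real.exp_nat_mul]; norm_num
  have hpos := Real.exp_pos s
  have h0 := Real.add_one_le_exp s
  have hm : (1 - s) * Real.exp s ≤ 1 := by
    have h1 := Real.add_one_le_exp (-s)
    have h2 : Real.exp (-s) * Real.exp s = 1 := by rw [← Real.exp_add]; simp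
    nlinarith
  rw [he]
  rcases le_total 0 s with hu | hu
  · calc (Real.exp s - 1) ^ 2 ≤ (s * Real.exp s) ^ 2 := by
          apply pow_le_pow_left₀ <;> nlinarith
      _ ≤ _ := by nlinarith [sq_nonneg s]
  · have h1 : Real.exp s ≤ 1 := Real.exp_le_one_iff.mpr hu
    calc (Real.exp s - 1) ^ 2 = (1 - Real.exp s) ^ 2 := by ring
      _ ≤ (-s) ^ 2 := by apply pow_le_pow_left₀ <;> linarith
      _ ≤ _ := by nlinarith [mul_nonneg (sq_nonneg s) (sq_nonneg (Real.exp s))]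

lemma aux_exp_mono (u s : ℝ) (hs : s ∈ Set.uIcc 0 u) : (Real.exp s - 1) ^ 2 ≤ (Real.exp u - 1) ^ 2 := by
  rcases le_total 0 u with hu | hu
  · rw [Set.uIcc_of_le hu] at hs
    have h1 : 1 ≤ Real.exp s := Real.one_le_exp hs.1
    have h2 : Real.exp s ≤ Real.exp u := Real.exp_le_exp.mpr hs.2
    apply pow_le_pow_left₀ <;> linarith
  · rw [Set.uIcc_of_ge hu] at hs
    have h1 : Real.exp s ≤ 1 := Real.exp_le_one_iff.mpr hs.2
    have h2 : Real.exp u ≤ Real.exp s := Real.exp_le_exp.mpr hs.1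
    nlinarith

lemma aux_exp_two (u : ℝ) : |u - (Real.exp u - 1) + (Real.exp u - 1) ^ 2 / 2|
    ≤ |u| ^ 3 * (1 + Real.exp (2 * u)) := by
  have hd : ∀ x ∈ Set.uIcc 0 u, HasDerivWithinAt
      (fun u => u - (Real.exp u - 1) + (Real.exp u - 1) ^ 2 / 2)
      ((Real.exp x - 1) ^ 2) (Set.uIcc 0 u) x := by
    intro x _
    have h1 := ((hasDerivAt_id x).sub ((Real.hasDerivAt_exp x).sub_const 1)).add
      ((((Real.hasDerivAt_exp x).sub_const 1).pow 2).div_const 2)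
    refine (h1.congr_deriv ?_).hasDerivWithinAt
    simp; ring
  have := (convex_uIcc (0:ℝ) u).norm_image_sub_le_of_norm_hasDerivWithin_le hd
    (C := (Real.exp u - 1) ^ 2) (fun x hx => by
      rw [Real.norm_of_nonneg (sq_nonneg _)]; exact aux_exp_mono u x hx)
    Set.left_mem_uIcc Set.right_mem_uIcc
  simp only [Real.norm_eq_abs, Real.exp_zero, sub_self, sub_zero] at this
  norm_num at this
  calc _ ≤ _ := this
    _ ≤ (u ^ 2 * (1 + Real.exp (2 * u))) * |u| := by gcongr; exact aux_exp_sq u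
    _ = _ := by rw [← sq_abs u]; ring

lemma aux_lq (μ : Measure ℝ) (hμ : μ Set.univ ≤ 1) (g : ℝ → ℝ) (hg : Measurable g)
    (p K : ℝ) (hp : 0 < p) (hint : Integrable (fun x => |g x| ^ p) μ)
    (hK : (∫ x, |g x| ^ p ∂μ) ^ (1 / p) ≤ K) (q : ℕ) (hq : 0 < q) (hqp : (q : ℝ) ≤ p) :
    ∫⁻ x, ENNReal.ofReal (|g x| ^ q) ∂μ ≤ ENNReal.ofReal (K ^ q) := by
  have hK0 : 0 ≤ K := le_trans (by positivity) hK
  have e1 : eLpNorm g (ENNReal.ofReal p) μ ≤ ENNReal.ofReal K := by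
    rw [eLpNorm_eq_lintegral_rpow_enorm_toReal (by simpa using hp) (by simp),
      ENNReal.toReal_ofReal hp.le]
    refine le_trans (le_of_eq ?_) (ENNReal.ofReal_le_ofReal hK)
    rw [← ENNReal.ofReal_rpow_of_nonneg (by positivity) (by positivity),
      ofReal_integral_eq_lintegral_ofReal hint (ae_of_all _ fun x => by positivity)]
    congr 1
    apply lintegral_congr
    intro x
    rw [← ENNReal.ofReal_rpow_of_nonneg (by positivity) hp.le, Real.enorm_eq_ofReal_abs]
  have hq1 : (0:ℝ) < q := by exact_mod_cast hq
  have e2 : eLpNorm g (ENNReal.ofReal q) μ ≤ ENNReal.ofReal K := by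
    refine (eLpNorm_le_eLpNorm_mul_rpow_measure_univ (ENNReal.ofReal_le_ofReal hqp)
      hg.aestronglyMeasurable).trans ?_
    calc _ ≤ ENNReal.ofReal K * 1 := by
          gcongr
          apply ENNReal.rpow_le_one hμ
          rw [ENNReal.toReal_ofReal hp.le, ENNReal.toReal_ofReal hq1.le, sub_nonneg]
          exact one_div_le_one_div_of_le hq1 hqp
      _ = _ := mul_one _
  rw [eLpNorm_eq_lintegral_rpow_enorm_toReal (by simpa using hq.ne') (by simp),
      ENNReal.toReal_ofReal hq1.le, one_div, ENNReal.rpow_inv_le_iff hq1] at e2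
  rw [ENNReal.ofReal_pow hK0, ← ENNReal.rpow_natCast]
  refine le_trans (le_of_eq ?_) e2
  apply lintegral_congr
  intro x
  rw [ENNReal.ofReal_pow (abs_nonneg _), Real.enorm_eq_ofReal_abs, ENNReal.rpow_natCast]

lemma aux_mass (I : Set ℝ) (hIo : IsOpen I) (V : ℝ → ℝ)
    (hVint : IntegrableOn (fun y => Real.exp (-V y)) I) :
    piMeasureI I V Set.univ ≤ 1 := by
  have h0 : 0 ≤ ∫ y in I, Real.exp (-V y) := integral_nonneg fun y => (Real.exp_pos _).le
  unfold piMeasureI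
  rw [withDensity_apply _ MeasurableSet.univ, Measure.restrict_univ,
    ← ofReal_integral_eq_lintegral_ofReal]
  · rw [← ENNReal.ofReal_one]
    apply ENNReal.ofReal_le_ofReal
    unfold piDenI
    rw [integral_div, integral_indicator hIo.measurableSet]
    exact div_self_le_one _
  · unfold piDenI
    exact (hVint.integrable_indicator hIo.measurableSet).div_const _
  · refine ae_of_all _ fun x => ?_
    unfold piDenI
    exact div_nonneg (Set.indicator_nonneg (fun y _ => (Real.exp_pos _).le) x) h0

/-- product of indicators -/
def auxD (I : Set ℝ) (r θ x : ℝ) : ℝ :=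
  Set.indicator I (fun _ => (1 : ℝ)) (x + r * θ) *
    Set.indicator I (fun _ => (1 : ℝ)) (x + (1 - r) * θ)

lemma auxD_cases (I : Set ℝ) (hIoc : I.OrdConnected) (r : ℝ) (hr : 1 < r) (θ x : ℝ) :
    auxD I r θ x = 0 ∨ (auxD I r θ x = 1 ∧ x ∈ I ∧ x + θ ∈ I) := by
  unfold auxD
  by_cases h1 : x + r * θ ∈ I
  · by_cases h2 : x + (1 - r) * θ ∈ I
    · right
      refine ⟨by simp [h1, h2], ?_, ?_⟩
      · refine hIoc.uIcc_subset h1 h2 ?_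
        rw [Set.mem_uIcc]
        rcases le_total 0 θ with h | h
        · right; constructor <;> nlinarith
        · left; constructor <;> nlinarith
      · refine hIoc.uIcc_subset h1 h2 ?_
        rw [Set.mem_uIcc]
        rcases le_total 0 θ with h | h
        · right; constructor <;> nlinarith
        · left; constructor <;> nlinarith
    · left; simp [h2]
  · left; simp [h1]

lemma auxD_neg (I : Set ℝ) (r θ x : ℝ) : auxD I r (-θ) (x + θ) = auxD I r θ x := by
  unfold auxD
  rw [mul_comm]
  congr 2 <;> ring

lemma measurable_auxD (I : Set ℝ) (hIo : IsOpen I) (r : ℝ) :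
    Measurable (fun q : ℝ × ℝ => auxD I r q.2 q.1) := by
  unfold auxD
  have h : Measurable (Set.indicator I (fun _ => (1 : ℝ))) :=
    measurable_const.indicator hIo.measurableSet
  exact (h.comp (by fun_prop : Measurable fun q : ℝ × ℝ => q.1 + r * q.2)).mul
    (h.comp (by fun_prop : Measurable fun q : ℝ × ℝ => q.1 + (1 - r) * q.2))

lemma aux_swap (I : Set ℝ) (hIo : IsOpen I) (hIoc : I.OrdConnected) (V : ℝ → ℝ)
    (hV : Measurable V) (r : ℝ) (hr : 1 < r) (θ : ℝ) (q : ℕ) (hq : 0 < q) :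
    ∫⁻ x, ENNReal.ofReal ((|V (x + θ) - V x| * auxD I r θ x) ^ q * Real.exp (V x - V (x + θ)))
      ∂(piMeasureI I V)
    = ∫⁻ x, ENNReal.ofReal ((|V (x + -θ) - V x| * auxD I r (-θ) x) ^ q) ∂(piMeasureI I V) := by
  have h0 : 0 ≤ ∫ y in I, Real.exp (-V y) := integral_nonneg fun y => (Real.exp_pos _).le
  have mD : ∀ θ, Measurable (fun x => auxD I r θ x) := fun θ =>
    (measurable_auxD I hIo r).comp (by fun_prop : Measurable fun x : ℝ => (x, θ))
  have mpi : Measurable (fun x => ENNReal.ofReal (piDenI I V x)) := by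
    unfold piDenI
    exact (((by fun_prop : Measurable fun y => Real.exp (-V y)).indicator
      hIo.measurableSet).div_const _).ennreal_ofReal
  have m1 := mD θ
  have m2 := mD (-θ)
  unfold piMeasureI
  rw [lintegral_withDensity_eq_lintegral_mul _ mpi (by fun_prop),
    lintegral_withDensity_eq_lintegral_mul _ mpi (by fun_prop)]
  symm
  rw [← lintegral_add_right_eq_self _ θ]
  symm
  apply lintegral_congr
  intro x
  have hpn : ∀ x, 0 ≤ piDenI I V x := fun x => by
    unfold piDenI
    exact div_nonneg (Set.indicator_nonneg (fun y _ => (Real.exp_pos _).le) x) h0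
  simp only [Pi.mul_apply]
  rw [← ENNReal.ofReal_mul (hpn _), ← ENNReal.ofReal_mul (hpn _), auxD_neg]
  congr 1
  rcases auxD_cases I hIoc r hr θ x with h | ⟨h, hx, hxθ⟩
  · simp [h, hq.ne']
  · unfold piDenI
    simp only [h, hx, hxθ, Set.indicator_of_mem, mul_one, add_neg_cancel_right]
    rw [abs_sub_comm (V x), sub_eq_add_neg (V x), Real.exp_add]
    have : Real.exp (-V x) * Real.exp (V x) = 1 := by rw [← Real.exp_add]; simp
    linear_combination (|V (x + θ) - V x| ^ q * Real.exp (-V (x + θ)) / (∫ y in I, Real.exp (-V y))) * this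

lemma aux_gauss_int (a : ℝ) (ha : 0 < a) :
    Integrable (fun z : ℝ => |z| ^ a) (gaussianReal 0 1) := by
  have := (memLp_id_gaussianReal (μ := 0) (v := 1) ⟨a, ha.le⟩).integrable_norm_rpow
    (fun h => ha.ne' (congrArg NNReal.toReal (ENNReal.coe_eq_zero.mp h))) ENNReal.coe_ne_top
  exact this

lemma aux_gauss (μ : Measure ℝ) [SFinite μ] (F : ℝ × ℝ → ℝ) (hF : Measurable F) (hF0 : ∀ q, 0 ≤ F q)
    (A B E a b e : ℝ) (hA : 0 ≤ A) (hB : 0 ≤ B) (hE : 0 ≤ E) (s : ℝ) (hs : 0 < s)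
    (ha : s < a) (hb : s < b) (he : s < e)
    (h : ∀ θ, ∫⁻ x, ENNReal.ofReal (F (x, θ)) ∂μ ≤
      ENNReal.ofReal (A * |θ| ^ a + B * |θ| ^ b + E * |θ| ^ e)) (ℓ : ℝ) (hℓ : 0 < ℓ) :
    Tendsto (fun d : ℕ => (Real.sqrt d) ^ s *
      ∫ q : ℝ × ℝ, F (q.1, ℓ * q.2 / Real.sqrt d) ∂(μ.prod (gaussianReal 0 1))) atTop (𝓝 0) := by
  have key : ∀ d : ℕ, ∫ q : ℝ × ℝ, F (q.1, ℓ * q.2 / Real.sqrt d) ∂(μ.prod (gaussianReal 0 1)) ≤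
      A * (ℓ / Real.sqrt d) ^ a * (∫ z, |z| ^ a ∂(gaussianReal 0 1)) +
      B * (ℓ / Real.sqrt d) ^ b * (∫ z, |z| ^ b ∂(gaussianReal 0 1)) +
      E * (ℓ / Real.sqrt d) ^ e * (∫ z, |z| ^ e ∂(gaussianReal 0 1)) := by
    intro d
    have mG : Measurable fun q : ℝ × ℝ => F (q.1, ℓ * q.2 / Real.sqrt d) :=
      hF.comp (by fun_prop)
    have ia := (aux_gauss_int a (hs.trans ha)).const_mul (A * (ℓ / Real.sqrt d) ^ a)
    have ib := (aux_gauss_int b (hs.trans hb)).const_mul (B * (ℓ / Real.sqrt d) ^ b)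
    have ie := (aux_gauss_int e (hs.trans he)).const_mul (E * (ℓ / Real.sqrt d) ^ e)
    rw [integral_eq_lintegral_of_nonneg_ae (ae_of_all _ fun q => hF0 _) mG.aestronglyMeasurable]
    refine ENNReal.toReal_le_of_le_ofReal ?_ ?_
    · have hm : ∀ t : ℝ, 0 ≤ ∫ z, |z| ^ t ∂(gaussianReal 0 1) := fun t =>
        integral_nonneg fun z => by positivity
      have := hm a
      have := hm b
      have := hm e
      positivity
    rw [lintegral_prod_symm _ mG.ennreal_ofReal.aemeasurable]
    calc _ ≤ ∫⁻ z, ENNReal.ofReal (A * (ℓ / Real.sqrt d) ^ a * |z| ^ a +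
            B * (ℓ / Real.sqrt d) ^ b * |z| ^ b + E * (ℓ / Real.sqrt d) ^ e * |z| ^ e)
            ∂(gaussianReal 0 1) := by
          apply lintegral_mono
          intro z
          refine (h (ℓ * z / Real.sqrt d)).trans (ENNReal.ofReal_le_ofReal (le_of_eq ?_))
          have : |ℓ * z / Real.sqrt d| = (ℓ / Real.sqrt d) * |z| := by
            rw [abs_div, abs_mul, abs_of_pos hℓ, abs_of_nonneg (Real.sqrt_nonneg _)]; ring
          rw [this, Real.mul_rpow (by positivity) (by positivity),
            Real.mul_rpow (by positivity) (by positivity),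
            Real.mul_rpow (by positivity) (by positivity)]
          ring
      _ = _ := by
          have iab : Integrable (fun z => A * (ℓ / Real.sqrt d) ^ a * |z| ^ a +
            B * (ℓ / Real.sqrt d) ^ b * |z| ^ b) (gaussianReal 0 1) := ia.add ib
          have iabe : Integrable (fun z => A * (ℓ / Real.sqrt d) ^ a * |z| ^ a +
            B * (ℓ / Real.sqrt d) ^ b * |z| ^ b + E * (ℓ / Real.sqrt d) ^ e * |z| ^ e)
            (gaussianReal 0 1) := iab.add ie
          rw [← ofReal_integral_eq_lintegral_ofReal iabe
            (ae_of_all _ fun z => by simp only [Pi.zero_apply]; positivity)]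
          rw [integral_add iab ie, integral_add ia ib, integral_const_mul,
            integral_const_mul, integral_const_mul]
  have lim : ∀ (A a : ℝ), s < a → Tendsto (fun d : ℕ => (Real.sqrt d) ^ s *
      (A * (ℓ / Real.sqrt d) ^ a * (∫ z, |z| ^ a ∂(gaussianReal 0 1)))) atTop (𝓝 0) := by
    intro A a ha
    have h1 : Tendsto (fun d : ℕ => (Real.sqrt d) ^ (-(a - s))) atTop (𝓝 0) :=
      (tendsto_rpow_neg_atTop (by linarith)).comp
        (Real.tendsto_sqrt_atTop.comp tendsto_natCast_atTop_atTop)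
    have h2 := h1.const_mul (A * ℓ ^ a * (∫ z, |z| ^ a ∂(gaussianReal 0 1)))
    rw [mul_zero] at h2
    refine h2.congr' ?_
    filter_upwards [eventually_gt_atTop 0] with d hd
    have hd' : 0 < Real.sqrt d := Real.sqrt_pos.mpr (by exact_mod_cast hd)
    rw [Real.div_rpow hℓ.le hd'.le, neg_sub, Real.rpow_sub hd']
    ring
  have L := ((lim A a ha).add (lim B b hb)).add (lim E e he)
  simp only [add_zero] at L
  refine squeeze_zero (fun d => ?_) (fun d => ?_) L
  · exact mul_nonneg (by positivity) (integral_nonneg fun q => hF0 _)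
  · rw [← mul_add, ← mul_add]
    exact mul_le_mul_of_nonneg_left (key d) (by positivity)

/-- the error in G1(i) -/
def auxG (I : Set ℝ) (V Vdot : ℝ → ℝ) (r θ x : ℝ) : ℝ :=
  (V (x + θ) - V x) * Set.indicator I (fun _ => (1 : ℝ)) (x + r * θ) *
            Set.indicator I (fun _ => (1 : ℝ)) (x + (1 - r) * θ) -
          θ * Vdot x

lemma auxG_eq (I : Set ℝ) (V Vdot : ℝ → ℝ) (r θ x : ℝ) :
    auxG I V Vdot r θ x = (V (x + θ) - V x) * auxD I r θ x - θ * Vdot x := by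
  unfold auxG auxD; ring

lemma measurable_auxG (I : Set ℝ) (hIo : IsOpen I) (V Vdot : ℝ → ℝ) (hV : Measurable V)
    (hVdot : Measurable Vdot) (r : ℝ) :
    Measurable (fun q : ℝ × ℝ => auxG I V Vdot r q.2 q.1) := by
  simp only [auxG_eq]
  have := measurable_auxD I hIo r
  fun_prop

lemma aux_moment (I : Set ℝ) (hIo : IsOpen I) (hIoc : I.OrdConnected)
    (V Vdot : ℝ → ℝ) (hV : Measurable V) (hVdot : Measurable Vdot)
    (hVint : IntegrableOn (fun y => Real.exp (-V y)) I)
    (r : ℝ) (hr : 1 < r) (C β : ℝ) (hC : 0 < C)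
    (q : ℕ) (hq : 0 < q) (hq6 : (q : ℝ) ≤ 6)
    (hg : ∀ θ, ∫⁻ x, ENNReal.ofReal (|auxG I V Vdot r θ x| ^ q) ∂(piMeasureI I V) ≤
      ENNReal.ofReal ((C * |θ| ^ β) ^ q))
    (hG1ii : Integrable (fun x => |Vdot x| ^ (6 : ℝ)) (piMeasureI I V)) :
    ∃ K : ℝ, 0 ≤ K ∧ ∀ θ,
      ∫⁻ x, ENNReal.ofReal ((|V (x + θ) - V x| * auxD I r θ x) ^ q) ∂(piMeasureI I V) ≤
      ENNReal.ofReal (K * |θ| ^ (β * q) + K * |θ| ^ (q : ℝ)) := by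
  have hv := aux_lq _ (aux_mass I hIo V hVint) Vdot hVdot 6 _ (by norm_num) hG1ii le_rfl q hq hq6
  set M := (∫ x, |Vdot x| ^ (6 : ℝ) ∂(piMeasureI I V)) ^ (1 / (6 : ℝ)) with hM
  have hM0 : 0 ≤ M := by positivity
  refine ⟨2 ^ (q - 1) * C ^ q + 2 ^ (q - 1) * M ^ q, by positivity, fun θ => ?_⟩
  have mG : Measurable (fun x => auxG I V Vdot r θ x) :=
    (measurable_auxG I hIo V Vdot hV hVdot r).comp (by fun_prop : Measurable fun x : ℝ => (x, θ))
  calc _ ≤ ∫⁻ x, (ENNReal.ofReal (2 ^ (q - 1)) * ENNReal.ofReal (|auxG I V Vdot r θ x| ^ q) +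
        ENNReal.ofReal (2 ^ (q - 1) * |θ| ^ q) * ENNReal.ofReal (|Vdot x| ^ q))
          ∂(piMeasureI I V) := by
        refine lintegral_mono fun x => ?_
        simp only
        rw [← ENNReal.ofReal_mul (by positivity), ← ENNReal.ofReal_mul (by positivity),
          ← ENNReal.ofReal_add (by positivity) (by positivity)]
        apply ENNReal.ofReal_le_ofReal
        have hD : 0 ≤ auxD I r θ x := by
          rcases auxD_cases I hIoc r hr θ x with h | h
          · exact h.ge
          · rw [h.1]; exact zero_le_one
        have h1 : |V (x + θ) - V x| * auxD I r θ x ≤ |auxG I V Vdot r θ x| + |θ * Vdot x| := by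
          have h2 : |V (x + θ) - V x| * auxD I r θ x = |(V (x + θ) - V x) * auxD I r θ x| := by
            rw [abs_mul, abs_of_nonneg hD]
          rw [h2, auxG_eq]
          have := abs_add_le ((V (x + θ) - V x) * auxD I r θ x - θ * Vdot x) (θ * Vdot x)
          simpa using this
        calc _ ≤ (|auxG I V Vdot r θ x| + |θ * Vdot x|) ^ q :=
              pow_le_pow_left₀ (by positivity) h1 q
          _ ≤ _ := add_pow_le (abs_nonneg _) (abs_nonneg _) q
          _ = _ := by rw [abs_mul]; ring
    _ = ENNReal.ofReal (2 ^ (q - 1)) * ∫⁻ x, ENNReal.ofReal (|auxG I V Vdot r θ x| ^ q)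
          ∂(piMeasureI I V) +
        ENNReal.ofReal (2 ^ (q - 1) * |θ| ^ q) * ∫⁻ x, ENNReal.ofReal (|Vdot x| ^ q)
          ∂(piMeasureI I V) := by
        rw [lintegral_add_left (by fun_prop), lintegral_const_mul _ (by fun_prop),
          lintegral_const_mul _ (by fun_prop)]
    _ ≤ ENNReal.ofReal (2 ^ (q - 1)) * ENNReal.ofReal ((C * |θ| ^ β) ^ q) +
        ENNReal.ofReal (2 ^ (q - 1) * |θ| ^ q) * ENNReal.ofReal (M ^ q) := by
        gcongr
        exact hg θ
    _ ≤ _ := by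
        rw [← ENNReal.ofReal_mul (by positivity), ← ENNReal.ofReal_mul (by positivity),
          ← ENNReal.ofReal_add (by positivity) (by positivity)]
        apply ENNReal.ofReal_le_ofReal
        rw [mul_pow, ← Real.rpow_mul_natCast (abs_nonneg _), Real.rpow_natCast]
        have h1 : 0 ≤ 2 ^ (q - 1) * M ^ q * |θ| ^ (β * q) := by positivity
        have h2 : 0 ≤ 2 ^ (q - 1) * C ^ q * |θ| ^ q := by positivity
        nlinarith

/-- moments weighted by `1 + exp` -/
lemma aux_moment_two (I : Set ℝ) (hIo : IsOpen I) (hIoc : I.OrdConnected)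
    (V Vdot : ℝ → ℝ) (hV : Measurable V) (hVdot : Measurable Vdot)
    (hVint : IntegrableOn (fun y => Real.exp (-V y)) I)
    (r : ℝ) (hr : 1 < r) (C β : ℝ) (hC : 0 < C)
    (q : ℕ) (hq : 0 < q) (hq6 : (q : ℝ) ≤ 6)
    (hg : ∀ θ, ∫⁻ x, ENNReal.ofReal (|auxG I V Vdot r θ x| ^ q) ∂(piMeasureI I V) ≤
      ENNReal.ofReal ((C * |θ| ^ β) ^ q))
    (hG1ii : Integrable (fun x => |Vdot x| ^ (6 : ℝ)) (piMeasureI I V)) :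
    ∃ K : ℝ, 0 ≤ K ∧ ∀ θ,
      ∫⁻ x, ENNReal.ofReal ((|V (x + θ) - V x| * auxD I r θ x) ^ q *
        (1 + Real.exp (V x - V (x + θ)))) ∂(piMeasureI I V) ≤
      ENNReal.ofReal (K * |θ| ^ (β * q) + K * |θ| ^ (q : ℝ)) := by
  obtain ⟨K, hK, h⟩ := aux_moment I hIo hIoc V Vdot hV hVdot hVint r hr C β hC q hq hq6 hg hG1ii
  refine ⟨2 * K, by positivity, fun θ => ?_⟩
  have mD : Measurable (fun x => auxD I r θ x) :=
    (measurable_auxD I hIo r).comp (by fun_prop : Measurable fun x : ℝ => (x, θ))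
  have hD : ∀ x, 0 ≤ auxD I r θ x := fun x => by
    rcases auxD_cases I hIoc r hr θ x with h | h
    · exact h.ge
    · rw [h.1]; exact zero_le_one
  calc _ = ∫⁻ x, (ENNReal.ofReal ((|V (x + θ) - V x| * auxD I r θ x) ^ q) +
        ENNReal.ofReal ((|V (x + θ) - V x| * auxD I r θ x) ^ q * Real.exp (V x - V (x + θ))))
          ∂(piMeasureI I V) := by
        refine lintegral_congr fun x => ?_
        have := hD x
        rw [← ENNReal.ofReal_add (by positivity) (by positivity)]
        congr 1; ring
    _ = _ := lintegral_add_left (by fun_prop) _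
    _ ≤ ENNReal.ofReal (K * |θ| ^ (β * q) + K * |θ| ^ (q : ℝ)) +
        ENNReal.ofReal (K * |-θ| ^ (β * q) + K * |-θ| ^ (q : ℝ)) := by
        rw [aux_swap I hIo hIoc V hV r hr θ q hq]
        exact add_le_add (h θ) (h (-θ))
    _ = _ := by
        rw [abs_neg, ← ENNReal.ofReal_add (by positivity) (by positivity)]
        congr 1; ring

/-- Lemma (integrated DQM, interval case): the three limits
(i) `d·E[(1_{𝒟_I} ζ^d + ℓZV̇(X)/(2√d))²] → 0`,
(ii) `√d·E[|1_{𝒟_I}(V(X) - V(X+ℓZ/√d)) + ℓZV̇(X)/√d|^p]^{1/p} → 0`,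
(iii) `d·E[1_{𝒟_I}|log(1+ζ^d) - ζ^d + (ζ^d)²/2|] → 0`. -/
theorem stmt_17
    (I : Set ℝ) (hIo : IsOpen I) (hIoc : I.OrdConnected)
    (V Vdot : ℝ → ℝ) (hV : Measurable V) (hVdot : Measurable Vdot)
    (hVint : IntegrableOn (fun y => Real.exp (-V y)) I)
    (r : ℝ) (hr : 1 < r)
    (p C β : ℝ) (hp : 4 < p) (hC : 0 < C) (hβ : 1 < β)
    (hG1i : ∀ θ : ℝ,
      Integrable (fun x =>
        |(V (x + θ) - V x) * Set.indicator I (fun _ => (1 : ℝ)) (x + r * θ) *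
            Set.indicator I (fun _ => (1 : ℝ)) (x + (1 - r) * θ) -
          θ * Vdot x| ^ p) (piMeasureI I V) ∧
      (∫ x,
        |(V (x + θ) - V x) * Set.indicator I (fun _ => (1 : ℝ)) (x + r * θ) *
            Set.indicator I (fun _ => (1 : ℝ)) (x + (1 - r) * θ) -
          θ * Vdot x| ^ p ∂(piMeasureI I V)) ^ (1 / p) ≤ C * |θ| ^ β)
    (hG1ii : Integrable (fun x => |Vdot x| ^ (6 : ℝ)) (piMeasureI I V))
    (γ Cγ : ℝ) (hγ : 6 ≤ γ) (hCγ : 0 < Cγ)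
    (hG1iii : ∀ θ : ℝ, ((piMeasureI I V) {x | x + θ ∉ I}).toReal ≤ Cγ * |θ| ^ γ)
    (ℓ : ℝ) (hℓ : 0 < ℓ) :
    Tendsto (fun d : ℕ =>
        (d : ℝ) * ∫ q : ℝ × ℝ,
          (indD I r ℓ d q.1 q.2 * zeta V ℓ d q.1 q.2 +
            ℓ * q.2 * Vdot q.1 / (2 * Real.sqrt d)) ^ 2
          ∂((piMeasureI I V).prod (gaussianReal 0 1)))
      atTop (𝓝 0) ∧
    Tendsto (fun d : ℕ =>
        Real.sqrt d * (∫ q : ℝ × ℝ,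
          |indD I r ℓ d q.1 q.2 * (V q.1 - V (q.1 + ℓ * q.2 / Real.sqrt d)) +
            ℓ * q.2 * Vdot q.1 / Real.sqrt d| ^ p
          ∂((piMeasureI I V).prod (gaussianReal 0 1))) ^ (1 / p))
      atTop (𝓝 0) ∧
    Tendsto (fun d : ℕ =>
        (d : ℝ) * ∫ q : ℝ × ℝ,
          indD I r ℓ d q.1 q.2 *
            |Real.log (1 + zeta V ℓ d q.1 q.2) - zeta V ℓ d q.1 q.2 +
              (zeta V ℓ d q.1 q.2) ^ 2 / 2|
          ∂((piMeasureI I V).prod (gaussianReal 0 1)))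
      atTop (𝓝 0) := by
  have hmass := aux_mass I hIo V hVint
  haveI : IsFiniteMeasure (piMeasureI I V) := ⟨hmass.trans_lt ENNReal.one_lt_top⟩
  have mGG := measurable_auxG I hIo V Vdot hV hVdot r
  have mD := measurable_auxD I hIo r
  have mG : ∀ θ, Measurable (fun x => auxG I V Vdot r θ x) := fun θ =>
    mGG.comp (by fun_prop : Measurable fun x : ℝ => (x, θ))
  have hg : ∀ q : ℕ, 0 < q → (q : ℝ) ≤ 4 → ∀ θ,
      ∫⁻ x, ENNReal.ofReal (|auxG I V Vdot r θ x| ^ q) ∂(piMeasureI I V) ≤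
      ENNReal.ofReal ((C * |θ| ^ β) ^ q) := fun q hq hq4 θ =>
    aux_lq _ hmass _ (mG θ) p _ (by linarith) (hG1i θ).1 (hG1i θ).2 q hq (by linarith)
  have hind : ∀ (d : ℕ) (x z : ℝ), indD I r ℓ d x z = auxD I r (ℓ * z / Real.sqrt d) x := by
    intro d x z
    unfold indD auxD
    congr 2 <;> ring
  have hsq : ∀ d : ℕ, (Real.sqrt d) ^ (2 : ℝ) = d := fun d => by
    rw [Real.rpow_two, Real.sq_sqrt (Nat.cast_nonneg d)]
  have hcases := auxD_cases I hIoc r hr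
  refine ⟨?_, ?_, ?_⟩
  · obtain ⟨K, hK, h⟩ := aux_moment_two I hIo hIoc V Vdot hV hVdot hVint r hr C β hC 4
      (by norm_num) (by norm_num) (hg 4 (by norm_num) (by norm_num)) hG1ii
    have key := aux_gauss (piMeasureI I V) (fun q =>
      (auxD I r q.2 q.1 * (Real.exp ((V q.1 - V (q.1 + q.2)) / 2) - 1) + q.2 * Vdot q.1 / 2) ^ 2)
      (by fun_prop) (fun q => sq_nonneg _) (C ^ 2) K K (β * 2) (β * 4) 4
      (by positivity) hK hK 2 (by norm_num) (by linarith) (by linarith) (by norm_num)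
      (fun θ => by
        calc _ ≤ ∫⁻ x, (ENNReal.ofReal (|auxG I V Vdot r θ x| ^ 2) +
            ENNReal.ofReal ((|V (x + θ) - V x| * auxD I r θ x) ^ 4 *
              (1 + Real.exp (V x - V (x + θ))))) ∂(piMeasureI I V) := by
              refine lintegral_mono fun x => ?_
              simp only
              rw [← ENNReal.ofReal_add (by positivity) (by positivity)]
              apply ENNReal.ofReal_le_ofReal
              rw [auxG_eq, sq_abs]
              have h1 := aux_exp_one ((V x - V (x + θ)) / 2)
              have h2 : 2 * ((V x - V (x + θ)) / 2) = V x - V (x + θ) := by ring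
              rw [h2] at h1
              rcases hcases θ x with h0 | ⟨h0, -⟩
              · rw [h0]; nlinarith [sq_nonneg (θ * Vdot x)]
              · rw [h0]
                simp only [mul_one, one_mul]
                rw [abs_sub_comm, show |V x - V (x + θ)| ^ 4 = (V x - V (x + θ)) ^ 4 from
                  Even.pow_abs (by decide) _]
                generalize Real.exp (V x - V (x + θ)) = E2 at *
                generalize Real.exp ((V x - V (x + θ)) / 2) = E1 at *
                have h3 : (V (x + θ) - V x - θ * Vdot x) ^ 2
                  = 4 * ((V x - V (x + θ)) / 2 + θ * Vdot x / 2) ^ 2 := by ring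
                have h4 : (V x - V (x + θ)) ^ 4 * (1 + E2) =
                  16 * (((V x - V (x + θ)) / 2) ^ 4 * (1 + E2)) := by ring
                rw [h3, h4]
                generalize ((V x - V (x + θ)) / 2) = u at *
                nlinarith [sq_nonneg (E1 - 1 - u - (u + θ * Vdot x / 2)),
                  sq_nonneg (E1 - 1 - u), sq_nonneg (u + θ * Vdot x / 2)]
          _ = _ := by
              have := mG θ
              exact lintegral_add_left (by fun_prop) _
          _ ≤ _ := add_le_add (hg 2 (by norm_num) (by norm_num) θ) (h θ)
          _ = _ := by
              rw [← ENNReal.ofReal_add (by positivity) (by positivity), mul_pow,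
                ← Real.rpow_mul_natCast (abs_nonneg _)]
              congr 1
              push_cast
              ring) ℓ hℓ
    refine key.congr fun d => ?_
    rw [hsq]
    congr 1
    refine integral_congr_ae (ae_of_all _ fun q => ?_)
    simp only [hind, zeta]
    congr 2
    ring
  · have key := aux_gauss (piMeasureI I V) (fun q => |auxG I V Vdot r q.2 q.1| ^ p)
      (by fun_prop) (fun q => by positivity) (C ^ p) 0 0 (β * p) (p + 1) (p + 1)
      (by positivity) le_rfl le_rfl p (by linarith) (by nlinarith) (by linarith) (by linarith)
      (fun θ => by
        have hp0 : 0 < p := by linarith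
        rw [zero_mul, add_zero, add_zero]
        simp only [auxG]
        rw [← ofReal_integral_eq_lintegral_ofReal (hG1i θ).1 (ae_of_all _ fun x => by
          simp only [Pi.zero_apply]; positivity)]
        apply ENNReal.ofReal_le_ofReal
        have h1 := (hG1i θ).2
        rw [one_div, Real.rpow_inv_le_iff_of_pos (integral_nonneg fun x => by
          simp only [Pi.zero_apply]; positivity) (by positivity) hp0,
          Real.mul_rpow hC.le (by positivity), ← Real.rpow_mul (abs_nonneg _)] at h1
        exact h1) ℓ hℓ
    have hp0 : 0 < p := by linarith
    have k2 := key.rpow_const (p := 1 / p) (Or.inr (by positivity))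
    rw [Real.zero_rpow (by positivity)] at k2
    refine k2.congr fun d => ?_
    rw [Real.mul_rpow (by positivity) (integral_nonneg fun q => by
          simp only [Pi.zero_apply]; positivity), ← Real.rpow_mul (Real.sqrt_nonneg _),
          mul_one_div_cancel hp0.ne', Real.rpow_one]
    congr 2
    refine integral_congr_ae (ae_of_all _ fun q => ?_)
    simp only [hind, auxG_eq]
    congr 1
    rw [← abs_neg]
    congr 1
    ring
  · obtain ⟨K, hK, h⟩ := aux_moment_two I hIo hIoc V Vdot hV hVdot hVint r hr C β hC 3
      (by norm_num) (by norm_num) (hg 3 (by norm_num) (by norm_num)) hG1ii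
    have hD : ∀ θ x, 0 ≤ auxD I r θ x := fun θ x => by
      rcases hcases θ x with h | h
      · exact h.ge
      · rw [h.1]; exact zero_le_one
    have key := aux_gauss (piMeasureI I V) (fun q => auxD I r q.2 q.1 *
        |Real.log (1 + (Real.exp ((V q.1 - V (q.1 + q.2)) / 2) - 1)) -
          (Real.exp ((V q.1 - V (q.1 + q.2)) / 2) - 1) +
          (Real.exp ((V q.1 - V (q.1 + q.2)) / 2) - 1) ^ 2 / 2|)
      (by fun_prop) (fun q => mul_nonneg (hD _ _) (abs_nonneg _)) 0 K K 3 (β * 3) 3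
      le_rfl hK hK 2 (by norm_num) (by norm_num) (by linarith) (by norm_num)
      (fun θ => by
        rw [zero_mul, zero_add]
        refine le_trans (lintegral_mono fun x => ?_) ((h θ).trans (le_of_eq (by norm_num)))
        simp only
        apply ENNReal.ofReal_le_ofReal
        rw [add_sub_cancel, Real.log_exp]
        rcases hcases θ x with h0 | ⟨h0, -⟩
        · rw [h0]; simp
        · rw [h0, one_mul, mul_one]
          refine (aux_exp_two _).trans ?_
          rw [mul_div_cancel₀ _ (two_ne_zero), abs_div, abs_sub_comm]
          gcongr
          rw [abs_two]
          linarith [abs_nonneg (V (x + θ) - V x)]) ℓ hℓ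
    refine key.congr fun d => ?_
    rw [hsq]
    congr 1
    refine integral_congr_ae (ae_of_all _ fun q => ?_)
    simp only [hind, zeta]
end
end

section
/- Assume G1. Let X be a real random variable with density π and Z an independent standard Gaussian random variable, and for each d set 𝒟_𝓘 = {X + r ℓ d^{−1/2} Z ∈ 𝓘} ∩ {X + (1−r) ℓ d^{−1/2} Z ∈ 𝓘} and ζ^d(x,z) = exp{(V(x) − V(x + ℓ d^{−1/2} z))/2} − 1 (defined on 𝒟_𝓘). Then lim_{d→∞} 2d · E[1_{𝒟_𝓘} ζ^d(X,Z)] = −ℓ² I / 4, where I = ∫ V̇(x)² π(x) dx. -/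
open MeasureTheory ProbabilityTheory Filter Real
open scoped ENNReal NNReal Topology

noncomputable section

/-- The Lipschitz function `t ↦ 1 - exp(-t⁺/2)`. -/
def gg (t : ℝ) : ℝ := 1 - Real.exp (-(max t 0) / 2)

@[fun_prop]
lemma gg_continuous : Continuous gg := by unfold gg; fun_prop

@[fun_prop]
lemma gg_measurable : Measurable gg := gg_continuous.measurable

lemma exp_neg_lip (a b : ℝ) (ha : 0 ≤ a) (hab : a ≤ b) :
    Real.exp (-a) - Real.exp (-b) ≤ b - a := by
  have h1 : Real.exp (-b) = Real.exp (-a) * Real.exp (-(b - a)) := by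
    rw [← Real.exp_add]; congr 1; ring
  have h2 := Real.add_one_le_exp (-(b - a))
  have h3 : Real.exp (-a) ≤ 1 := Real.exp_le_one_iff.mpr (by linarith)
  have h4 := Real.exp_pos (-a)
  rw [h1]
  nlinarith

lemma exp_neg_lip_abs (a b : ℝ) (ha : 0 ≤ a) (hb : 0 ≤ b) :
    |Real.exp (-a) - Real.exp (-b)| ≤ |a - b| := by
  rcases le_total a b with h | h
  · rw [abs_of_nonneg (sub_nonneg.mpr (Real.exp_le_exp.mpr (by linarith))),
      abs_of_nonpos (by linarith)]
    linarith [exp_neg_lip a b ha h]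
  · rw [abs_of_nonpos (sub_nonpos.mpr (Real.exp_le_exp.mpr (by linarith))),
      abs_of_nonneg (by linarith)]
    linarith [exp_neg_lip b a hb h]

lemma gg_lip (a b : ℝ) : |gg a - gg b| ≤ |a - b| / 2 := by
  have h := exp_neg_lip_abs (max b 0 / 2) (max a 0 / 2) (by positivity) (by positivity)
  have h2 : |max b 0 - max a 0| ≤ |b - a| := abs_max_sub_max_le_abs b a 0
  have h3 : gg a - gg b = Real.exp (-(max b 0 / 2)) - Real.exp (-(max a 0 / 2)) := by
    unfold gg; rw [neg_div, neg_div]; ring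
  rw [h3]
  refine h.trans ?_
  rw [← sub_div, abs_div, abs_of_pos (by norm_num : (0:ℝ) < 2), abs_sub_comm a b]
  linarith

lemma gg_zero : gg 0 = 0 := by simp [gg]

lemma gg_nonpos_arg {t : ℝ} (ht : t ≤ 0) : gg t = 0 := by simp [gg, max_eq_right ht]

lemma gg_abs_le (a : ℝ) : |gg a| ≤ |a| / 2 := by
  have := gg_lip a 0
  simpa [gg_zero] using this

lemma gg_abs_le_one (a : ℝ) : |gg a| ≤ 1 := by
  have h1 : Real.exp (-(max a 0) / 2) ≤ 1 := by
    apply Real.exp_le_one_iff.mpr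
    have : 0 ≤ max a 0 := le_max_right _ _
    linarith
  have h2 := Real.exp_pos (-(max a 0) / 2)
  rw [gg, abs_le]; constructor <;> linarith

lemma gg_sq_le (a : ℝ) : gg a ^ 2 ≤ a ^ 2 / 4 := by
  have := gg_abs_le a
  have h := abs_nonneg (gg a)
  rw [← sq_abs (gg a), ← sq_abs a]
  nlinarith

lemma gg_sq_sum_le (a : ℝ) : gg a ^ 2 + gg (-a) ^ 2 ≤ a ^ 2 / 4 := by
  rcases le_total a 0 with h | h
  · rw [gg_nonpos_arg h]; have := gg_sq_le (-a); simpa using this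
  · rw [gg_nonpos_arg (by linarith : -a ≤ 0)]; have := gg_sq_le a; simpa using this

lemma gg_sq_diff (a b s : ℝ) (hs : 0 < s) :
    |gg a ^ 2 - gg b ^ 2| ≤ (a - b) ^ 2 / 4 + ((a - b) ^ 2 / s + s * b ^ 2) / 4 := by
  have h1 := gg_lip a b
  have h2 := gg_abs_le b
  have h3 : |gg a ^ 2 - gg b ^ 2| ≤ |a - b| / 2 * (|a - b| / 2 + |b|) := by
    have : gg a ^ 2 - gg b ^ 2 = (gg a - gg b) * ((gg a - gg b) + 2 * gg b) := by ring
    rw [this, abs_mul]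
    refine mul_le_mul h1 ?_ (abs_nonneg _) (by positivity)
    refine (abs_add_le _ _).trans ?_
    rw [abs_mul, abs_two]; linarith
  have h4 : 2 * |a - b| * |b| ≤ |a - b| ^ 2 / s + s * |b| ^ 2 := by
    have : |a - b| ^ 2 / s + s * |b| ^ 2 - 2 * |a - b| * |b| = (|a - b| - s * |b|) ^ 2 / s := by
      field_simp; ring
    have h5 : 0 ≤ (|a - b| - s * |b|) ^ 2 / s := by positivity
    linarith
  rw [← sq_abs (a - b), ← sq_abs b]
  nlinarith

lemma sq_le_young (p t e : ℝ) (hp : 2 ≤ p) (ht : 0 < t) :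
    e ^ 2 ≤ t ^ 2 + t ^ 2 / t ^ p * |e| ^ p := by
  have htp : 0 < t ^ p := Real.rpow_pos_of_pos ht p
  rcases le_total |e| t with h | h
  · have : e ^ 2 ≤ t ^ 2 := by rw [← sq_abs]; gcongr
    have h2 : 0 ≤ t ^ 2 / t ^ p * |e| ^ p := by positivity
    linarith
  · have he : 0 < |e| := ht.trans_le h
    have h1 : 1 ≤ |e| / t := (one_le_div ht).mpr h
    have h2 : (|e| / t) ^ (2:ℝ) ≤ (|e| / t) ^ p := Real.rpow_le_rpow_of_exponent_le h1 hp
    rw [Real.rpow_two, Real.div_rpow he.le ht.le, div_pow, sq_abs] at h2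
    have h3 : e ^ 2 ≤ t ^ 2 / t ^ p * |e| ^ p := by
      have := mul_le_mul_of_nonneg_left h2 (sq_nonneg t)
      rw [mul_div_cancel₀ _ (by positivity)] at this
      calc e ^ 2 ≤ _ := this
        _ = _ := by ring
    have := sq_nonneg t
    linarith

lemma e_sq_bound (μ : Measure ℝ) [IsFiniteMeasure μ] (p C β θ : ℝ) (hp : 4 < p) (hC : 0 < C)
    (hθ : θ ≠ 0) (e : ℝ → ℝ) (he : Measurable e)
    (hi : Integrable (fun x => |e x| ^ p) μ)
    (hb : (∫ x, |e x| ^ p ∂μ) ^ (1 / p) ≤ C * |θ| ^ β) :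
    Integrable (fun x => e x ^ 2) μ ∧
      ∫ x, e x ^ 2 ∂μ ≤ (μ.real Set.univ + C ^ p) * (θ ^ 2 * (|θ| ^ (β - 1)) ^ 2) := by
  set t := |θ| ^ β with htdef
  have hθ' : 0 < |θ| := abs_pos.mpr hθ
  have ht : 0 < t := Real.rpow_pos_of_pos hθ' β
  have htp : 0 < t ^ p := Real.rpow_pos_of_pos ht p
  have hint : Integrable (fun x => t ^ 2 + t ^ 2 / t ^ p * |e x| ^ p) μ :=
    (integrable_const _).add (hi.const_mul _)
  have h1 : Integrable (fun x => e x ^ 2) μ := by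
    refine hint.mono' (by fun_prop) (Eventually.of_forall fun x => ?_)
    rw [Real.norm_of_nonneg (sq_nonneg _)]
    exact sq_le_young p t (e x) (by linarith) ht
  refine ⟨h1, ?_⟩
  have h0 : 0 ≤ ∫ x, |e x| ^ p ∂μ := integral_nonneg fun x => by positivity
  have hI : ∫ x, |e x| ^ p ∂μ ≤ C ^ p * t ^ p := by
    have := Real.rpow_le_rpow (by positivity) hb (by linarith : 0 ≤ p)
    rw [← Real.rpow_mul h0, one_div_mul_cancel (by linarith), Real.rpow_one,
      Real.mul_rpow hC.le ht.le] at this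
    exact this
  have hts : t = |θ| * |θ| ^ (β - 1) := by
    rw [htdef, Real.rpow_sub_one hθ'.ne']; field_simp
  calc ∫ x, e x ^ 2 ∂μ ≤ ∫ x, (t ^ 2 + t ^ 2 / t ^ p * |e x| ^ p) ∂μ :=
        integral_mono h1 hint fun x => sq_le_young p t (e x) (by linarith) ht
    _ = μ.real Set.univ * t ^ 2 + t ^ 2 / t ^ p * ∫ x, |e x| ^ p ∂μ := by
        rw [integral_add (integrable_const _) (hi.const_mul _), integral_const, smul_eq_mul,
          integral_const_mul]
    _ ≤ μ.real Set.univ * t ^ 2 + t ^ 2 / t ^ p * (C ^ p * t ^ p) := by gcongr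
    _ = (μ.real Set.univ + C ^ p) * t ^ 2 := by field_simp
    _ = _ := by rw [hts, mul_pow, sq_abs]

lemma G_sub_H (μ : Measure ℝ) [IsFiniteMeasure μ] (θ s B : ℝ) (hs : 0 < s)
    (u v : ℝ → ℝ) (hu : Measurable u) (hv : Measurable v)
    (hv2 : Integrable (fun x => v x ^ 2) μ)
    (hi : Integrable (fun x => (u x - θ * v x) ^ 2) μ)
    (hb : ∫ x, (u x - θ * v x) ^ 2 ∂μ ≤ B * (θ ^ 2 * s ^ 2)) :
    |(∫ x, gg (u x) ^ 2 ∂μ) - ∫ x, gg (θ * v x) ^ 2 ∂μ| ≤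
      θ ^ 2 / 4 * (B * s ^ 2 + (B + ∫ x, v x ^ 2 ∂μ) * s) := by
  have hgm := gg_measurable
  have hgi : ∀ w : ℝ → ℝ, Measurable w → Integrable (fun x => gg (w x) ^ 2) μ := by
    intro w hw
    refine Integrable.of_bound (by fun_prop) 1 (Eventually.of_forall fun x => ?_)
    rw [norm_pow, Real.norm_eq_abs]
    exact pow_le_one₀ (abs_nonneg _) (gg_abs_le_one _)
  rw [← integral_sub (hgi _ hu) (hgi _ (by fun_prop))]
  refine (abs_integral_le_integral_abs).trans ?_
  have hint : Integrable (fun x => (1 / 4 + 1 / (4 * s)) * (u x - θ * v x) ^ 2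
      + s * θ ^ 2 / 4 * v x ^ 2) μ := (hi.const_mul _).add (hv2.const_mul _)
  calc ∫ x, |gg (u x) ^ 2 - gg (θ * v x) ^ 2| ∂μ
      ≤ ∫ x, ((1 / 4 + 1 / (4 * s)) * (u x - θ * v x) ^ 2
      + s * θ ^ 2 / 4 * v x ^ 2) ∂μ := by
        refine integral_mono (((hgi _ hu).sub (hgi _ (by fun_prop))).abs) hint fun x => ?_
        refine (gg_sq_diff _ _ s hs).trans (le_of_eq ?_)
        field_simp
        ring
    _ = (1 / 4 + 1 / (4 * s)) * ∫ x, (u x - θ * v x) ^ 2 ∂μ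
        + s * θ ^ 2 / 4 * ∫ x, v x ^ 2 ∂μ := by
        rw [integral_add (hi.const_mul _) (hv2.const_mul _), integral_const_mul,
          integral_const_mul]
    _ ≤ (1 / 4 + 1 / (4 * s)) * (B * (θ ^ 2 * s ^ 2)) + s * θ ^ 2 / 4 * ∫ x, v x ^ 2 ∂μ := by
        gcongr
    _ = _ := by field_simp; ring

/-- pointwise limit of the rescaled sum -/
lemma gg_limit (v : ℝ) :
    Tendsto (fun θ : ℝ => (gg (θ * v) ^ 2 + gg (-θ * v) ^ 2) / θ ^ 2) (𝓝[≠] 0)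
      (𝓝 (v ^ 2 / 4)) := by
  have hd : HasDerivAt (fun y : ℝ => 1 - Real.exp (-y / 2)) (1 / 2) 0 := by
    have h1 : HasDerivAt (fun y : ℝ => -y / 2) (-1 / 2) 0 :=
      ((hasDerivAt_id (0:ℝ)).neg).div_const 2
    have h2 := (h1.exp).const_sub 1
    refine h2.congr_deriv ?_
    norm_num
  have hs := hd.tendsto_slope_zero
  by_cases hv : v = 0
  · subst hv
    simp [gg_zero]
  have hv' : 0 < |v| := abs_pos.mpr hv
  have hmap : Tendsto (fun θ : ℝ => |θ * v|) (𝓝[≠] 0) (𝓝[≠] 0) := by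
    refine tendsto_nhdsWithin_iff.mpr ⟨?_, ?_⟩
    · have : Continuous (fun θ : ℝ => |θ * v|) := by fun_prop
      have h := this.tendsto 0
      simp only [zero_mul, abs_zero] at h
      exact h.mono_left nhdsWithin_le_nhds
    · filter_upwards [self_mem_nhdsWithin] with θ hθ
      have hθ : θ ≠ 0 := hθ
      simp [hθ, hv]
  have h := ((hs.comp hmap).pow 2).mul_const (v ^ 2)
  have e : (1 / 2 : ℝ) ^ 2 * v ^ 2 = v ^ 2 / 4 := by ring
  rw [e] at h
  refine h.congr' ?_
  filter_upwards [self_mem_nhdsWithin] with θ hθ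
  have hθ : θ ≠ 0 := hθ
  have key : gg (θ * v) ^ 2 + gg (-θ * v) ^ 2 = (1 - Real.exp (-|θ * v| / 2)) ^ 2 := by
    rw [neg_mul]
    rcases le_total (θ * v) 0 with h | h
    · rw [gg_nonpos_arg h, abs_of_nonpos h, gg, max_eq_left (by linarith)]; ring
    · rw [gg_nonpos_arg (by linarith : -(θ * v) ≤ 0), abs_of_nonneg h, gg, max_eq_left h]; ring
  rw [key]
  simp only [Function.comp, zero_add, smul_eq_mul, neg_zero, zero_div, Real.exp_zero, sub_self,
    sub_zero]
  rw [mul_pow, inv_pow, sq_abs]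
  field_simp

lemma H_limit (μ : Measure ℝ) [IsFiniteMeasure μ] (v : ℝ → ℝ) (hv : Measurable v)
    (hv2 : Integrable (fun x => v x ^ 2) μ) :
    Tendsto (fun θ : ℝ => ((∫ x, gg (θ * v x) ^ 2 ∂μ) + ∫ x, gg (-θ * v x) ^ 2 ∂μ) / θ ^ 2)
      (𝓝[≠] 0) (𝓝 ((∫ x, v x ^ 2 ∂μ) / 4)) := by
  have hgm := gg_measurable
  have hgi : ∀ w : ℝ → ℝ, Measurable w → Integrable (fun x => gg (w x) ^ 2) μ := by
    intro w hw
    refine Integrable.of_bound (by fun_prop) 1 (Eventually.of_forall fun x => ?_)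
    rw [norm_pow, Real.norm_eq_abs]
    exact pow_le_one₀ (abs_nonneg _) (gg_abs_le_one _)
  have h := tendsto_integral_filter_of_dominated_convergence (μ := μ) (l := 𝓝[≠] (0:ℝ))
    (F := fun θ x => (gg (θ * v x) ^ 2 + gg (-θ * v x) ^ 2) / θ ^ 2)
    (f := fun x => v x ^ 2 / 4) (fun x => v x ^ 2 / 4)
    (Eventually.of_forall fun θ => by fun_prop)
    (by
      filter_upwards [self_mem_nhdsWithin] with θ hθ
      have hθ : θ ≠ 0 := hθ
      refine Eventually.of_forall fun x => ?_
      rw [Real.norm_of_nonneg (by positivity), div_le_iff₀ (by positivity), neg_mul]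
      refine (gg_sq_sum_le _).trans (le_of_eq (by ring)))
    (hv2.div_const 4)
    (Eventually.of_forall fun x => gg_limit (v x))
  rw [integral_div] at h
  refine h.congr fun θ => ?_
  rw [integral_div, integral_add (hgi _ (by fun_prop)) (hgi _ (by fun_prop))]

/-- The indicator of `D_θ`. -/
def ind2 (I : Set ℝ) (r θ x : ℝ) : ℝ :=
  Set.indicator I (fun _ => (1 : ℝ)) (x + r * θ) *
    Set.indicator I (fun _ => (1 : ℝ)) (x + (1 - r) * θ)

/-- Square root of the density. -/
def sden (I : Set ℝ) (V : ℝ → ℝ) (x : ℝ) : ℝ :=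
  Set.indicator I (fun y => Real.exp (-V y / 2) / √(∫ y in I, Real.exp (-V y))) x

lemma ind2_cases (I : Set ℝ) (hI : I.OrdConnected) (r θ x : ℝ) (hr : 1 < r) :
    ind2 I r θ x = 0 ∨ (ind2 I r θ x = 1 ∧ x ∈ I ∧ x + θ ∈ I) := by
  classical
  by_cases h1 : x + r * θ ∈ I
  · by_cases h2 : x + (1 - r) * θ ∈ I
    · right
      refine ⟨by simp [ind2, h1, h2], ?_, ?_⟩
      · rcases le_total 0 θ with h | h
        · exact hI.out h2 h1 ⟨by nlinarith, by nlinarith⟩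
        · exact hI.out h1 h2 ⟨by nlinarith, by nlinarith⟩
      · rcases le_total 0 θ with h | h
        · exact hI.out h2 h1 ⟨by nlinarith, by nlinarith⟩
        · exact hI.out h1 h2 ⟨by nlinarith, by nlinarith⟩
    · left; simp [ind2, h2]
  · left; simp [ind2, h1]

lemma ind2_neg (I : Set ℝ) (r θ x : ℝ) : ind2 I r (-θ) (x + θ) = ind2 I r θ x := by
  unfold ind2
  rw [show x + θ + r * -θ = x + (1 - r) * θ by ring,
    show x + θ + (1 - r) * -θ = x + r * θ by ring, mul_comm]

lemma ind2_measurable (I : Set ℝ) (hI : MeasurableSet I) (r : ℝ) :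
    Measurable (fun q : ℝ × ℝ => ind2 I r q.1 q.2) := by
  unfold ind2
  have h : Measurable (Set.indicator I (fun _ => (1 : ℝ))) := measurable_const.indicator hI
  exact (h.comp (by fun_prop : Measurable fun q : ℝ × ℝ => q.2 + r * q.1)).mul
    (h.comp (by fun_prop : Measurable fun q : ℝ × ℝ => q.2 + (1 - r) * q.1))

lemma sden_nonneg (I : Set ℝ) (V : ℝ → ℝ) (x : ℝ) : 0 ≤ sden I V x :=
  Set.indicator_nonneg (fun y _ => by positivity) x

lemma sden_measurable (I : Set ℝ) (hI : MeasurableSet I) (V : ℝ → ℝ) (hV : Measurable V) :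
    Measurable (sden I V) := by
  unfold sden
  exact Measurable.indicator (by fun_prop) hI

lemma piDenI_eq (I : Set ℝ) (V : ℝ → ℝ) (x : ℝ) : piDenI I V x = sden I V x ^ 2 := by
  have hc : 0 ≤ ∫ y in I, Real.exp (-V y) := integral_nonneg fun y => (Real.exp_pos _).le
  unfold piDenI sden
  by_cases h : x ∈ I
  · rw [Set.indicator_of_mem h, Set.indicator_of_mem h, div_pow, Real.sq_sqrt hc,
      ← Real.exp_nat_mul]
    congr 2; push_cast; ring
  · simp [h]

lemma sden_sq_integrable (I : Set ℝ) (hI : MeasurableSet I) (V : ℝ → ℝ)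
    (hVint : IntegrableOn (fun y => Real.exp (-V y)) I) :
    Integrable (fun x => sden I V x ^ 2) := by
  have : (fun x => sden I V x ^ 2) = fun x => piDenI I V x := by
    funext x; rw [piDenI_eq]
  rw [this]
  unfold piDenI
  exact ((integrable_indicator_iff hI).mpr hVint).div_const _

/-- Integrand `1_D ζ`. -/
def phi (I : Set ℝ) (V : ℝ → ℝ) (r θ x : ℝ) : ℝ :=
  ind2 I r θ x * (Real.exp ((V x - V (x + θ)) / 2) - 1)

/-- The clipped increment `1_D ΔV`. -/
def uu (I : Set ℝ) (V : ℝ → ℝ) (r θ x : ℝ) : ℝ :=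
  (V (x + θ) - V x) * Set.indicator I (fun _ => (1 : ℝ)) (x + r * θ) *
            Set.indicator I (fun _ => (1 : ℝ)) (x + (1 - r) * θ)

lemma uu_eq (I : Set ℝ) (V : ℝ → ℝ) (r θ x : ℝ) :
    uu I V r θ x = ind2 I r θ x * (V (x + θ) - V x) := by
  unfold uu ind2; ring

lemma phi_measurable (I : Set ℝ) (hI : MeasurableSet I) (V : ℝ → ℝ) (hV : Measurable V) (r : ℝ) :
    Measurable (fun q : ℝ × ℝ => phi I V r q.1 q.2) := by
  unfold phi
  exact (ind2_measurable I hI r).mul (by fun_prop)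

lemma uu_measurable (I : Set ℝ) (hI : MeasurableSet I) (V : ℝ → ℝ) (hV : Measurable V) (r : ℝ) :
    Measurable (fun q : ℝ × ℝ => uu I V r q.1 q.2) := by
  simp only [uu_eq]
  exact (ind2_measurable I hI r).mul (by fun_prop)

lemma sden_mul_exp (I : Set ℝ) (V : ℝ → ℝ) (x y : ℝ) (hx : x ∈ I) (hy : y ∈ I) :
    sden I V x * Real.exp ((V x - V y) / 2) = sden I V y := by
  unfold sden
  rw [Set.indicator_of_mem hx, Set.indicator_of_mem hy, div_mul_eq_mul_div, ← Real.exp_add]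
  congr 2; ring

lemma phi_den (I : Set ℝ) (hI : I.OrdConnected) (V : ℝ → ℝ) (r θ x : ℝ) (hr : 1 < r) :
    sden I V x ^ 2 * phi I V r θ x =
      ind2 I r θ x * (sden I V x * sden I V (x + θ) - sden I V x ^ 2) := by
  unfold phi
  rcases ind2_cases I hI r θ x hr with h | ⟨h, hx, hy⟩
  · rw [h]; ring
  · rw [← sden_mul_exp I V x (x + θ) hx hy]; ring

lemma gg_den (I : Set ℝ) (hI : I.OrdConnected) (V : ℝ → ℝ) (r θ x : ℝ) (hr : 1 < r) :
    sden I V x ^ 2 * gg (uu I V r θ x) ^ 2 =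
      ind2 I r θ x * (max (sden I V x - sden I V (x + θ)) 0) ^ 2 := by
  rw [uu_eq]
  rcases ind2_cases I hI r θ x hr with h | ⟨h, hx, hy⟩
  · rw [h]; simp [gg_zero]
  · have h0 := sden_nonneg I V x
    rw [h, one_mul, one_mul, ← sden_mul_exp I V x (x + θ) hx hy]
    rcases le_total (V (x + θ) - V x) 0 with h | h
    · rw [gg_nonpos_arg h]
      have : 1 ≤ Real.exp ((V x - V (x + θ)) / 2) := Real.one_le_exp (by linarith)
      rw [max_eq_right (by nlinarith)]; ring
    · have : Real.exp ((V x - V (x + θ)) / 2) ≤ 1 := Real.exp_le_one_iff.mpr (by linarith)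
      rw [max_eq_left (by nlinarith), gg, max_eq_left h,
        show -(V (x + θ) - V x) / 2 = (V x - V (x + θ)) / 2 by ring]
      ring

lemma piMeasure_integral (I : Set ℝ) (hI : MeasurableSet I) (V : ℝ → ℝ) (hV : Measurable V)
    (f : ℝ → ℝ) : ∫ x, f x ∂(piMeasureI I V) = ∫ x, sden I V x ^ 2 * f x := by
  unfold piMeasureI
  simp only [piDenI_eq]
  have := sden_measurable I hI V hV
  rw [integral_withDensity_eq_integral_toReal_smul (by fun_prop)
    (Eventually.of_forall fun x => ENNReal.ofReal_lt_top)]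
  refine integral_congr_ae (Eventually.of_forall fun x => ?_)
  simp only [smul_eq_mul]
  rw [ENNReal.toReal_ofReal (sq_nonneg _)]

lemma piMeasure_integrable (I : Set ℝ) (hI : MeasurableSet I) (V : ℝ → ℝ) (hV : Measurable V)
    (f : ℝ → ℝ) : Integrable f (piMeasureI I V) ↔ Integrable (fun x => sden I V x ^ 2 * f x) := by
  unfold piMeasureI
  simp only [piDenI_eq]
  have := sden_measurable I hI V hV
  rw [integrable_withDensity_iff_integrable_smul' (by fun_prop)
    (Eventually.of_forall fun x => ENNReal.ofReal_lt_top)]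
  refine integrable_congr (Eventually.of_forall fun x => ?_)
  simp only [smul_eq_mul]
  rw [ENNReal.toReal_ofReal (sq_nonneg _)]

lemma piMeasure_finite (I : Set ℝ) (hI : MeasurableSet I) (V : ℝ → ℝ)
    (hVint : IntegrableOn (fun y => Real.exp (-V y)) I) : IsFiniteMeasure (piMeasureI I V) := by
  unfold piMeasureI
  simp only [piDenI_eq]
  exact isFiniteMeasure_withDensity_ofReal (sden_sq_integrable I hI V hVint).2

lemma phi_integrable (I : Set ℝ) (hI : MeasurableSet I) (hIo : I.OrdConnected)
    (V : ℝ → ℝ) (hV : Measurable V) (hVint : IntegrableOn (fun y => Real.exp (-V y)) I)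
    (r θ : ℝ) (hr : 1 < r) :
    Integrable (fun x => phi I V r θ x) (piMeasureI I V) ∧
    ∫ x, ‖phi I V r θ x‖ ∂(piMeasureI I V) ≤ 3 * ∫ x, sden I V x ^ 2 := by
  have hm := sden_measurable I hI V hV
  have hi := sden_sq_integrable I hI V hVint
  have hi' := hi.comp_add_right θ
  have hphim : Measurable (fun x => phi I V r θ x) :=
    (phi_measurable I hI V hV r).comp (by fun_prop : Measurable fun x : ℝ => (θ, x))
  have hint : Integrable (fun x => 2 * sden I V x ^ 2 + sden I V (x + θ) ^ 2) :=
    (hi.const_mul 2).add hi'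
  have hbd : ∀ x, ‖sden I V x ^ 2 * phi I V r θ x‖ ≤
      2 * sden I V x ^ 2 + sden I V (x + θ) ^ 2 := by
    intro x
    rw [phi_den I hIo V r θ x hr, Real.norm_eq_abs]
    have h1 := sden_nonneg I V x
    have h2 := sden_nonneg I V (x + θ)
    rcases ind2_cases I hIo r θ x hr with h | ⟨h, -, -⟩
    · rw [h]; simp; positivity
    · rw [h, one_mul, abs_le]
      constructor <;> nlinarith [sq_nonneg (sden I V x - sden I V (x + θ))]
  have h1 : Integrable (fun x => sden I V x ^ 2 * phi I V r θ x) :=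
    hint.mono' (by fun_prop) (Eventually.of_forall hbd)
  refine ⟨(piMeasure_integrable I hI V hV _).mpr h1, ?_⟩
  rw [piMeasure_integral I hI V hV]
  calc ∫ x, sden I V x ^ 2 * ‖phi I V r θ x‖ = ∫ x, ‖sden I V x ^ 2 * phi I V r θ x‖ := by
        congr 1; funext x; rw [norm_mul, Real.norm_of_nonneg (sq_nonneg _)]
    _ ≤ ∫ x, (2 * sden I V x ^ 2 + sden I V (x + θ) ^ 2) :=
        integral_mono h1.norm hint hbd
    _ = 3 * ∫ x, sden I V x ^ 2 := by
        rw [integral_add (hi.const_mul 2) hi', integral_const_mul,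
          integral_add_right_eq_self (fun x => sden I V x ^ 2) θ]
        ring

/-- The symmetrization identity. -/
lemma symm_identity (I : Set ℝ) (hI : MeasurableSet I) (hIo : I.OrdConnected)
    (V : ℝ → ℝ) (hV : Measurable V) (hVint : IntegrableOn (fun y => Real.exp (-V y)) I)
    (r θ : ℝ) (hr : 1 < r) :
    (∫ x, phi I V r θ x ∂(piMeasureI I V)) + ∫ x, phi I V r (-θ) x ∂(piMeasureI I V) =
    -((∫ x, gg (uu I V r θ x) ^ 2 ∂(piMeasureI I V)) +
      ∫ x, gg (uu I V r (-θ) x) ^ 2 ∂(piMeasureI I V)) := by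
  have := piMeasure_finite I hI V hVint
  have hgi : ∀ η, Integrable (fun x => gg (uu I V r η x) ^ 2) (piMeasureI I V) := by
    intro η
    have hum : Measurable (fun x => uu I V r η x) :=
      (uu_measurable I hI V hV r).comp (by fun_prop : Measurable fun x : ℝ => (η, x))
    refine Integrable.of_bound (by fun_prop) 1 (Eventually.of_forall fun x => ?_)
    rw [norm_pow, Real.norm_eq_abs]
    exact pow_le_one₀ (abs_nonneg _) (gg_abs_le_one _)
  have hphi := fun η => (piMeasure_integrable I hI V hV _).mp
    (phi_integrable I hI hIo V hV hVint r η hr).1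
  have hg := fun η => (piMeasure_integrable I hI V hV _).mp (hgi η)
  simp only [piMeasure_integral I hI V hV]
  rw [← integral_add_right_eq_self (fun x => sden I V x ^ 2 * phi I V r (-θ) x) θ,
    ← integral_add_right_eq_self (fun x => sden I V x ^ 2 * gg (uu I V r (-θ) x) ^ 2) θ,
    ← integral_add (hphi θ) ((hphi (-θ)).comp_add_right θ),
    ← integral_add (hg θ) ((hg (-θ)).comp_add_right θ), ← integral_neg]
  congr 1
  funext x
  rw [phi_den I hIo V r θ x hr, phi_den I hIo V r (-θ) (x + θ) hr, gg_den I hIo V r θ x hr,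
    gg_den I hIo V r (-θ) (x + θ) hr, ind2_neg, add_neg_cancel_right]
  rcases le_total (sden I V x) (sden I V (x + θ)) with h | h
  · rw [max_eq_right (by linarith), max_eq_left (by linarith)]; ring
  · rw [max_eq_left (by linarith), max_eq_right (by linarith)]; ring

/-- Core limit with abstract data. -/
lemma core_limit (μ : Measure ℝ) [IsFiniteMeasure μ] (u : ℝ → ℝ → ℝ) (v : ℝ → ℝ)
    (hum : Measurable (fun q : ℝ × ℝ => u q.1 q.2)) (hv : Measurable v)
    (hu0 : ∀ x, u 0 x = 0)
    (hv2 : Integrable (fun x => v x ^ 2) μ) (B β ℓ : ℝ) (hB : 0 ≤ B) (hβ : 1 < β) (hℓ : 0 < ℓ)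
    (he : ∀ θ : ℝ, θ ≠ 0 → Integrable (fun x => (u θ x - θ * v x) ^ 2) μ ∧
      ∫ x, (u θ x - θ * v x) ^ 2 ∂μ ≤ B * (θ ^ 2 * (|θ| ^ (β - 1)) ^ 2)) :
    Tendsto (fun d : ℕ => ∫ z, (d : ℝ) * ((∫ x, gg (u (ℓ * z / √d) x) ^ 2 ∂μ) +
        ∫ x, gg (u (-(ℓ * z / √d)) x) ^ 2 ∂μ) ∂(gaussianReal 0 1)) atTop
      (𝓝 (ℓ ^ 2 * (∫ x, v x ^ 2 ∂μ) / 4)) := by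
  set K := ∫ x, v x ^ 2 ∂μ with hK
  have hK0 : 0 ≤ K := integral_nonneg fun x => sq_nonneg _
  set G : ℝ → ℝ := fun θ => ∫ x, gg (u θ x) ^ 2 ∂μ with hG
  set H : ℝ → ℝ := fun θ => ∫ x, gg (θ * v x) ^ 2 ∂μ with hH
  have hGm : Measurable G := by
    have : StronglyMeasurable (fun q : ℝ × ℝ => gg (u q.2 q.1) ^ 2) := by
      apply Measurable.stronglyMeasurable
      have : Measurable (fun q : ℝ × ℝ => u q.2 q.1) := hum.comp measurable_swap
      fun_prop
    exact this.integral_prod_left'.measurable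
  have hu1 : ∀ θ, Measurable (u θ) := fun θ =>
    hum.comp (by fun_prop : Measurable fun x : ℝ => (θ, x))
  have hGH : ∀ θ : ℝ, θ ≠ 0 → |G θ - H θ| ≤
      θ ^ 2 / 4 * (B * (|θ| ^ (β - 1)) ^ 2 + (B + K) * |θ| ^ (β - 1)) := fun θ hθ =>
    G_sub_H μ θ _ B (Real.rpow_pos_of_pos (abs_pos.mpr hθ) _) (u θ) v (hu1 θ) hv hv2
      (he θ hθ).1 (he θ hθ).2
  have hG0 : G 0 = 0 := by simp [hG, hu0, gg_zero]
  have hGnn : ∀ θ, 0 ≤ G θ := fun θ => integral_nonneg fun x => sq_nonneg _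
  have hHle : ∀ θ, H θ ≤ θ ^ 2 / 4 * K := by
    intro θ
    rw [hK, ← integral_const_mul]
    refine integral_mono_of_nonneg (Eventually.of_forall fun x => sq_nonneg _)
      (hv2.const_mul _) (Eventually.of_forall fun x => ?_)
    refine (gg_sq_le _).trans (le_of_eq (by ring))
  -- limit of the ratio
  have hR : Tendsto (fun θ => (G θ + G (-θ)) / θ ^ 2) (𝓝[≠] 0) (𝓝 (K / 4)) := by
    have hHl : Tendsto (fun θ => (H θ + H (-θ)) / θ ^ 2) (𝓝[≠] 0) (𝓝 (K / 4)) :=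
      H_limit μ v hv hv2
    have hs : Tendsto (fun θ : ℝ => |θ| ^ (β - 1)) (𝓝[≠] 0) (𝓝 0) := by
      have hc : Continuous (fun θ : ℝ => |θ| ^ (β - 1)) :=
        continuous_abs.rpow_const fun x => Or.inr (by linarith)
      have := hc.tendsto 0
      rw [abs_zero, Real.zero_rpow (by linarith)] at this
      exact this.mono_left nhdsWithin_le_nhds
    have hdiff : Tendsto (fun θ => (G θ + G (-θ)) / θ ^ 2 - (H θ + H (-θ)) / θ ^ 2)
        (𝓝[≠] 0) (𝓝 0) := by
      have hb : Tendsto (fun θ : ℝ => (B * (|θ| ^ (β - 1)) ^ 2 + (B + K) * |θ| ^ (β - 1)) / 2)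
          (𝓝[≠] 0) (𝓝 0) := by
        have := (((hs.pow 2).const_mul B).add (hs.const_mul (B + K))).div_const 2
        simpa using this
      refine squeeze_zero_norm' ?_ hb
      filter_upwards [self_mem_nhdsWithin] with θ hθ
      have hθ : θ ≠ 0 := hθ
      have h1 := hGH θ hθ
      have h2 := hGH (-θ) (neg_ne_zero.mpr hθ)
      rw [abs_neg, neg_sq] at h2
      rw [← sub_div, norm_div, Real.norm_eq_abs, Real.norm_of_nonneg (sq_nonneg θ),
        div_le_iff₀ (by positivity)]
      have h3 : |G θ + G (-θ) - (H θ + H (-θ))| ≤ |G θ - H θ| + |G (-θ) - H (-θ)| := by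
        rw [show G θ + G (-θ) - (H θ + H (-θ)) = (G θ - H θ) + (G (-θ) - H (-θ)) by ring]
        exact abs_add_le _ _
      refine h3.trans ((add_le_add h1 h2).trans (le_of_eq (by ring)))
    have := hdiff.add hHl
    simpa using this
  have hlim : ∫ z, z ^ 2 * (ℓ ^ 2 * (K / 4)) ∂(gaussianReal 0 1) = ℓ ^ 2 * K / 4 := by
    have hvar : ∫ z, z ^ 2 ∂(gaussianReal 0 1) = 1 := by
      have h := variance_id_gaussianReal (μ := 0) (v := 1)
      rw [variance_eq_integral (by fun_prop)] at h
      simpa using h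
    rw [integral_mul_const, hvar]; ring
  rw [← hlim]
  have hmom : ∀ s : ℝ, 0 < s → Integrable (fun z : ℝ => |z| ^ s) (gaussianReal 0 1) := by
    intro s hs
    have h := (memLp_id_gaussianReal' (μ := 0) (v := 1) (ENNReal.ofReal s)
      ENNReal.ofReal_ne_top).integrable_norm_rpow
      (by simpa using hs) ENNReal.ofReal_ne_top
    rw [ENNReal.toReal_ofReal hs.le] at h
    simpa using h
  have hz2 : Integrable (fun z : ℝ => z ^ 2) (gaussianReal 0 1) := by
    have := hmom 2 (by norm_num)
    simpa using this
  refine tendsto_integral_filter_of_dominated_convergence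
    (fun z => ℓ ^ 2 / 2 * (B * (ℓ ^ (β - 1)) ^ 2 * |z| ^ (2 * β) +
      (B + K) * ℓ ^ (β - 1) * |z| ^ (β + 1) + K * z ^ 2)) ?_ ?_ ?_ ?_
  · exact Eventually.of_forall fun d => by
      apply Measurable.aestronglyMeasurable
      change Measurable fun z => (d : ℝ) * (G (ℓ * z / √d) + G (-(ℓ * z / √d)))
      fun_prop
  · filter_upwards [eventually_ge_atTop 1] with d hd
    refine Eventually.of_forall fun z => ?_
    have hd1 : (1:ℝ) ≤ d := by exact_mod_cast hd
    have hsd : 1 ≤ √(d:ℝ) := Real.one_le_sqrt.mpr hd1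
    by_cases hz : z = 0
    · subst hz
      have e1 : (0:ℝ) ^ (2 * β) = 0 := Real.zero_rpow (by linarith)
      have e2 : (0:ℝ) ^ (β + 1) = 0 := Real.zero_rpow (by linarith)
      change ‖(d:ℝ) * (G (ℓ * 0 / √d) + G (-(ℓ * 0 / √d)))‖ ≤ _
      simp [hG0, e1, e2]
    set θ := ℓ * z / √(d:ℝ) with hθdef
    have hθ : θ ≠ 0 := by
      rw [hθdef]; positivity
    have hθ2 : (d:ℝ) * θ ^ 2 = ℓ ^ 2 * z ^ 2 := by
      rw [hθdef, div_pow, Real.sq_sqrt (by linarith)]; field_simp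
    have hsle : |θ| ^ (β - 1) ≤ ℓ ^ (β - 1) * |z| ^ (β - 1) := by
      rw [← Real.mul_rpow hℓ.le (abs_nonneg z)]
      refine Real.rpow_le_rpow (abs_nonneg _) ?_ (by linarith)
      rw [hθdef, abs_div, abs_mul, abs_of_pos hℓ, abs_of_nonneg (Real.sqrt_nonneg _)]
      exact div_le_self (by positivity) hsd
    have hs0 : 0 ≤ |θ| ^ (β - 1) := by positivity
    change ‖(d:ℝ) * (G θ + G (-θ))‖ ≤ _
    rw [Real.norm_of_nonneg (by have := hGnn θ; have := hGnn (-θ); positivity)]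
    have h1 := (abs_le.mp (hGH θ hθ)).2
    have h2 := (abs_le.mp (hGH (-θ) (neg_ne_zero.mpr hθ))).2
    have h3 := hHle θ
    have h4 := hHle (-θ)
    rw [abs_neg, neg_sq] at h2
    rw [neg_sq] at h4
    have hz' : 0 < |z| := abs_pos.mpr hz
    have p1 : |z| ^ (2 * β) = z ^ 2 * (|z| ^ (β - 1)) ^ 2 := by
      rw [← sq_abs z, ← Real.rpow_natCast (|z| ^ (β - 1)) 2, ← Real.rpow_mul hz'.le,
        ← Real.rpow_natCast |z| 2, ← Real.rpow_add hz']
      congr 1; push_cast; ring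
    have p2 : |z| ^ (β + 1) = z ^ 2 * |z| ^ (β - 1) := by
      rw [← sq_abs z, ← Real.rpow_natCast |z| 2, ← Real.rpow_add hz']
      congr 1; push_cast; ring
    calc (d:ℝ) * (G θ + G (-θ))
        ≤ d * (θ ^ 2 / 2 * (B * (|θ| ^ (β - 1)) ^ 2 + (B + K) * |θ| ^ (β - 1) + K)) := by
          apply mul_le_mul_of_nonneg_left _ (by linarith)
          linarith
      _ = ℓ ^ 2 * z ^ 2 / 2 * (B * (|θ| ^ (β - 1)) ^ 2 + (B + K) * |θ| ^ (β - 1) + K) := by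
          rw [← hθ2]; ring
      _ ≤ ℓ ^ 2 * z ^ 2 / 2 * (B * (ℓ ^ (β - 1) * |z| ^ (β - 1)) ^ 2 +
            (B + K) * (ℓ ^ (β - 1) * |z| ^ (β - 1)) + K) := by gcongr
      _ = _ := by rw [p1, p2]; ring
  · exact (((hmom _ (by linarith)).const_mul _).add ((hmom _ (by linarith)).const_mul _) |>.add
      (hz2.const_mul _)).const_mul _
  · refine Eventually.of_forall fun z => ?_
    change Tendsto (fun d : ℕ => (d:ℝ) * (G (ℓ * z / √d) + G (-(ℓ * z / √d)))) atTop _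
    by_cases hz : z = 0
    · subst hz; simp [hG0]
    have hθt : Tendsto (fun d : ℕ => ℓ * z / √(d:ℝ)) atTop (𝓝[≠] 0) := by
      refine tendsto_nhdsWithin_iff.mpr ⟨?_, ?_⟩
      · exact Tendsto.div_atTop tendsto_const_nhds
          (Real.tendsto_sqrt_atTop.comp tendsto_natCast_atTop_atTop)
      · filter_upwards [eventually_ge_atTop 1] with d hd
        have hd1 : (0:ℝ) < d := by exact_mod_cast hd
        have : ℓ * z / √(d:ℝ) ≠ 0 := by positivity
        exact this
    have h := (hR.comp hθt).const_mul (ℓ ^ 2 * z ^ 2)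
    rw [show z ^ 2 * (ℓ ^ 2 * (K / 4)) = ℓ ^ 2 * z ^ 2 * (K / 4) by ring]
    refine h.congr' ?_
    filter_upwards [eventually_ge_atTop 1] with d hd
    have hd1 : (0:ℝ) < d := by exact_mod_cast hd
    simp only [Function.comp]
    rw [div_pow (ℓ * z), Real.sq_sqrt hd1.le]
    field_simp

/-- Lemma (interval case): `lim_d 2d · E[1_{𝒟_I} ζ^d(X,Z)] = -ℓ² I/4` with
`I = ∫ V̇² π`. -/
theorem stmt_18
    (I : Set ℝ) (hIo : IsOpen I) (hIoc : I.OrdConnected)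
    (V Vdot : ℝ → ℝ) (hV : Measurable V) (hVdot : Measurable Vdot)
    (hVint : IntegrableOn (fun y => Real.exp (-V y)) I)
    (r : ℝ) (hr : 1 < r)
    (p C β : ℝ) (hp : 4 < p) (hC : 0 < C) (hβ : 1 < β)
    (hG1i : ∀ θ : ℝ,
      Integrable (fun x =>
        |(V (x + θ) - V x) * Set.indicator I (fun _ => (1 : ℝ)) (x + r * θ) *
            Set.indicator I (fun _ => (1 : ℝ)) (x + (1 - r) * θ) -
          θ * Vdot x| ^ p) (piMeasureI I V) ∧
      (∫ x,
        |(V (x + θ) - V x) * Set.indicator I (fun _ => (1 : ℝ)) (x + r * θ) *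
            Set.indicator I (fun _ => (1 : ℝ)) (x + (1 - r) * θ) -
          θ * Vdot x| ^ p ∂(piMeasureI I V)) ^ (1 / p) ≤ C * |θ| ^ β)
    (hG1ii : Integrable (fun x => |Vdot x| ^ (6 : ℝ)) (piMeasureI I V))
    (γ Cγ : ℝ) (hγ : 6 ≤ γ) (hCγ : 0 < Cγ)
    (hG1iii : ∀ θ : ℝ, ((piMeasureI I V) {x | x + θ ∉ I}).toReal ≤ Cγ * |θ| ^ γ)
    (ℓ : ℝ) (hℓ : 0 < ℓ) :
    Tendsto (fun d : ℕ =>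
      2 * (d : ℝ) * ∫ q : ℝ × ℝ,
        indD I r ℓ d q.1 q.2 * zeta V ℓ d q.1 q.2
        ∂((piMeasureI I V).prod (gaussianReal 0 1)))
      atTop (𝓝 (-(ℓ ^ 2 * (∫ x, (Vdot x) ^ 2 ∂(piMeasureI I V))) / 4)) := by
  have hI : MeasurableSet I := hIo.measurableSet
  have := piMeasure_finite I hI V hVint
  set μ := piMeasureI I V with hμ
  have hv2 : Integrable (fun x => Vdot x ^ 2) μ := by
    have hint : Integrable (fun x => (1:ℝ) ^ 2 + 1 ^ 2 / 1 ^ (6:ℝ) * |Vdot x| ^ (6:ℝ)) μ :=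
      (integrable_const _).add (hG1ii.const_mul _)
    refine hint.mono' (by fun_prop) (Eventually.of_forall fun x => ?_)
    rw [Real.norm_of_nonneg (sq_nonneg _)]
    exact sq_le_young 6 1 (Vdot x) (by norm_num) one_pos
  have hum := uu_measurable I hI V hV r
  have hcore := core_limit μ (fun θ x => uu I V r θ x) Vdot hum hVdot
    (fun x => by simp [uu]) hv2 (μ.real Set.univ + C ^ p) β ℓ (by positivity) hβ hℓ
    (fun θ hθ => by
      have hm : Measurable (fun x => uu I V r θ x) :=
        hum.comp (by fun_prop : Measurable fun x : ℝ => (θ, x))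
      exact e_sq_bound μ p C β θ hp hC hθ (fun x => uu I V r θ x - θ * Vdot x) (by fun_prop)
        (hG1i θ).1 (hG1i θ).2)
  have hneg := hcore.neg
  rw [show -(ℓ ^ 2 * (∫ x, (Vdot x) ^ 2 ∂μ)) / 4 = -(ℓ ^ 2 * (∫ x, (Vdot x) ^ 2 ∂μ) / 4) by ring]
  refine hneg.congr fun d => ?_
  have hfun : ∀ x z : ℝ, indD I r ℓ d x z * zeta V ℓ d x z = phi I V r (ℓ * z / √d) x := by
    intro x z
    unfold indD zeta phi ind2
    rw [show r * ℓ * z / √(d:ℝ) = r * (ℓ * z / √d) by ring,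
      show (1 - r) * ℓ * z / √(d:ℝ) = (1 - r) * (ℓ * z / √d) by ring]
  simp only [hfun]
  set A : ℝ → ℝ := fun θ => ∫ x, phi I V r θ x ∂μ with hA
  have hpm := phi_measurable I hI V hV r
  have hprodm : Measurable (fun q : ℝ × ℝ => phi I V r (ℓ * q.2 / √d) q.1) :=
    hpm.comp (by fun_prop : Measurable fun q : ℝ × ℝ => (ℓ * q.2 / √(d:ℝ), q.1))
  have hprodi : Integrable (fun q : ℝ × ℝ => phi I V r (ℓ * q.2 / √d) q.1)
      (μ.prod (gaussianReal 0 1)) := by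
    refine (integrable_prod_iff' hprodm.aestronglyMeasurable).mpr ⟨?_, ?_⟩
    · exact Eventually.of_forall fun z =>
        (phi_integrable I hI hIoc V hV hVint r (ℓ * z / √d) hr).1
    · refine Integrable.of_bound ?_ (3 * ∫ x, sden I V x ^ 2) (Eventually.of_forall fun z => ?_)
      · exact (hprodm.norm.stronglyMeasurable.integral_prod_left').aestronglyMeasurable
      · rw [Real.norm_of_nonneg (integral_nonneg fun x => norm_nonneg _)]
        exact (phi_integrable I hI hIoc V hV hVint r (ℓ * z / √d) hr).2
  have hAi : Integrable (fun z => A (ℓ * z / √d)) (gaussianReal 0 1) := hprodi.integral_prod_right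
  have hgneg : Measure.map (fun x => -x) (gaussianReal 0 1) = gaussianReal 0 1 := by
    rw [gaussianReal_map_neg, neg_zero]
  have hmp : MeasurePreserving (fun x : ℝ => -x) (gaussianReal 0 1) (gaussianReal 0 1) :=
    ⟨measurable_neg, hgneg⟩
  have hAi' : Integrable (fun z => A (-(ℓ * z / √d))) (gaussianReal 0 1) := by
    have := hmp.integrable_comp_of_integrable hAi
    refine this.congr (Eventually.of_forall fun z => ?_)
    simp only [Function.comp]
    congr 1; ring
  have hAeq : ∫ z, A (-(ℓ * z / √d)) ∂(gaussianReal 0 1) =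
      ∫ z, A (ℓ * z / √d) ∂(gaussianReal 0 1) := by
    have := hmp.integral_comp (Homeomorph.neg ℝ).measurableEmbedding (fun z => A (ℓ * z / √d))
    rw [← this]
    congr 1; funext z; congr 1; ring
  rw [integral_prod_symm _ hprodi]
  change _ = 2 * (d:ℝ) * ∫ z, A (ℓ * z / √d) ∂(gaussianReal 0 1)
  rw [integral_const_mul]
  have hS : ∀ z : ℝ, (∫ x, gg (uu I V r (ℓ * z / √d) x) ^ 2 ∂μ) +
        ∫ x, gg (uu I V r (-(ℓ * z / √d)) x) ^ 2 ∂μ =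
      -(A (ℓ * z / √d) + A (-(ℓ * z / √d))) := by
    intro z
    have := symm_identity I hI hIoc V hV hVint r (ℓ * z / √d) hr
    simp only [hA]
    linarith
  simp only [hS]
  rw [integral_neg, integral_add hAi hAi', hAeq]
  ring
end
end
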